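/- Let q be an odd prime power with q > 3. Then the weak normal covering number of PSp_4(q) is at least 3: for any two proper subgroups H and K of PSp_4(q) there exists an element g of PSp_4(q) such that phi(g) lies in neither H nor K for every automorphism phi of PSp_4(q). -/

import Mathlib

open Module

section PSp
variable {F V : Type*} [Field F] [AddCommGroup V] [Module F V]

structure Sy (ω : V →ₗ[F] V →ₗ[F] F) : Prop where
  alt : ∀ v, ω v v = 0
  nd : ∀ v, (∀ w, ω v w = 0) → v = 0
  dim : finrank F V = 4

def Tv (ω : V →ₗ[F] V →ₗ[F] F) (c : F) (x : V) : V → V := fun v => v + (c * ω v x) • x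
def Sv (ω : V →ₗ[F] V →ₗ[F] F) (x z : V) : V → V := fun v => v + ω v x • z + ω v z • x
def Has (H : Subgroup (V ≃ₗ[F] V)) (f : V → V) : Prop := ∃ g ∈ H, ∀ v, g v = f v
def IsoS (ω : V →ₗ[F] V →ₗ[F] F) (H : Subgroup (V ≃ₗ[F] V)) : Prop :=
  ∀ g ∈ H, ∀ v w, ω (g v) (g w) = ω v w
def AllS (ω : V →ₗ[F] V →ₗ[F] F) (H : Subgroup (V ≃ₗ[F] V)) : Prop :=
  ∀ g : V ≃ₗ[F] V, (∀ v w, ω (g v) (g w) = ω v w) → g ∈ H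

variable {ω : V →ₗ[F] V →ₗ[F] F} {H : Subgroup (V ≃ₗ[F] V)}

theorem Sy.skew (hω : Sy ω) (v w : V) : ω v w = - ω w v := by
  have h := hω.alt (v + w)
  simp only [map_add, LinearMap.add_apply, hω.alt, zero_add, add_zero] at h
  linear_combination h

theorem Sy.skew0 (hω : Sy ω) {v w : V} (h : ω v w = 0) : ω w v = 0 := by
  rw [hω.skew, h, neg_zero]

theorem Sy.nd' (hω : Sy ω) {v : V} (hv : v ≠ 0) : ∃ w, ω v w ≠ 0 := by
  by_contra h
  push Not at h
  exact hv (hω.nd v h)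

theorem Sy.nd1 (hω : Sy ω) {v : V} (hv : v ≠ 0) : ∃ w, ω v w = 1 := by
  obtain ⟨w, hw⟩ := hω.nd' hv
  exact ⟨(ω v w)⁻¹ • w, by simp [hw]⟩

theorem Has.mul {f g : V → V} (hf : Has H f) (hg : Has H g) : Has H (fun v => f (g v)) := by
  obtain ⟨a, ha, ha'⟩ := hf
  obtain ⟨b, hb, hb'⟩ := hg
  exact ⟨a * b, H.mul_mem ha hb, fun v => by simp [ha', hb']⟩

theorem Has.inv {f g : V → V} (hf : Has H f) (h : ∀ v, f (g v) = v) : Has H g := by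
  obtain ⟨a, ha, ha'⟩ := hf
  refine ⟨a⁻¹, H.inv_mem ha, fun v => ?_⟩
  have : a (g v) = v := by rw [ha', h]
  rw [← this]
  conv_rhs => rw [this]
  exact a.symm_apply_apply (g v)

theorem Has.congr {f g : V → V} (hf : Has H f) (h : ∀ v, f v = g v) : Has H g := by
  obtain ⟨a, ha, ha'⟩ := hf
  exact ⟨a, ha, fun v => by rw [ha', h]⟩

theorem Has.of {h : V ≃ₗ[F] V} (hh : h ∈ H) : Has H h := ⟨h, hh, fun _ => rfl⟩

theorem inv_app (h : V ≃ₗ[F] V) (v : V) : h⁻¹ (h v) = v := h.symm_apply_apply v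
theorem app_inv (h : V ≃ₗ[F] V) (v : V) : h (h⁻¹ v) = v := h.apply_symm_apply v

theorem Has.Tconj (hI : IsoS ω H) {h : V ≃ₗ[F] V} (hh : h ∈ H) {c : F} {x : V}
    (hT : Has H (Tv ω c x)) : Has H (Tv ω c (h x)) := by
  refine (((Has.of hh).mul hT).mul (Has.of (H.inv_mem hh))).congr fun v => ?_
  have : ω (h⁻¹ v) x = ω v (h x) := by
    rw [← hI h hh, app_inv]
  simp only [Tv, map_add, map_smul, app_inv, this]

theorem Has.Sconj (hI : IsoS ω H) {h : V ≃ₗ[F] V} (hh : h ∈ H) {x z : V}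
    (hT : Has H (Sv ω x z)) : Has H (Sv ω (h x) (h z)) := by
  refine (((Has.of hh).mul hT).mul (Has.of (H.inv_mem hh))).congr fun v => ?_
  have this (x : V) : ω (h⁻¹ v) x = ω v (h x) := by
    rw [← hI h hh, app_inv]
  simp only [Sv, map_add, map_smul, app_inv, this]

theorem Has.Tadd (hω : Sy ω) {c d : F} {x : V} (h : Has H (Tv ω c x)) (h' : Has H (Tv ω d x)) :
    Has H (Tv ω (c + d) x) := by
  refine (h.mul h').congr fun v => ?_
  simp only [Tv, map_add, map_smul, LinearMap.add_apply, LinearMap.smul_apply, hω.alt, smul_zero, add_zero]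
  module

theorem Has.Tneg (hω : Sy ω) {c : F} {x : V} (h : Has H (Tv ω c x)) : Has H (Tv ω (-c) x) := by
  refine h.inv fun v => ?_
  simp only [Tv, map_add, map_smul, LinearMap.add_apply, LinearMap.smul_apply, hω.alt, smul_zero, add_zero]
  module

theorem Has.Tsmul {c a : F} {x : V} (h : Has H (Tv ω c (a • x))) : Has H (Tv ω (c * a ^ 2) x) := by
  refine h.congr fun v => ?_
  simp only [Tv, map_smul, smul_eq_mul]
  module

theorem Tv_iso (hω : Sy ω) (c : F) (x v w : V) : ω (Tv ω c x v) (Tv ω c x w) = ω v w := by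
  simp only [Tv, map_add, map_smul, LinearMap.add_apply, LinearMap.smul_apply, hω.alt, smul_eq_mul]
  rw [hω.skew x w]; ring

theorem Sy.expand (hω : Sy ω) {e f e' f' : V} (h1 : ω e f = 1) (h2 : ω e' f' = 1)
    (h3 : ω e e' = 0) (h4 : ω e f' = 0) (h5 : ω f e' = 0) (h6 : ω f f' = 0) (v : V) :
    v = ω v f • e - ω v e • f + ω v f' • e' - ω v e' • f' := by
  have hli : LinearIndependent F ![e, f, e', f'] := by
    rw [Fintype.linearIndependent_iff]
    intro g hg
    simp only [Fin.sum_univ_four] at hg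
    simp at hg
    have a1 := congrArg (fun t => ω t f) hg
    have a2 := congrArg (fun t => ω t e) hg
    have a3 := congrArg (fun t => ω t f') hg
    have a4 := congrArg (fun t => ω t e') hg
    simp [h1, h2, h3, h4, h5, h6, hω.alt, hω.skew0 h3, hω.skew0 h4, hω.skew0 h5, hω.skew0 h6,
      hω.skew f e, hω.skew f' e'] at a1 a2 a3 a4
    intro i
    fin_cases i <;> simp [a1, a2, a3, a4]
  have hsp : v ∈ Submodule.span F (Set.range ![e, f, e', f']) := by
    rw [hli.span_eq_top_of_card_eq_finrank (by simp [hω.dim])]; trivial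
  rw [Submodule.mem_span_range_iff_exists_fun] at hsp
  obtain ⟨g, hg⟩ := hsp
  simp only [Fin.sum_univ_four] at hg
  simp at hg
  rw [← hg]
  simp [h1, h2, h3, h4, h5, h6, hω.alt, hω.skew0 h3, hω.skew0 h4, hω.skew0 h5, hω.skew0 h6,
      hω.skew f e, hω.skew f' e']

theorem Sy.complete (hω : Sy ω) {e f : V} (h1 : ω e f = 1) : ∃ e' f', ω e' f' = 1 ∧ ω e e' = 0 ∧
    ω e f' = 0 ∧ ω f e' = 0 ∧ ω f f' = 0 := by
  have hfd : FiniteDimensional F V := FiniteDimensional.of_finrank_pos (by rw [hω.dim]; norm_num)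
  have hfe : ω f e = -1 := by rw [hω.skew, h1]
  let P : V → V := fun v => v - ω v f • e + ω v e • f
  have hP1 : ∀ v, ω e (P v) = 0 := fun v => by
    simp [P, h1, hω.alt, hω.skew e v]
  have hP2 : ∀ v, ω f (P v) = 0 := fun v => by
    simp [P, hfe, hω.alt, hω.skew f v]
  have : ∃ v, v ∉ Submodule.span F (Set.range ![e, f]) := by
    by_contra! h
    have h' : Submodule.span F (Set.range ![e, f]) = ⊤ := by
      exact eq_top_iff.2 fun x _ => h x
    have := finrank_range_le_card (R := F) ![e, f]
    rw [Set.finrank, h', finrank_top, hω.dim] at this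
    simp at this
  obtain ⟨v, hv⟩ := this
  have hP0 : P v ≠ 0 := by
    intro h0
    apply hv
    rw [Submodule.mem_span_range_iff_exists_fun]
    refine ⟨![ω v f, - ω v e], ?_⟩
    simp only [Fin.sum_univ_two]
    simp
    have : v = v - P v := by rw [h0, sub_zero]
    conv_rhs => rw [this]
    simp only [P]
    module
  obtain ⟨w, hw⟩ := hω.nd1 hP0
  refine ⟨P v, P w, ?_, hP1 _, hP1 _, hP2 _, hP2 _⟩
  have : P w = w - ω w f • e + ω w e • f := rfl
  rw [this]
  simp [hω.skew0 (hP1 v), hω.skew0 (hP2 v), hw]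

/-- transitivity with centres in W -/
theorem claim1 (hω : Sy ω) (W : Submodule F V) (hW : ∀ v ∈ W, v ≠ 0 → ∃ w ∈ W, ω v w ≠ 0)
    (hT : ∀ c, ∀ x ∈ W, Has H (Tv ω c x)) {v w : V} (hv : v ∈ W) (hw : w ∈ W) (hv0 : v ≠ 0)
    (hw0 : w ≠ 0) : ∃ h ∈ H, h v = w ∧ (∀ y, (∀ z ∈ W, ω y z = 0) → h y = y) ∧ ∀ z ∈ W, h z ∈ W := by
  have key : ∀ v ∈ W, ∀ w ∈ W, ω v w ≠ 0 →
      ∃ h ∈ H, h v = w ∧ (∀ y, (∀ z ∈ W, ω y z = 0) → h y = y) ∧ ∀ z ∈ W, h z ∈ W := by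
    intro v hv w hw h
    obtain ⟨g, hg, hg'⟩ := hT (ω v w)⁻¹ (w - v) (W.sub_mem hw hv)
    refine ⟨g, hg, ?_, ?_, ?_⟩
    · rw [hg']; simp [Tv, hω.alt, h]
    · intro y hy; rw [hg']; simp [Tv, hy _ hv, hy _ hw]
    · intro z hz; rw [hg']; exact W.add_mem hz (W.smul_mem _ (W.sub_mem hw hv))
  have : ∃ z ∈ W, ω v z ≠ 0 ∧ ω z w ≠ 0 := by
    obtain ⟨z1, h1, h1'⟩ := hW v hv hv0
    obtain ⟨z2, h2, h2'⟩ := hW w hw hw0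
    rw [hω.skew, neg_ne_zero] at h2'
    by_cases a : ω z1 w = 0
    · by_cases b : ω v z2 = 0
      · exact ⟨z1 + z2, W.add_mem h1 h2, by simp [b, h1'], by simp [a, h2']⟩
      · exact ⟨z2, h2, b, h2'⟩
    · exact ⟨z1, h1, h1', a⟩
  obtain ⟨z, hz, a, b⟩ := this
  obtain ⟨g1, hg1, c1, d1, k1⟩ := key v hv z hz a
  obtain ⟨g2, hg2, c2, d2, k2⟩ := key z hz w hw b
  exact ⟨g2 * g1, H.mul_mem hg2 hg1, by simp [c1, c2], fun y hy => by simp [d1 y hy, d2 y hy],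
    fun z hz => k2 _ (k1 _ hz)⟩

theorem claim2 (hω : Sy ω) (W : Submodule F V)
    (hT : ∀ c, ∀ x ∈ W, Has H (Tv ω c x)) {e f f' : V} (he : e ∈ W) (hf : f ∈ W) (hf' : f' ∈ W)
    (h1 : ω e f = 1) (h2 : ω e f' = 1) :
    ∃ h ∈ H, h e = e ∧ h f = f' ∧ ∀ y, (∀ z ∈ W, ω y z = 0) → h y = y := by
  have key : ∀ f ∈ W, ∀ f' ∈ W, ω e f = 1 → ω e f' = 1 → ω f f' ≠ 0 →
      ∃ h ∈ H, h e = e ∧ h f = f' ∧ ∀ y, (∀ z ∈ W, ω y z = 0) → h y = y := by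
    intro f hf f' hf' h1 h2 h
    obtain ⟨g, hg, hg'⟩ := hT (ω f f')⁻¹ (f' - f) (W.sub_mem hf' hf)
    refine ⟨g, hg, ?_, ?_, ?_⟩
    · rw [hg']; simp [Tv, h1, h2]
    · rw [hg']; simp [Tv, hω.alt, h]
    · intro y hy; rw [hg']; simp [Tv, hy _ hf, hy _ hf']
  by_cases h : ω f f' = 0
  · have hfe : ω f e = -1 := by rw [hω.skew, h1]
    obtain ⟨g1, hg1, c1, c1', d1⟩ := key f hf (f + e) (W.add_mem hf he) h1 (by simp [h1, hω.alt])
      (by simp [hω.alt, hfe])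
    obtain ⟨g2, hg2, c2, c2', d2⟩ := key (f + e) (W.add_mem hf he) f' hf' (by simp [h1, hω.alt]) h2
      (by simp [h2, h])
    exact ⟨g2 * g1, H.mul_mem hg2 hg1, by simp [c1, c2], by simp [c1', c2'],
      fun y hy => by simp [d1 y hy, d2 y hy]⟩
  · exact key f hf f' hf' h1 h2 h

def perp2 (ω : V →ₗ[F] V →ₗ[F] F) (e f : V) : Submodule F V :=
  LinearMap.ker (ω e) ⊓ LinearMap.ker (ω f)

theorem mem_perp2 {e f v : V} : v ∈ perp2 ω e f ↔ ω e v = 0 ∧ ω f v = 0 := by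
  simp [perp2]

theorem claim12 (hω : Sy ω) (W : Submodule F V) (hW : ∀ v ∈ W, v ≠ 0 → ∃ w ∈ W, ω v w ≠ 0)
    (hT : ∀ c, ∀ x ∈ W, Has H (Tv ω c x)) (hI : IsoS ω H) {e f e' f' : V} (he : e ∈ W) (hf : f ∈ W)
    (he' : e' ∈ W) (hf' : f' ∈ W) (h1 : ω e f = 1) (h2 : ω e' f' = 1) :
    ∃ h ∈ H, h e = e' ∧ h f = f' ∧ ∀ y, (∀ z ∈ W, ω y z = 0) → h y = y := by
  have he0 : e ≠ 0 := by rintro rfl; simp at h1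
  have he0' : e' ≠ 0 := by rintro rfl; simp at h2
  obtain ⟨g1, hg1, c1, d1, k1⟩ := claim1 hω W hW hT he he' he0 he0'
  obtain ⟨g2, hg2, c2, c2', d2⟩ := claim2 hω W hT he' (k1 _ hf) hf' (by rw [← c1, hI g1 hg1, h1]) h2
  exact ⟨g2 * g1, H.mul_mem hg2 hg1, by simp [c1, c2], by simp [c2'],
    fun y hy => by simp [d1 y hy, d2 y hy]⟩

theorem TG (hω : Sy ω) (hI : IsoS ω H) (hT : ∀ c x, Has H (Tv ω c x)) : AllS ω H := by
  intro g hg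
  have hfd : Nontrivial V := Module.nontrivial_of_finrank_pos (R := F) (by rw [hω.dim]; norm_num)
  obtain ⟨e, he⟩ := exists_ne (0 : V)
  obtain ⟨f, h1⟩ := hω.nd1 he
  obtain ⟨e', f', h2, h3, h4, h5, h6⟩ := hω.complete h1
  obtain ⟨a, ha, a1, a2, -⟩ := claim12 (e := e) (f := f) (e' := g e) (f' := g f) hω ⊤
    (fun v _ hv => by obtain ⟨w, hw⟩ := hω.nd' hv; exact ⟨w, trivial, hw⟩)
    (fun c x _ => hT c x) hI trivial trivial trivial trivial h1 (by rw [hg, h1])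
  have hiso : ∀ v w, ω (a⁻¹ v) (a⁻¹ w) = ω v w := hI _ (H.inv_mem ha)
  have hae : a⁻¹ (g e) = e := by rw [← a1, inv_app]
  have haf : a⁻¹ (g f) = f := by rw [← a2, inv_app]
  have hm1 : ∀ z, ω e z = 0 → ω f z = 0 → a⁻¹ (g z) ∈ perp2 ω e f := fun z hz hz' => by
    rw [mem_perp2]
    constructor
    · rw [← hae, hiso, hg, hz]
    · rw [← haf, hiso, hg, hz']
  obtain ⟨b, hb, b1, b2, b3⟩ := claim12 (e := e') (f := f') (e' := a⁻¹ (g e')) (f' := a⁻¹ (g f'))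
    hω (perp2 ω e f) (by
      intro v hv hv0
      rw [mem_perp2] at hv
      by_contra! hc
      have c1 := hc e' (mem_perp2.2 ⟨h3, h5⟩)
      have c2 := hc f' (mem_perp2.2 ⟨h4, h6⟩)
      apply hv0
      rw [hω.expand h1 h2 h3 h4 h5 h6 v]
      simp [c1, c2, hω.skew0 hv.1, hω.skew0 hv.2])
    (fun c x _ => hT c x) hI (mem_perp2.2 ⟨h3, h5⟩) (mem_perp2.2 ⟨h4, h6⟩)
    (hm1 _ h3 h5) (hm1 _ h4 h6) h2 (by rw [hiso, hg, h2])
  have b4 : b e = e := b3 _ fun z hz => (mem_perp2.1 hz).1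
  have b5 : b f = f := b3 _ fun z hz => (mem_perp2.1 hz).2
  have : g = a * b := by
    ext v
    rw [hω.expand h1 h2 h3 h4 h5 h6 v]
    simp [b4, b5, b1, b2, app_inv, a1, a2]
  rw [this]
  exact H.mul_mem ha hb

/-! LemE -/
def Ep (ω : V →ₗ[F] V →ₗ[F] F) (H : Subgroup (V ≃ₗ[F] V)) (x : V) : Prop :=
  ∀ z, ω x z = 0 → Has H (Sv ω x z)

theorem Ep.conj (hI : IsoS ω H) {x : V} (h : Ep ω H x) {g : V ≃ₗ[F] V} (hg : g ∈ H) :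
    Ep ω H (g x) := by
  intro z hz
  have := (h (g⁻¹ z) (by rw [← hI g hg, app_inv, hz])).Sconj hI hg
  rwa [app_inv] at this

theorem Ep.move (hω : Sy ω) (h2 : (2 : F) ≠ 0) {x : V} (h : Ep ω H x) {v z : V} (hv : ω x v ≠ 0)
    (hz : ω x z = ω x v) : ∃ g ∈ H, g v = z := by
  have hvx : ω v x ≠ 0 := by rwa [hω.skew, neg_ne_zero]
  obtain ⟨g, hg, hg'⟩ := h ((ω v x)⁻¹ • (z - v) - ((ω v x)⁻¹ * 2⁻¹ * (ω v x)⁻¹ * ω v z) • x)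
    (by simp [hz, hω.alt])
  refine ⟨g, hg, ?_⟩
  rw [hg']
  have : (ω v x)⁻¹ * ω v x = 1 := inv_mul_cancel₀ hvx
  have h3 : (2 : F) * 2⁻¹ = 1 := mul_inv_cancel₀ h2
  simp only [Sv, map_sub, map_smul, smul_eq_mul, hω.alt]
  rw [smul_sub, smul_smul, smul_smul, mul_inv_cancel₀ hvx]
  have e1 : (ω v x)⁻¹ * (ω v z - 0) - (ω v x)⁻¹ * 2⁻¹ * (ω v x)⁻¹ * ω v z * ω v x
     = ω v x * ((ω v x)⁻¹ * 2⁻¹ * (ω v x)⁻¹ * ω v z) := by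
    field_simp; ring
  rw [e1]
  module

theorem Ep.ofsmul {x : V} {c : F} (hc : c ≠ 0) (h : Ep ω H x) : Ep ω H (c • x) := by
  intro z hz
  refine (h (c • z) (by simpa [hc] using hz)).congr fun v => ?_
  simp [Sv, smul_smul, mul_comm]

theorem Ep.T (h2 : (2 : F) ≠ 0) (hω : Sy ω) {x : V} (h : Ep ω H x) (c : F) : Has H (Tv ω c x) := by
  refine (h ((c * 2⁻¹) • x) (by simp [hω.alt])).congr fun v => ?_
  simp only [Sv, Tv, map_smul, smul_eq_mul]
  have : c = c * 2⁻¹ + c * 2⁻¹ := by field_simp; ring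
  rw [add_assoc, smul_smul, ← add_smul]
  congr 2
  conv_rhs => rw [this]
  ring

theorem LemE (hω : Sy ω) (hI : IsoS ω H) (h2 : (2 : F) ≠ 0) {x : V} (h : Ep ω H x)
    {g : V ≃ₗ[F] V} (hg : g ∈ H) (hx : ω x (g x) ≠ 0) : AllS ω H := by
  -- all vectors not perpendicular to a good pair
  have step : ∀ x y, Ep ω H x → Ep ω H y → ω x y ≠ 0 → ∀ z, ω x z ≠ 0 → Ep ω H z := by
    intro x y hx hy hxy z hz
    have hc : ω x z / ω x y ≠ 0 := div_ne_zero hz hxy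
    obtain ⟨k, hk, hk'⟩ := Ep.move (v := (ω x z / ω x y) • y) (z := z) hω h2 hx
      (by simp [hxy, hz]) (by simp [hxy])
    rw [← hk']
    exact (hy.ofsmul hc).conj hI hk
  have hy := h.conj hI hg
  have hx0 : x ≠ 0 := by rintro rfl; simp at hx
  have all : ∀ z, z ≠ 0 → Ep ω H z := by
    intro z hz
    by_cases hxz : ω x z = 0
    · obtain ⟨w, hw⟩ := hω.nd' hz
      have : ∃ w, ω z w ≠ 0 ∧ ω x w ≠ 0 := by
        by_cases a : ω x w = 0
        · by_cases b : ω z (g x) = 0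
          · exact ⟨w + g x, by simp [b, hw], by simp [a, hx]⟩
          · exact ⟨_, b, hx⟩
        · exact ⟨w, hw, a⟩
      obtain ⟨w, hw1, hw2⟩ := this
      have hw3 := step x _ h hy hx w hw2
      exact step w x hw3 h (by rwa [hω.skew, neg_ne_zero]) z (by rwa [hω.skew, neg_ne_zero])
    · exact step x _ h hy hx z hxz
  refine TG hω hI fun c z => ?_
  by_cases hz : z = 0
  · exact ⟨1, H.one_mem, fun v => by simp [Tv, hz]⟩
  · exact (all z hz).T h2 hω c
end PSp

open Module
section PSp
open scoped Pointwise
set_option linter.unusedSectionVars false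

theorem freeorb {G α : Type*} [Group G] [MulAction G α] [Finite α] (g : G) (n : ℕ) (s : Set α)
    (hs : ∀ a ∈ s, g • a ∈ s) (h : ∀ a ∈ s, ∀ k : ℕ, g ^ k • a = a → n ∣ k) : n ∣ s.ncard := by
  classical
  induction hm : s.ncard using Nat.strong_induction_on generalizing s with
  | _ m ih =>
    rcases s.eq_empty_or_nonempty with rfl | ⟨a, ha⟩
    · simp at hm; simp [← hm]
    have hsk : ∀ k : ℕ, ∀ b ∈ s, g ^ k • b ∈ s := by
      intro k
      induction k with
      | zero => simp
      | succ k ihk => intro b hb; rw [pow_succ', mul_smul]; exact hs _ (ihk b hb)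
    set O : Set α := MulAction.orbit (Subgroup.zpowers g) a with hO
    have hOc : O.ncard = Function.minimalPeriod (g • ·) a := by
      have : Fintype O := Fintype.ofFinite _
      rw [MulAction.minimalPeriod_eq_card, ← Nat.card_coe_set_eq, Nat.card_eq_fintype_card]
    have hit : ∀ k : ℕ, ∀ b : α, (g • ·)^[k] b = g ^ k • b := by
      intro k b; rw [smul_iterate]
    have hOn : n ∣ O.ncard := by
      rw [hOc]
      apply h a ha
      rw [← hit]
      exact Function.iterate_minimalPeriod
    have hper : ∀ b : α, ∃ k : ℕ, 0 < k ∧ g ^ k • b = b := by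
      intro b
      have hf : IsOfFinOrder (MulAction.toPermHom G α g) := isOfFinOrder_of_finite _
      obtain ⟨k, hk, hk'⟩ := hf.exists_pow_eq_one
      refine ⟨k, hk, ?_⟩
      rw [← map_pow] at hk'
      have := congrArg (fun f => f b) hk'
      simpa using this
    have hOk : ∀ b ∈ O, ∃ k : ℕ, b = g ^ k • a := by
      rintro b ⟨⟨x, hx⟩, rfl⟩
      obtain ⟨z, rfl⟩ := Subgroup.mem_zpowers_iff.1 hx
      obtain ⟨k, hk, hk'⟩ := hper a
      have e0 : ∀ m : ℕ, (g ^ k) ^ m • a = a := by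
        intro m
        induction m with
        | zero => simp
        | succ m ihm => rw [pow_succ, mul_smul, hk', ihm]
      have e1 : (g ^ (z.natAbs * k)) • a = a := by
        rw [mul_comm, pow_mul, e0]
      have hz : 0 ≤ z + z.natAbs * k := by
        have : (1 : ℤ) ≤ k := by exact_mod_cast hk
        have h2 : -z ≤ z.natAbs := by omega
        nlinarith [(Int.natCast_nonneg z.natAbs)]
      refine ⟨(z + z.natAbs * k).toNat, ?_⟩
      have e3 : g ^ (z + z.natAbs * k).toNat = g ^ z * g ^ (z.natAbs * k) := by
        rw [← zpow_natCast, Int.toNat_of_nonneg hz, zpow_add]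
        norm_cast
      rw [e3, mul_smul, e1]
      rfl
    have hOs : O ⊆ s := by
      intro b hb
      obtain ⟨k, rfl⟩ := hOk b hb
      exact hsk k a ha
    have hOg : ∀ b, g • b ∈ O → b ∈ O := by
      intro b hb
      have := MulAction.mem_orbit_of_mem_orbit (⟨g⁻¹, by simp⟩ : Subgroup.zpowers g) hb
      rw [Subgroup.smul_def] at this
      simpa using this
    have haO : a ∈ O := MulAction.mem_orbit_self _
    have hc : (s \ O).ncard + O.ncard = s.ncard := Set.ncard_sdiff_add_ncard_of_subset hOs
    have hpos : 0 < O.ncard := (Set.ncard_pos).2 ⟨a, haO⟩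
    have := ih (s \ O).ncard (by omega) (s \ O)
      (fun b hb => ⟨hs b hb.1, fun hh => hb.2 (hOg b hh)⟩) (fun b hb => h b hb.1) rfl
    rw [← hm, ← hc]
    exact dvd_add this hOn

theorem num1 {p q f a a' : ℕ} (hp : p.Prime) (hq : q = p ^ f) (hq5 : 5 ≤ q) (ho : Odd q)
    (h : a * a' = q ^ 2) (h1 : a ≠ 1) (h1' : a' ≠ 1) (hd : (q + 1) / 2 ∣ a - 1) : False := by
  obtain ⟨m, hm⟩ := ho
  obtain ⟨e, he⟩ : ∃ e, e = (q + 1) / 2 := ⟨_, rfl⟩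
  have hqe : q + 1 = 2 * e := by omega
  rw [← he] at hd
  have key : ∀ b c : ℕ, b * c = q ^ 2 → b ≠ 1 → e ∣ b - 1 → b ≤ q → False := by
    intro b c hbc hb hd hbq
    have hbd : b ∣ p ^ (f * 2) := by rw [pow_mul, ← hq, ← hbc]; exact dvd_mul_right _ _
    obtain ⟨i, hi, rfl⟩ := (Nat.dvd_prime_pow hp).1 hbd
    have hif : i ≤ f := by
      rw [hq] at hbq
      exact (Nat.pow_le_pow_iff_right hp.one_lt).1 hbq
    have hpos : 0 < p ^ i := pow_pos hp.pos _
    have hle : e ≤ p ^ i - 1 := Nat.le_of_dvd (by omega) hd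
    rcases hif.eq_or_lt with rfl | hlt
    · rw [← hq] at hd
      have h3 : e ∣ 2 := by
        have : e ∣ (q + 1) - (q - 1) := Nat.dvd_sub (by rw [hqe]; exact dvd_mul_left _ _) hd
        convert this using 1
        omega
      have := Nat.le_of_dvd (by norm_num) h3
      omega
    · have : p ^ (i + 1) ≤ q := by rw [hq]; exact Nat.pow_le_pow_right hp.pos hlt
      have h2 := hp.two_le
      rw [pow_succ] at this
      have := Nat.mul_le_mul_left (p ^ i) h2
      omega
  have hq0 : q ^ 2 ≠ 0 := by positivity
  have ha0 : 0 < a := Nat.pos_of_ne_zero (by rintro rfl; apply hq0; rw [← h]; simp)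
  have ha0' : 0 < a' := Nat.pos_of_ne_zero (by rintro rfl; apply hq0; rw [← h]; simp)
  rcases le_or_gt a q with hle | hgt
  · exact key a a' h h1 hd hle
  · apply key a' a (by rw [mul_comm, h]) h1' _ (by nlinarith)
    have e1 : (a - 1) * a' + (a' - 1) = (q - 1) * (q + 1) := by
      zify [ha0, ha0', (by omega : 1 ≤ q)]
      have : (a : ℤ) * a' = q ^ 2 := by exact_mod_cast h
      linear_combination this
    have e2 : e ∣ (a - 1) * a' + (a' - 1) := by
      rw [e1, hqe]; exact Dvd.intro_left _ (by ring : (q - 1) * 2 * e = _)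
    exact (Nat.dvd_add_right (hd.mul_right a')).1 e2

theorem LemS {G M : Type*} [Group G] [AddCommGroup M] [DistribMulAction G M] [Finite M] {p q f : ℕ}
    (hp : p.Prime) (hq : q = p ^ f) (hq5 : 5 ≤ q) (ho : Odd q) (g : G) (A B : AddSubgroup M)
    (hAB : A ≤ B) (hB : Nat.card B = q ^ 2) (hA : ∃ a ∈ A, a ≠ 0) (hg : ∀ a ∈ A, g • a ∈ A)
    (hfree : ∀ a ∈ A, a ≠ 0 → ∀ k : ℕ, g ^ k • a = a → (q + 1) / 2 ∣ k) : A = B := by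
  have h1 : (q + 1) / 2 ∣ ((A : Set M) \ {0}).ncard := by
    apply freeorb g
    · rintro a ⟨ha, ha0⟩
      refine ⟨hg a ha, ?_⟩
      simpa [smul_eq_zero_iff_eq] using ha0
    · rintro a ⟨ha, ha0⟩
      exact hfree a ha ha0
  rw [Set.ncard_sdiff_singleton_of_mem A.zero_mem, ← Nat.card_coe_set_eq] at h1
  obtain ⟨c, hc⟩ := AddSubgroup.card_dvd_of_le hAB
  rw [hB] at hc
  by_contra hne
  obtain ⟨a, ha, ha0⟩ := hA
  refine num1 hp hq hq5 ho hc.symm ?_ ?_ h1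
  · intro h
    have := AddSubgroup.eq_bot_of_card_eq A h
    rw [this] at ha
    exact ha0 (by simpa using ha)
  · rintro rfl
    rw [mul_one, ← hB] at hc
    exact hne (AddSubgroup.eq_of_le_of_card_ge hAB hc.le)

theorem numA {q r a b : ℕ} (hr : r.Prime) (hr2 : r ≠ 2) (hrq : r ∣ q ^ 2 + 1) (hba : b ≤ a)
    (ha : a ≤ 4) (h : r ∣ q ^ a - q ^ b) : a = b ∨ (a = 4 ∧ b = 0) := by
  have : Fact r.Prime := ⟨hr⟩
  have hq2 : (q : ZMod r) ^ 2 = -1 := by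
    have := (ZMod.natCast_eq_zero_iff (q ^ 2 + 1) r).2 hrq
    push_cast at this
    linear_combination this
  have hq0 : (q : ZMod r) ≠ 0 := by intro h; simp [h] at hq2
  have h2 : (2 : ZMod r) ≠ 0 := by
    intro h
    have : ((2 : ℕ) : ZMod r) = 0 := by exact_mod_cast h
    rw [ZMod.natCast_eq_zero_iff] at this
    exact hr2 ((Nat.prime_dvd_prime_iff_eq hr Nat.prime_two).1 this)
  have hqpos : 0 < q := Nat.pos_of_ne_zero (by rintro rfl; simp at hq0)
  have e := (ZMod.natCast_eq_zero_iff _ r).2 h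
  rw [Nat.cast_sub (Nat.pow_le_pow_right hqpos hba)] at e
  push_cast at e
  obtain ⟨d, rfl⟩ := Nat.exists_eq_add_of_le hba
  have e' : (q : ZMod r) ^ d = 1 := by
    rw [pow_add] at e
    have : (q : ZMod r) ^ b * (q ^ d - 1) = 0 := by linear_combination e
    rcases mul_eq_zero.1 this with h | h
    · exact absurd (eq_zero_of_pow_eq_zero h) hq0
    · linear_combination h
  have hd : d ≤ 4 := by omega
  interval_cases d
  · left; rfl
  · exfalso; apply h2; rw [pow_one] at e'; rw [e'] at hq2; linear_combination hq2
  · exfalso; apply h2; rw [e'] at hq2; linear_combination hq2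
  · exfalso; apply h2
    have : (q : ZMod r) = -1 := by linear_combination -e' + q * hq2
    rw [this] at hq2; linear_combination hq2
  · right; omega

variable {F V : Type*} [Field F] [AddCommGroup V] [Module F V] [Finite F] [Finite V]

theorem ncard_sub (L : Submodule F V) : (L : Set V).ncard = Nat.card F ^ finrank F L := by
  rw [← Nat.card_coe_set_eq]
  exact Module.natCard_eq_pow_finrank (K := F) (V := L)

theorem pow_fix {h : V ≃ₗ[F] V} {v : V} {k : ℕ} (hv : (h ^ k) v = v) (m : ℕ) : (h ^ (k * m)) v = v := by
  induction m with
  | zero => simp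
  | succ m ih => rw [Nat.mul_succ, pow_add, LinearEquiv.mul_apply, hv, ih]

theorem pow_fix_coprime {h : V ≃ₗ[F] V} {v : V} {k r : ℕ} (hr : r.Prime) (hhr : (h ^ r) v = v)
    (hv : (h ^ k) v = v) (hk : ¬ r ∣ k) : h v = v := by
  have hc : Nat.Coprime k r := (Nat.coprime_comm.1 ((Nat.Prime.coprime_iff_not_dvd hr).2 hk))
  obtain ⟨m, -, hm⟩ := Nat.exists_mul_mod_eq_one_of_coprime hc hr.one_lt
  have h1 := pow_fix hv m
  rw [← Nat.div_add_mod (k * m) r, hm, pow_add, LinearEquiv.mul_apply, pow_one] at h1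
  have h2 := pow_fix hhr ((k * m) / r)
  have h3 : (h ^ (r * (k * m / r))) (h v) = (h ^ (r * (k * m / r))) v := by rw [h1, h2]
  exact (LinearEquiv.injective _) h3

theorem LemA (hV : finrank F V = 4) {r : ℕ} (hr : r.Prime) (hr2 : r ≠ 2)
    (hrq : r ∣ Nat.card F ^ 2 + 1) {h : V ≃ₗ[F] V} (hh : h ^ r = 1) (L : Submodule F V)
    (hL : finrank F L = 1 ∨ finrank F L = 2) (hLh : ∀ v ∈ L, h v ∈ L) : h = 1 := by
  have : FiniteDimensional F V := FiniteDimensional.of_finrank_pos (by rw [hV]; norm_num)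
  set K : Submodule F V := LinearMap.ker ((h : V →ₗ[F] V) - 1) with hK
  have hKm : ∀ v, v ∈ K ↔ h v = v := by intro v; simp [hK, sub_eq_zero]
  have main : ∀ M : Submodule F V, (∀ v ∈ M, h v ∈ M) →
      r ∣ Nat.card F ^ finrank F M - Nat.card F ^ finrank F (M ⊓ K : Submodule F V) := by
    intro M hM
    rw [← ncard_sub, ← ncard_sub, ← Set.ncard_sdiff (by exact fun x hx => hx.1)]
    apply freeorb h
    · rintro a ⟨ha, hb⟩
      refine ⟨hM a ha, fun hc => hb ⟨ha, ?_⟩⟩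
      have := (hKm _).1 hc.2
      exact (hKm _).2 (h.injective this)
    · rintro a ⟨ha, hb⟩ k hk
      by_contra hkr
      exact hb ⟨ha, (hKm _).2 (pow_fix_coprime hr (by rw [hh]; rfl) hk hkr)⟩
  have m1 := main L hLh
  have hle := Submodule.finrank_mono (inf_le_left : L ⊓ K ≤ L)
  rcases numA hr hr2 hrq hle (by omega) m1 with h1 | h1
  · have hLK : L ⊓ K = L := Submodule.eq_of_le_of_finrank_eq inf_le_left h1.symm
    have hLK' : L ≤ K := inf_eq_left.1 hLK
    have m2 := main ⊤ (fun _ _ => trivial)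
    have hle2 := Submodule.finrank_mono hLK'
    rw [top_inf_eq, finrank_top, hV] at m2
    have hle4 := K.finrank_le
    rcases numA hr hr2 hrq (by omega) le_rfl m2 with h2 | h2
    · have : K = ⊤ := Submodule.eq_top_of_finrank_eq (by rw [hV, h2])
      ext v
      have hv : v ∈ K := by rw [this]; trivial
      exact (hKm v).1 hv
    · omega
  · omega
end PSp

open Module
section PSp
open scoped Pointwise
set_option linter.unusedSectionVars false

structure QF (F : Type*) [Field F] (p f q : ℕ) : Prop where
  hp : p.Prime
  hq : q = p ^ f
  h5 : 5 ≤ q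
  ho : Odd q
  hc : Nat.card F = q
  hch : CharP F p

variable {F V : Type*} [Field F] [AddCommGroup V] [Module F V] [Finite F] [Finite V]
variable {ω : V →ₗ[F] V →ₗ[F] F} {H : Subgroup (V ≃ₗ[F] V)} {p f q : ℕ}

theorem QF.f0 (h : QF F p f q) : f ≠ 0 := by
  rintro rfl
  have := h.hq; have := h.h5; simp at *; omega

theorem QF.p3 (h : QF F p f q) : 3 ≤ p := by
  have h2 := h.hp.two_le
  have : p ≠ 2 := by
    rintro rfl
    have := h.ho
    rw [h.hq] at this
    have h0 := h.f0
    rw [Nat.odd_pow_iff h0] at this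
    revert this; decide
  omega

theorem QF.two (h : QF F p f q) : (2 : F) ≠ 0 := by
  have := h.hch
  have h3 := h.p3
  intro h2
  have : ((2 : ℕ) : F) = 0 := by exact_mod_cast h2
  rw [CharP.cast_eq_zero_iff F p] at this
  have := Nat.le_of_dvd (by norm_num) this
  omega

theorem QF.e2 (h : QF F p f q) : q + 1 = 2 * ((q + 1) / 2) := by
  obtain ⟨m, hm⟩ := h.ho
  omega

theorem QF.e3 (h : QF F p f q) : 3 ≤ (q + 1) / 2 := by
  have := h.h5; omega

theorem QF.en (h : QF F p f q) : ¬ (q + 1) / 2 ∣ q - 1 := by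
  intro hd
  have h5 := h.h5
  have : (q + 1) / 2 ∣ (q + 1) - (q - 1) := Nat.dvd_sub (Dvd.intro_left 2 h.e2.symm) hd
  have := Nat.le_of_dvd (by omega) this
  have := h.e3
  omega

theorem QF.fpow (h : QF F p f q) {c : F} (hc : c ≠ 0) : c ^ (q - 1) = 1 := by
  have : Fintype F := Fintype.ofFinite F
  rw [← h.hc, Nat.card_eq_fintype_card]
  exact FiniteField.pow_card_sub_one_eq_one c hc

theorem pow_eig {s : V ≃ₗ[F] V} {v : V} {c : F} (h : s v = c • v) (k : ℕ) : (s ^ k) v = c ^ k • v := by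
  induction k with
  | zero => simp
  | succ k ih => rw [pow_succ', LinearEquiv.mul_apply, ih, map_smul, h, smul_smul, pow_succ]

/-- the plane orthogonal to a hyperbolic pair -/
theorem perp2_plane (hω : Sy ω) {x x' : V} (hx : ω x x' = 1) {a b v : V} (ha : a ∈ perp2 ω x x')
    (hb : b ∈ perp2 ω x x') (hv : v ∈ perp2 ω x x') : ω a b • v = ω v b • a - ω v a • b := by
  obtain ⟨e, f, h2, h3, h4, h5, h6⟩ := hω.complete hx
  have key : ∀ v ∈ perp2 ω x x', ∃ α β : F, v = α • e + β • f := by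
    intro v hv
    rw [mem_perp2] at hv
    refine ⟨ω v f, - ω v e, ?_⟩
    conv_lhs => rw [hω.expand hx h2 h3 h4 h5 h6 v]
    simp [hω.skew0 hv.1, hω.skew0 hv.2, sub_eq_add_neg]
  obtain ⟨a1, a2, rfl⟩ := key a ha
  obtain ⟨b1, b2, rfl⟩ := key b hb
  obtain ⟨v1, v2, rfl⟩ := key v hv
  simp only [map_add, map_smul, LinearMap.add_apply, LinearMap.smul_apply, hω.alt, h2, hω.skew f e,
    smul_eq_mul]
  module

theorem perp2_card (hω : Sy ω) {x x' : V} (hx : ω x x' = 1) :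
    Nat.card (perp2 ω x x').toAddSubgroup = Nat.card F ^ 2 := by
  obtain ⟨e, f, h2, h3, h4, h5, h6⟩ := hω.complete hx
  have he : Nat.card (perp2 ω x x') = Nat.card (F × F) := by
    apply Nat.card_congr
    refine ⟨fun v => (ω v f, - ω v e), fun t => ⟨t.1 • e + t.2 • f, by
      rw [mem_perp2]; simp [h3, h4, h5, h6]⟩, ?_, ?_⟩
    · rintro ⟨v, hv⟩
      rw [mem_perp2] at hv
      ext
      have := hω.expand hx h2 h3 h4 h5 h6 v
      rw [hω.skew0 hv.1, hω.skew0 hv.2] at this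
      simpa [sub_eq_add_neg] using this.symm
    · rintro ⟨a, b⟩
      simp [hω.alt, h2, hω.skew f e]
  have h3 : Nat.card (perp2 ω x x').toAddSubgroup = Nat.card (perp2 ω x x') := rfl
  rw [h3, he, Nat.card_prod, sq]

theorem Sv_mul (hω : Sy ω) {y z z' : V} (h : ω y z = 0) (h' : ω y z' = 0) (d d' : F) (v : V) :
    Sv ω y z (Tv ω d y (Sv ω y z' (Tv ω d' y v))) =
    Sv ω y (z + z') (Tv ω (d + d' + ω z' z) y v) := by
  simp only [Sv, Tv, map_add, map_smul, LinearMap.add_apply, LinearMap.smul_apply, hω.alt, h, h',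
    hω.skew0 h, hω.skew0 h', smul_eq_mul]
  module

theorem LemG1 (hω : Sy ω) (hI : IsoS ω H) (Q : QF F p f q) {s : V ≃ₗ[F] V} (hs : s ∈ H)
    {x x' : V} (hx : ω x x' = 1) (hsx : s x = x) (hsx' : s x' = x')
    (hse : ∀ w ∈ perp2 ω x x', (s ^ ((q + 1) / 2)) w = - w)
    (hsf : ∀ w ∈ perp2 ω x x', w ≠ 0 → ∀ k : ℕ, (s ^ k) w = w → (q + 1) / 2 ∣ k)
    {c0 c : F} (hc0 : c0 ≠ 0) (hc : c ≠ 0) (hT : Has H (Tv ω c0 x)) {w : V}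
    (hw : w ∈ perp2 ω x x') (hw0 : w ≠ 0) (hT' : Has H (Tv ω c (x' + w))) : AllS ω H := by
  have h2 := Q.two
  have hpow : ∀ k : ℕ, (s ^ k) x' = x' := fun k => by
    have := pow_eig (s := s) (v := x') (c := 1) (by simp [hsx']) k
    simpa using this
  have hxx : ω x' x = -1 := by rw [hω.skew, hx]
  have hsp : ∀ z ∈ perp2 ω x x', s z ∈ perp2 ω x x' := by
    intro z hz
    rw [mem_perp2] at hz ⊢
    constructor
    · have := hI s hs x z
      rwa [hsx, hz.1] at this
    · have := hI s hs x' z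
      rwa [hsx', hz.2] at this
  have hm := mem_perp2.1 hw
  have hS : Has H (Sv ω x' ((2 * c) • w)) := by
    have h1 := hT'.Tconj hI (H.pow_mem hs ((q + 1) / 2))
    rw [map_add, hse w hw, hpow] at h1
    refine (hT'.mul (h1.Tneg hω)).congr fun v => ?_
    simp only [Sv, Tv, map_add, map_smul, map_neg, LinearMap.add_apply, LinearMap.smul_apply,
      LinearMap.neg_apply, hω.alt, hm, hω.skew0 hm.2, smul_eq_mul]
    module
  let A : AddSubgroup V :=
    { carrier := {z | z ∈ perp2 ω x x' ∧ ∃ d, Has H (fun v => Sv ω x' z (Tv ω d x' v))}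
      zero_mem' := ⟨Submodule.zero_mem _, 0, 1, H.one_mem, fun v => by simp [Sv, Tv]⟩
      add_mem' := by
        rintro a b ⟨ha, d, hd⟩ ⟨hb, d', hd'⟩
        exact ⟨Submodule.add_mem _ ha hb, _, (hd.mul hd').congr
          (Sv_mul hω (mem_perp2.1 ha).2 (mem_perp2.1 hb).2 d d')⟩
      neg_mem' := by
        rintro a ⟨ha, d, hd⟩
        refine ⟨Submodule.neg_mem _ ha, -d, hd.inv fun v => ?_⟩
        rw [Sv_mul hω (mem_perp2.1 ha).2 (by simp [(mem_perp2.1 ha).2])]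
        simp [hω.alt, Sv, Tv] }
  have hA : A = (perp2 ω x x').toAddSubgroup := by
    refine LemS Q.hp Q.hq Q.h5 Q.ho s A _ (fun z hz => hz.1) (by rw [perp2_card hω hx, Q.hc])
      ⟨(2 * c) • w, ⟨Submodule.smul_mem _ _ hw, 0, hS.congr fun v => by simp [Tv]⟩, ?_⟩ ?_ ?_
    · simp [hw0, hc, h2]
    · rintro a ⟨ha, d, hd⟩
      refine ⟨hsp a ha, d, ?_⟩
      refine (((Has.of hs).mul hd).mul (Has.of (H.inv_mem hs))).congr fun v => ?_
      have this (x : V) : ω (s⁻¹ v) x = ω v (s x) := by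
        rw [← hI s hs, app_inv]
      change _ = Sv ω x' (s a) (Tv ω d x' v)
      simp only [Sv, Tv, map_add, map_smul, app_inv, this, hsx', LinearMap.add_apply,
        LinearMap.smul_apply, hω.alt, (mem_perp2.1 ha).2, (mem_perp2.1 (hsp a ha)).2]
    · rintro a ⟨ha, -⟩ ha0 k hk
      exact hsf a ha ha0 k hk
  have hAm : ∀ z ∈ perp2 ω x x', ∃ d, Has H (fun v => Sv ω x' z (Tv ω d x' v)) := by
    intro z hz
    have : z ∈ A := by rw [hA]; exact hz
    exact this.2
  have hTall : ∀ c, Has H (Tv ω c x') := by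
    intro c
    obtain ⟨e, f, k2, k3, k4, k5, k6⟩ := hω.complete hx
    have e1 : (-(c / 2)) • e ∈ perp2 ω x x' := mem_perp2.2 ⟨by simp [k3], by simp [k5]⟩
    have f1 : f ∈ perp2 ω x x' := mem_perp2.2 ⟨k4, k6⟩
    obtain ⟨d, hd⟩ := hAm _ e1
    obtain ⟨d', hd'⟩ := hAm _ f1
    have p1 := (hd.mul hd').congr (Sv_mul hω (mem_perp2.1 e1).2 (mem_perp2.1 f1).2 d d')
    have p2 := (hd'.mul hd).congr (Sv_mul hω (mem_perp2.1 f1).2 (mem_perp2.1 e1).2 d' d)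
    have p3 : Has H (fun v => Sv ω x' (-((-(c / 2)) • e + f))
        (Tv ω (-(d' + d + ω ((-(c / 2)) • e) f)) x' v)) := by
      refine p2.inv fun v => ?_
      rw [Sv_mul hω]
      · rw [add_comm f, add_neg_cancel]
        simp [Sv, Tv, hω.alt, hω.skew f e, k2]
      · simp [k5, k6]
      · simp [k5, k6]
    refine (p1.mul p3).congr fun v => ?_
    rw [Sv_mul hω]
    · rw [add_neg_cancel]
      simp only [Sv, Tv, map_zero, smul_zero, zero_smul, add_zero, map_neg, map_add, map_smul,
        LinearMap.neg_apply, LinearMap.add_apply, LinearMap.smul_apply, hω.alt, hω.skew f e, k2]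
      congr 3
      simp only [smul_eq_mul]
      field_simp
      ring
    · simp [k5, k6]
    · simp [k5, k6]
  have hSall : ∀ z ∈ perp2 ω x x', Has H (Sv ω x' z) := by
    intro z hz
    obtain ⟨d, hd⟩ := hAm _ hz
    refine (hd.mul (hTall (-d))).congr fun v => ?_
    congr 1
    simp only [Tv, map_add, map_smul, LinearMap.add_apply, LinearMap.smul_apply, hω.alt]
    module
  have hE : Ep ω H x' := by
    intro z hz
    have hz' : ω z x' = 0 := hω.skew0 hz
    have hw' : z + ω z x • x' ∈ perp2 ω x x' := by
      rw [mem_perp2]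
      simp [hz, hx, hω.alt, hω.skew x z]
    refine ((hSall _ hw').mul (hTall (-2 * ω z x))).congr fun v => ?_
    simp only [Sv, Tv, map_add, map_smul, LinearMap.add_apply, LinearMap.smul_apply, hω.alt, hz,
      smul_eq_mul]
    module
  obtain ⟨g, hg, hg'⟩ := hT
  refine LemE hω hI h2 hE hg ?_
  rw [hg']
  simp [Tv, hω.alt, hxx, hc0]

theorem LemG (hω : Sy ω) (hI : IsoS ω H) (Q : QF F p f q) {s : V ≃ₗ[F] V} (hs : s ∈ H)
    {x x' : V} (hx : ω x x' = 1) (hsx : s x = x) (hsx' : s x' = x')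
    (hse : ∀ w ∈ perp2 ω x x', (s ^ ((q + 1) / 2)) w = - w)
    (hsf : ∀ w ∈ perp2 ω x x', w ≠ 0 → ∀ k : ℕ, (s ^ k) w = w → (q + 1) / 2 ∣ k)
    {c0 : F} (hc0 : c0 ≠ 0) (hT : Has H (Tv ω c0 x)) :
    AllS ω H ∨ (∀ h ∈ H, ∃ c : F, h x = c • x) ∨
      ∀ h ∈ H, ∀ v ∈ Submodule.span F {x, x'}, h (h v) ∈ Submodule.span F {x, x'} := by
  have h2 := Q.two
  have hxx : ω x' x = -1 := by rw [hω.skew, hx]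
  have hsp : ∀ z ∈ perp2 ω x x', s z ∈ perp2 ω x x' := by
    intro z hz
    rw [mem_perp2] at hz ⊢
    constructor
    · have := hI s hs x z
      rwa [hsx, hz.1] at this
    · have := hI s hs x' z
      rwa [hsx', hz.2] at this
  have hpr : ∀ z, z - ω z x' • x + ω z x • x' ∈ perp2 ω x x' := by
    intro z
    rw [mem_perp2]
    simp [hx, hω.alt, hxx, hω.skew x z, hω.skew x' z]
  have hnon : ∀ w ∈ perp2 ω x x', w ≠ 0 → ω w (s w) ≠ 0 := by
    intro w hw hw0 h0
    have : ∃ c : F, s w = c • w := by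
      obtain ⟨e, f, k2, k3, k4, k5, k6⟩ := hω.complete hx
      have : ∃ b ∈ perp2 ω x x', ω w b ≠ 0 := by
        by_contra! hcon
        have m := mem_perp2.1 hw
        apply hw0
        rw [hω.expand hx k2 k3 k4 k5 k6 w, hcon e (mem_perp2.2 ⟨k3, k5⟩),
          hcon f (mem_perp2.2 ⟨k4, k6⟩), hω.skew0 m.1, hω.skew0 m.2]
        simp
      obtain ⟨b, hb, hb0⟩ := this
      have := perp2_plane hω hx hw hb (hsp w hw)
      rw [hω.skew0 h0, zero_smul, sub_zero] at this
      exact ⟨(ω w b)⁻¹ * ω (s w) b, by rw [mul_smul, ← this, smul_smul, inv_mul_cancel₀ hb0, one_smul]⟩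
    obtain ⟨c, hc⟩ := this
    have hc' : c ≠ 0 := by
      rintro rfl
      rw [zero_smul] at hc
      exact hw0 (by simpa using hc)
    have := pow_eig hc (q - 1)
    rw [Q.fpow hc', one_smul] at this
    exact Q.en (hsf w hw hw0 _ this)
  by_cases hper : ∀ h ∈ H, ω x (h x) = 0
  · right; left
    intro h hh
    refine ⟨ω (h x) x', ?_⟩
    have hw := hpr (h x)
    rw [hω.skew (h x) x, hper h hh] at hw
    by_contra hne
    have hw0 : h x - ω (h x) x' • x + (-0 : F) • x' ≠ 0 := by
      simp only [neg_zero, zero_smul, add_zero]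
      rwa [sub_ne_zero]
    apply hnon _ hw hw0
    have h3 : ω (h x) (s (h x)) = 0 := by
      have := hper _ (H.mul_mem (H.mul_mem (H.inv_mem hh) hs) hh)
      rw [← hI h hh] at this
      simpa [app_inv] using this
    have h4 : ω x (s (h x)) = 0 := by
      have := hI s hs x (h x)
      rwa [hsx, hper h hh] at this
    simp [hsx, hω.alt, h4, hω.skew0 (hper h hh), h3]
  push Not at hper
  obtain ⟨h1, hh1, hx1⟩ := hper
  by_cases hgood : ∃ y, (∃ c : F, c ≠ 0 ∧ Has H (Tv ω c y)) ∧ ω x y ≠ 0 ∧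
      y - ω y x' • x + ω y x • x' ≠ 0
  · left
    obtain ⟨y, ⟨c, hc, hcT⟩, hy, hw0⟩ := hgood
    set w := y - ω y x' • x + ω y x • x' with hw
    have hwm : w ∈ perp2 ω x x' := hpr y
    have hyk : ω y x = - ω x y := hω.skew _ _
    obtain ⟨k, hk⟩ : ∃ k, k = ω x y := ⟨_, rfl⟩
    rw [← hk] at hyk hy
    set x2 := x' + (ω y x' / k) • x with hx2
    have hxx2 : ω x x2 = 1 := by simp [hx2, hx, hω.alt]
    have hmem : ∀ v, v ∈ perp2 ω x x2 ↔ v ∈ perp2 ω x x' := by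
      intro v
      rw [mem_perp2, mem_perp2]
      constructor
      · rintro ⟨a, b⟩; refine ⟨a, ?_⟩; simpa [hx2, a] using b
      · rintro ⟨a, b⟩; refine ⟨a, ?_⟩; simp [hx2, a, b]
    have hyy : y = k • (x2 + k⁻¹ • w) := by
      have e1 : k * (ω y x' / k) = ω y x' := by field_simp
      rw [smul_add, smul_smul, mul_inv_cancel₀ hy, hx2, smul_add, smul_smul, e1, hw, hyk]
      module
    rw [hyy] at hcT
    exact LemG1 hω hI Q hs hxx2 hsx (by simp [hx2, hsx, hsx']) (fun v hv => hse v ((hmem v).1 hv))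
      (fun v hv => hsf v ((hmem v).1 hv)) hc0 (mul_ne_zero hc (pow_ne_zero 2 hy)) hT
      (w := k⁻¹ • w) ((hmem _).2 (Submodule.smul_mem _ _ hwm)) (by simp [hy, hw0]) hcT.Tsmul
  right; right
  push Not at hgood
  set y := h1 x with hy
  have hyT : Has H (Tv ω c0 y) := hT.Tconj hI hh1
  have hyY : y = ω y x' • x - ω y x • x' := by
    have := hgood y ⟨c0, hc0, hyT⟩ hx1
    rw [← sub_eq_zero, ← this]; module
  have hYm : ∀ a b : F, a • x + b • x' ∈ Submodule.span F {x, x'} := fun a b =>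
    Submodule.mem_span_pair.2 ⟨a, b, rfl⟩
  have hcl : ∀ z, (∃ c : F, c ≠ 0 ∧ Has H (Tv ω c z)) →
      z ∈ Submodule.span F {x, x'} ∨ z ∈ perp2 ω x x' := by
    rintro z ⟨c, hc, hz⟩
    by_cases hxz : ω x z = 0
    · by_cases hw0 : z - ω z x' • x + ω z x • x' = 0
      · left
        have : z = ω z x' • x + (- ω z x) • x' := by
          rw [← sub_eq_zero, ← hw0]; module
        rw [this]; exact hYm _ _
      · right
        have hzx := hω.skew0 hxz
        rw [mem_perp2]
        refine ⟨hxz, ?_⟩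
        by_contra hne
        have hne' : ω z x' ≠ 0 := by rwa [hω.skew, neg_ne_zero]
        obtain ⟨t, ht, ht'⟩ := hyT
        have hzy : ω z y = - (ω z x' * ω y x) := by
          conv_lhs => rw [hyY]
          simp [hzx, mul_comm]
        have hyx : ω y x ≠ 0 := by rwa [hω.skew, neg_ne_zero]
        have := hgood (t z) ⟨c, hc, hz.Tconj hI ht⟩
          (by rw [ht']; simp [Tv, hxz, hx1, hc0, hzy, hne', hyx])
        apply hw0
        rw [← this, ht']
        simp only [Tv, map_add, map_smul, LinearMap.add_apply, LinearMap.smul_apply, smul_eq_mul]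
        have e2 : (c0 * ω z y) • (y - ω y x' • x + ω y x • x') = 0 := by
          rw [hgood y ⟨c0, hc0, ⟨t, ht, ht'⟩⟩ hx1, smul_zero]
        rw [← sub_eq_zero, ← neg_eq_zero, ← e2]
        module
    · left
      have := hgood z ⟨c, hc, hz⟩ hxz
      have : z = ω z x' • x + (- ω z x) • x' := by
        rw [← sub_eq_zero, ← this]; module
      rw [this]; exact hYm _ _
  have hYW : ∀ a ∈ Submodule.span F {x, x'}, ∀ b ∈ perp2 ω x x', ω a b = 0 := by
    intro a ha b hb
    obtain ⟨c, d, rfl⟩ := Submodule.mem_span_pair.1 ha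
    rw [mem_perp2] at hb
    simp [hb]
  intro h hh
  have hX : ∀ g ∈ H, (∃ c : F, c ≠ 0 ∧ Has H (Tv ω c (g x))) ∧
      ∃ c : F, c ≠ 0 ∧ Has H (Tv ω c (g y)) := fun g hg =>
    ⟨⟨c0, hc0, hT.Tconj hI hg⟩, ⟨c0, hc0, hyT.Tconj hI hg⟩⟩
  have hxy : ∀ g ∈ H, ω (g x) (g y) ≠ 0 := fun g hg => by rwa [hI g hg]
  have hyx : ω y x ≠ 0 := by rwa [hω.skew, neg_ne_zero]
  -- Y is spanned by x and y
  have hsp2 : ∀ v ∈ Submodule.span F {x, x'}, ∃ a b : F, v = a • x + b • y := by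
    intro v hv
    obtain ⟨c, d, rfl⟩ := Submodule.mem_span_pair.1 hv
    refine ⟨c + d * (ω y x)⁻¹ * ω y x', - (d * (ω y x)⁻¹), ?_⟩
    rw [hyY]
    simp only [map_sub, map_smul, LinearMap.sub_apply, LinearMap.smul_apply, hω.alt, hx, hxx, smul_eq_mul]
    have : d = d * (ω y x)⁻¹ * ω y x := by field_simp
    conv_lhs => rw [this]
    module
  have fin : ∀ g ∈ H, g x ∈ Submodule.span F {x, x'} → g y ∈ Submodule.span F {x, x'} →
      ∀ v ∈ Submodule.span F {x, x'}, g v ∈ Submodule.span F {x, x'} := by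
    intro g hg a b v hv
    obtain ⟨c, d, rfl⟩ := hsp2 v hv
    rw [map_add, map_smul, map_smul]
    exact Submodule.add_mem _ (Submodule.smul_mem _ _ a) (Submodule.smul_mem _ _ b)
  rcases hcl _ (hX h hh).1 with a | a <;> rcases hcl _ (hX h hh).2 with b | b
  · intro v hv
    exact fin h hh a b _ (fin h hh a b v hv)
  · exact absurd (hYW _ a _ b) (hxy h hh)
  · exact absurd (hω.skew0 (hYW _ b _ a)) (hxy h hh)
  · have hhh := H.mul_mem hh hh
    have zero : ∀ v ∈ perp2 ω x x', ω v (h x) = 0 → ω v (h y) = 0 → v = 0 := by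
      intro v hv c d
      have := perp2_plane hω hx a b hv
      rw [c, d] at this
      simpa [hxy h hh] using this
    have hx0 : x ≠ 0 := by rintro rfl; simp at hx
    have hy0 : y ≠ 0 := by intro hy0; rw [hy0] at hx1; simp at hx1
    have hxY : x ∈ Submodule.span F {x, x'} := Submodule.subset_span (by simp)
    have hyYm : y ∈ Submodule.span F {x, x'} := by
      rw [hyY, sub_eq_add_neg, ← neg_smul]; exact hYm _ _
    have A : h (h x) ∈ Submodule.span F {x, x'} := by
      rcases hcl _ (hX _ hhh).1 with c | c
      · exact c
      · exfalso
        have := zero _ c (by simp only [LinearEquiv.mul_apply]; rw [hI h hh]; exact hω.skew0 (hYW _ hxY _ a))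
          (by simp only [LinearEquiv.mul_apply]; rw [hI h hh]; exact hω.skew0 (hYW _ hyYm _ a))
        exact hx0 (by simpa using this)
    have B : h (h y) ∈ Submodule.span F {x, x'} := by
      rcases hcl _ (hX _ hhh).2 with c | c
      · exact c
      · exfalso
        have := zero _ c (by simp only [LinearEquiv.mul_apply]; rw [hI h hh]; exact hω.skew0 (hYW _ hxY _ b))
          (by simp only [LinearEquiv.mul_apply]; rw [hI h hh]; exact hω.skew0 (hYW _ hyYm _ b))
        exact hy0 (by simpa using this)
    exact fin _ hhh A B
end PSp

open Module
section PSp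
open scoped Pointwise
open Polynomial
set_option linter.unusedSectionVars false

variable {F V : Type*} [Field F] [AddCommGroup V] [Module F V] [Finite F] [Finite V]
variable {ω : V →ₗ[F] V →ₗ[F] F} {H : Subgroup (V ≃ₗ[F] V)} {p f q : ℕ}

theorem end_pow (s : V ≃ₗ[F] V) (k : ℕ) (v : V) : ((s : V →ₗ[F] V) ^ k) v = (s ^ k) v := by
  induction k generalizing v with
  | zero => simp
  | succ k ih => rw [pow_succ, pow_succ, Module.End.mul_apply, LinearEquiv.mul_apply, ← ih]; rfl

theorem LemSS (hV : finrank F V = 4) {s : V ≃ₗ[F] V} {n : ℕ} (hn : (n : F) ≠ 0) (hs : s ^ n = 1)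
    {P : F[X]} {k : ℕ} (h : aeval (s : V →ₗ[F] V) (P ^ k) = 0) :
    aeval (s : V →ₗ[F] V) P = 0 := by
  have : FiniteDimensional F V := FiniteDimensional.of_finrank_pos (by rw [hV]; norm_num)
  rw [← minpoly.dvd_iff] at h ⊢
  have h1 : minpoly F (s : V →ₗ[F] V) ∣ X ^ n - 1 := by
    rw [minpoly.dvd_iff]
    ext v
    simp [end_pow, hs]
  have h2 : Squarefree (minpoly F (s : V →ₗ[F] V)) :=
    ((X_pow_sub_one_separable_iff.2 hn).squarefree).squarefree_of_dvd h1
  by_cases hk : k = 0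
  · subst hk
    rw [pow_zero] at h
    exact h.trans (one_dvd _)
  · exact (h2.dvd_pow_iff_dvd hk).1 h

theorem LemR (Q : QF F p f q) {t : F} (ht : t ^ 2 ≠ 4) :
    ((∃ c : F, c ^ 2 - t * c + 1 = 0) ∧ X ^ 2 - C t * X + 1 ∣ X ^ (q - 1) - C (1 : F)) ∨
    ((∀ c : F, c ^ 2 - t * c + 1 ≠ 0) ∧ ∃ ε : F, (ε = 1 ∨ ε = -1) ∧
      X ^ 2 - C t * X + 1 ∣ X ^ ((q + 1) / 2) - C ε) := by
  have : Fintype F := Fintype.ofFinite F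
  have hcard : Fintype.card F = q := by rw [← Q.hc, Nat.card_eq_fintype_card]
  have h2 := Q.two
  set E := AlgebraicClosure F
  have hch := Q.hch
  have : Fact p.Prime := ⟨Q.hp⟩
  have hchE : CharP E p := charP_of_injective_algebraMap (algebraMap F E).injective p
  obtain ⟨ξ, hξ⟩ : ∃ ξ : E, (X ^ 2 - C (algebraMap F E t) * X + 1 : E[X]).IsRoot ξ := by
    apply IsAlgClosed.exists_root
    have : (X ^ 2 - C (algebraMap F E t) * X + 1 : E[X]).degree = 2 := by compute_degree!
    rw [this]; norm_num
  have hξ : ξ ^ 2 - algebraMap F E t * ξ + 1 = 0 := by simpa using hξ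
  set T := algebraMap F E t with hT
  have hroots : ∀ y : E, y ^ 2 - T * y + 1 = 0 → y = ξ ∨ y = T - ξ := by
    intro y hy
    have : (y - ξ) * (y - (T - ξ)) = 0 := by linear_combination hy - hξ
    rcases mul_eq_zero.1 this with h | h
    · left; linear_combination h
    · right; linear_combination h
  have hne : ξ ≠ T - ξ := by
    intro h
    apply ht
    have : T ^ 2 = 4 := by
      have h3 : T = 2 * ξ := by linear_combination -h
      rw [h3] at hξ ⊢
      linear_combination -4 * hξ
    apply (algebraMap F E).injective
    rw [map_pow, ← hT, this, map_ofNat]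
  have hξ0 : ξ ≠ 0 := by rintro h; simp [h] at hξ
  have hinv : ξ * (T - ξ) = 1 := by linear_combination -hξ
  have hmap : (X ^ 2 - C t * X + 1 : F[X]).map (algebraMap F E) = (X - C ξ) * (X - C (T - ξ)) := by
    simp only [Polynomial.map_add, Polynomial.map_sub, Polynomial.map_mul, Polynomial.map_pow,
      Polynomial.map_one, map_X, map_C]
    rw [← hT]
    have : (1 : E[X]) = C (ξ * (T - ξ)) := by rw [hinv, C_1]
    rw [this]
    simp only [C_mul, C_sub]
    ring
  have hfr : ∀ c : F, (algebraMap F E c) ^ q = algebraMap F E c := by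
    intro c
    rw [← map_pow, ← hcard, FiniteField.pow_card]
  have hdiv : ∀ m : ℕ, ∀ ε : F, ξ ^ m = algebraMap F E ε → (T - ξ) ^ m = algebraMap F E ε →
      X ^ 2 - C t * X + 1 ∣ X ^ m - C ε := by
    intro m ε h1 h2
    rw [← Polynomial.map_dvd_map' (algebraMap F E), hmap]
    apply IsCoprime.mul_dvd
    · apply Polynomial.isCoprime_X_sub_C_of_isUnit_sub
      exact (sub_ne_zero.2 hne).isUnit
    · rw [dvd_iff_isRoot]; simp [h1]
    · rw [dvd_iff_isRoot]; simp [h2]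
  have hq1 : q - 1 + 1 = q := by have := Q.h5; omega
  have hfrob : (ξ ^ q) ^ 2 - T * ξ ^ q + 1 = 0 := by
    have hadd : ∀ a b : E, (a + b) ^ q = a ^ q + b ^ q := by
      intro a b; rw [Q.hq]; exact add_pow_char_pow a b p f
    have hTq : T ^ q = T := hfr t
    have h3 : T * ξ = ξ ^ 2 + 1 := by linear_combination -hξ
    have h4 := congrArg (· ^ q) h3
    simp only [mul_pow, hadd, one_pow, hTq] at h4
    rw [h4]; ring
  rcases hroots _ hfrob with h | h
  · left
    have hmem : ∃ c : F, algebraMap F E c = ξ := by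
      have hsplit := FiniteField.X_pow_card_sub_X_ne_zero E (p := q) (by have := Q.h5; omega)
      by_contra hcon
      push Not at hcon
      classical
      have hsub : insert ξ ((Finset.univ : Finset F).map ⟨algebraMap F E, (algebraMap F E).injective⟩)
          ⊆ (X ^ q - X : E[X]).roots.toFinset := by
        intro y hy
        rw [Multiset.mem_toFinset, mem_roots hsplit]
        simp only [Finset.mem_insert, Finset.mem_map, Finset.mem_univ, true_and] at hy
        rcases hy with rfl | ⟨c, rfl⟩
        · simp [h]
        · simp [hfr]
      have := Finset.card_le_card hsub
      rw [Finset.card_insert_of_notMem (by simpa using hcon), Finset.card_map, Finset.card_univ, hcard] at this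
      have h5 := (Multiset.toFinset_card_le _).trans (card_roots' (X ^ q - X : E[X]))
      rw [FiniteField.X_pow_card_sub_X_natDegree_eq E (by have := Q.h5; omega : 1 < q)] at h5
      omega
    obtain ⟨c, hc⟩ := hmem
    refine ⟨⟨c, ?_⟩, ?_⟩
    · apply (algebraMap F E).injective
      simp only [map_add, map_sub, map_mul, map_pow, hc, map_one, map_zero]
      exact hξ
    · have h6 : ξ ^ (q - 1) = 1 := by
        apply mul_right_cancel₀ hξ0
        rw [← pow_succ, hq1, h, one_mul]
      apply hdiv
      · rw [h6, map_one]
      · have : (ξ * (T - ξ)) ^ (q - 1) = 1 := by rw [hinv, one_pow]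
        rw [mul_pow, h6, one_mul] at this
        rw [this, map_one]
  · right
    refine ⟨?_, ?_⟩
    · intro c hc
      have h7 : (algebraMap F E c) ^ 2 - T * (algebraMap F E c) + 1 = 0 := by
        rw [hT, ← map_pow, ← map_mul, ← map_sub, ← map_one (algebraMap F E), ← map_add, hc, map_zero]
      apply hne
      rcases hroots _ h7 with h8 | h8
      · rw [← h, ← h8, hfr]
      · have : ξ = algebraMap F E (t - c) := by rw [map_sub, h8]; ring
        rw [← h, this, hfr]
    · have h9 : (ξ ^ ((q + 1) / 2)) ^ 2 = 1 := by
        rw [← pow_mul, mul_comm, ← Q.e2, pow_succ, h, mul_comm, hinv]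
      have h10 : (T - ξ) ^ ((q + 1) / 2) * ξ ^ ((q + 1) / 2) = 1 := by
        rw [← mul_pow, mul_comm, hinv, one_pow]
      rcases mul_self_eq_one_iff.1 ((sq _).symm.trans h9) with h11 | h11
      · exact ⟨1, Or.inl rfl, hdiv _ _ (by rw [h11, map_one]) (by rw [h11, mul_one] at h10; rw [h10, map_one])⟩
      · exact ⟨-1, Or.inr rfl, hdiv _ _ (by rw [h11]; simp) (by
          rw [h11] at h10; simp; linear_combination -h10)⟩

theorem rel_pow {s : V ≃ₗ[F] V} {t : F} {v : V} (hv : s (s v) = t • s v - v) {m : ℕ} {ε : F}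
    (h : X ^ 2 - C t * X + 1 ∣ X ^ m - C ε) : (s ^ m) v = ε • v := by
  obtain ⟨R, hR⟩ := h
  have h1 : aeval (s : V →ₗ[F] V) (X ^ 2 - C t * X + 1) v = 0 := by
    simp [end_pow, hv, pow_two, Module.algebraMap_end_apply]
  have h2 : aeval (s : V →ₗ[F] V) (X ^ m - C ε) v = 0 := by
    rw [hR, mul_comm, map_mul, Module.End.mul_apply, h1, map_zero]
  simpa [end_pow, Module.algebraMap_end_apply, sub_eq_zero] using h2

theorem nil_ker {N : V →ₗ[F] V} {n : ℕ} (hN : N ^ n = 0) (M : Submodule F V)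
    (hM : ∀ v ∈ M, N v ∈ M) {v : V} (hv : v ∈ M) (hv0 : v ≠ 0) : ∃ y ∈ M, y ≠ 0 ∧ N y = 0 := by
  classical
  have hex : ∃ k, (N ^ k) v = 0 := ⟨n, by simp [hN]⟩
  have hk := Nat.find_spec hex
  have hmin := fun m => Nat.find_min hex (m := m)
  obtain ⟨k, hk'⟩ : ∃ k, k = Nat.find hex := ⟨_, rfl⟩
  rw [← hk'] at hk hmin
  rcases k with _ | k
  · simp at hk; exact absurd hk hv0
  · have hm : ∀ j, (N ^ j) v ∈ M := by
      intro j
      induction j with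
      | zero => simpa
      | succ j ih => rw [pow_succ', Module.End.mul_apply]; exact hM _ ih
    refine ⟨(N ^ k) v, hm k, hmin k (by omega), ?_⟩
    rw [← Module.End.mul_apply, ← pow_succ', hk]

end PSp

open Module
section PSp
open scoped Pointwise
open Polynomial
set_option linter.unusedSectionVars false

variable {F V : Type*} [Field F] [AddCommGroup V] [Module F V] [Finite F] [Finite V]
variable {ω : V →ₗ[F] V →ₗ[F] F} {H : Subgroup (V ≃ₗ[F] V)} {p f q : ℕ}

theorem tv_of_rank1 (hω : Sy ω) {z : V ≃ₗ[F] V} (hz : ∀ v w, ω (z v) (z w) = ω v w) {x : V}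
    (hx : x ≠ 0) (h : ∀ v, ∃ c : F, z v - v = c • x) : ∃ c : F, ∀ v, z v = Tv ω c x v := by
  choose φ hφ using h
  obtain ⟨w0, hw0⟩ := hω.nd1 hx
  refine ⟨- φ w0, fun v => ?_⟩
  have e : ∀ v, z v = v + φ v • x := fun v => by rw [← hφ v]; abel
  have := hz v w0
  rw [e v, e w0] at this
  simp only [map_add, map_smul, LinearMap.add_apply, LinearMap.smul_apply, hω.alt, hw0, smul_eq_mul] at this
  rw [e v, Tv]
  congr 2
  linear_combination this

/-- vector in a 2-dim space with alternating form with a nonzero radical -/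
theorem ti_of_rad (hω : Sy ω) {U : Submodule F V} (hU : finrank F U = 2) {y : V} (hy : y ∈ U)
    (hy0 : y ≠ 0) (h : ∀ v ∈ U, ω y v = 0) : ∀ v ∈ U, ∀ w ∈ U, ω v w = 0 := by
  have key : ∀ v ∈ U, v ∉ Submodule.span F {y} → ∀ w ∈ U, ∃ a b : F, w = a • y + b • v := by
    intro v hv hvy w hw
    have hli : LinearIndependent F ![y, v] := by
      rw [LinearIndependent.pair_iff' hy0]
      intro a ha
      exact hvy (Submodule.mem_span_singleton.2 ⟨a, ha⟩)
    have hsp : Submodule.span F (Set.range ![y, v]) = U := by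
      have : FiniteDimensional F U := FiniteDimensional.of_finrank_pos (by rw [hU]; norm_num)
      apply Submodule.eq_of_le_of_finrank_eq
      · rw [Submodule.span_le]
        rintro _ ⟨i, rfl⟩
        fin_cases i
        · exact hy
        · exact hv
      · rw [finrank_span_eq_card hli, hU]; simp
    rw [← hsp] at hw
    rw [Submodule.mem_span_range_iff_exists_fun] at hw
    obtain ⟨g, hg⟩ := hw
    rw [Fin.sum_univ_two] at hg
    exact ⟨g 0, g 1, by simpa using hg.symm⟩
  intro v hv w hw
  by_cases hvy : v ∈ Submodule.span F {y}
  · obtain ⟨a, rfl⟩ := Submodule.mem_span_singleton.1 hvy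
    simp [h w hw]
  · obtain ⟨a, b, rfl⟩ := key v hv hvy w hw
    simp [hω.alt, hω.skew v y, h v hv]

theorem two_rel {U : Submodule F V} (hU : finrank F U = 2) {s : V →ₗ[F] V} (hs : ∀ v ∈ U, s v ∈ U) :
    ∃ t d : F, ∀ v ∈ U, s (s v) = t • s v - d • v := by
  have : FiniteDimensional F U := FiniteDimensional.of_finrank_pos (by rw [hU]; norm_num)
  by_cases h : ∃ x ∈ U, ∀ c : F, x ≠ 0 ∧ s x ≠ c • x
  · obtain ⟨x, hx, hc⟩ := h
    have hx0 : x ≠ 0 := (hc 0).1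
    have hli : LinearIndependent F ![x, s x] := by
      rw [LinearIndependent.pair_iff' hx0]
      intro a ha
      exact (hc a).2 ha.symm
    have hsp : Submodule.span F (Set.range ![x, s x]) = U := by
      apply Submodule.eq_of_le_of_finrank_eq
      · rw [Submodule.span_le]
        rintro _ ⟨i, rfl⟩
        fin_cases i
        · exact hx
        · exact hs x hx
      · rw [finrank_span_eq_card hli, hU]; simp
    have key : ∀ w ∈ U, ∃ a b : F, w = a • x + b • s x := by
      intro w hw
      rw [← hsp, Submodule.mem_span_range_iff_exists_fun] at hw
      obtain ⟨g, hg⟩ := hw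
      rw [Fin.sum_univ_two] at hg
      exact ⟨g 0, g 1, by simpa using hg.symm⟩
    obtain ⟨a, b, hab⟩ := key _ (hs _ (hs _ hx))
    refine ⟨b, -a, fun v hv => ?_⟩
    obtain ⟨c, d, rfl⟩ := key v hv
    simp only [map_add, map_smul, hab]
    module
  · push Not at h
    have h' : ∀ x ∈ U, ∃ c : F, s x = c • x := by
      intro x hx
      obtain ⟨c, hc⟩ := h x hx
      by_cases hx0 : x = 0
      · exact ⟨0, by simp [hx0]⟩
      · exact ⟨c, hc hx0⟩
    have : ∃ c : F, ∀ x ∈ U, s x = c • x := by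
      by_cases hbot : ∀ x ∈ U, x = 0
      · exact ⟨0, fun x hx => by simp [hbot x hx]⟩
      push Not at hbot
      obtain ⟨x, hx, hx0⟩ := hbot
      obtain ⟨c, hc⟩ := h' x hx
      refine ⟨c, fun y hy => ?_⟩
      by_cases hxy : ∃ a : F, a • x = y
      · obtain ⟨a, rfl⟩ := hxy
        rw [map_smul, hc, smul_comm]
      · push Not at hxy
        have hli : LinearIndependent F ![x, y] := (LinearIndependent.pair_iff' hx0).2 hxy
        obtain ⟨d, hd⟩ := h' y hy
        obtain ⟨e, he⟩ := h' (x + y) (U.add_mem hx hy)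
        rw [map_add, hc, hd] at he
        have h0 : (c - e) • x + (d - e) • y = 0 := by
          have : (c - e) • x + (d - e) • y = (c • x + d • y) - e • (x + y) := by module
          rw [this, he, sub_self]
        have := LinearIndependent.pair_iff.1 hli _ _ h0
        rw [hd]
        congr 1
        linear_combination this.2 - this.1
    obtain ⟨c, hc⟩ := this
    refine ⟨c, 0, fun v hv => ?_⟩
    rw [hc v hv, map_smul, hc v hv]; simp

theorem Uni (hω : Sy ω) (Q : QF F p f q) {z s : V ≃ₗ[F] V} (hz : ∀ v w, ω (z v) (z w) = ω v w)
    (hs : ∀ v w, ω (s v) (s w) = ω v w) (hcomm : ∀ v, s (z v) = z (s v)) (hzp : z ^ p = 1)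
    (hz1 : z ≠ 1) {n : ℕ} (hn : (n : F) ≠ 0) (hsn : s ^ n = 1) :
    (∃ (c : F) (x : V), c ≠ 0 ∧ x ≠ 0 ∧ ∀ v, z v = Tv ω c x v) ∨ (∀ v, s (s v) = v) ∨
    ∃ (t : F) (U : Submodule F V), finrank F U = 2 ∧ (∀ v ∈ U, ∀ w ∈ U, ω v w = 0) ∧
      (∀ v ∈ U, s v ∈ U) ∧ (∀ v, z v - v ∈ U) ∧ (∀ v ∈ U, z v = v) ∧
      (∀ v, s (s v) = t • s v - v) := by
  have hfd : FiniteDimensional F V := FiniteDimensional.of_finrank_pos (by rw [hω.dim]; norm_num)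
  have hch := Q.hch
  have : Fact p.Prime := ⟨Q.hp⟩
  obtain ⟨N, hNd⟩ : ∃ N : V →ₗ[F] V, N = (z : V →ₗ[F] V) - 1 := ⟨_, rfl⟩
  have hN : ∀ v, N v = z v - v := fun v => by simp [hNd]
  have hNs : ∀ v, s (N v) = N (s v) := fun v => by simp [hN, hcomm]
  have hnil : N ^ p = 0 := by
    have hchE : CharP (V →ₗ[F] V) p := by
      have hnt : Nontrivial V := Module.nontrivial_of_finrank_pos (R := F) (by rw [hω.dim]; norm_num)
      exact charP_of_injective_algebraMap (FaithfulSMul.algebraMap_injective F (Module.End F V)) p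
    rw [hNd, sub_pow_char_of_commute _ (Commute.one_right _)]
    ext v
    simp [end_pow, hzp]
  set I := LinearMap.range N with hI
  have hNI : ∀ v, N v ∈ I := fun v => LinearMap.mem_range_self N v
  -- N y = 0 iff y ⊥ I
  have hK : ∀ y, N y = 0 ↔ ∀ v ∈ I, ω y v = 0 := by
    intro y
    constructor
    · rintro hy _ ⟨v, rfl⟩
      have hy' : z y = y := by rwa [hN, sub_eq_zero] at hy
      have := hz y v
      rw [hy'] at this
      rw [hN, map_sub, this, sub_self]
    · intro hy
      apply hω.nd
      intro w
      have h1 := hy _ (hNI (z⁻¹ w))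
      have h2 := hz y (z⁻¹ w)
      rw [hN, app_inv, map_sub] at h1
      rw [app_inv] at h2
      rw [hN, map_sub, LinearMap.sub_apply, h2]
      linear_combination -h1
  have hsI : ∀ v ∈ I, s v ∈ I := by
    rintro _ ⟨v, rfl⟩; rw [hNs]; exact hNI _
  have hrn := N.finrank_range_add_finrank_ker
  rw [hω.dim, ← hI] at hrn
  have hI0 : finrank F I ≠ 0 := by
    intro h0
    apply hz1
    have : I = ⊥ := Submodule.finrank_eq_zero.1 h0
    ext v
    have h1 := hNI v
    rw [this, Submodule.mem_bot, hN, sub_eq_zero] at h1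
    exact h1
  have hK0 : finrank F (LinearMap.ker N) ≠ 0 := by
    intro h0
    have : LinearMap.ker N = ⊥ := Submodule.finrank_eq_zero.1 h0
    have hnt : Nontrivial V := Module.nontrivial_of_finrank_pos (R := F) (by rw [hω.dim]; norm_num)
    obtain ⟨v, hv⟩ := exists_ne (0 : V)
    obtain ⟨y, -, hy0, hy⟩ := nil_ker hnil ⊤ (fun _ _ => trivial) (v := v) trivial hv
    have : y ∈ LinearMap.ker N := hy
    simp_all
  obtain h1 | h1 | h1 : finrank F I = 1 ∨ finrank F I = 2 ∨ finrank F I = 3 := by omega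
  · left
    obtain ⟨x, hx0, hx⟩ := finrank_eq_one_iff'.1 h1
    have hx0' : (x : V) ≠ 0 := by simpa using hx0
    obtain ⟨c, hc⟩ := tv_of_rank1 hω hz hx0' (fun v => by
      obtain ⟨c, hc⟩ := hx ⟨N v, hNI v⟩
      refine ⟨c, ?_⟩
      have := congrArg Subtype.val hc
      rw [← hN]; simpa using this.symm)
    refine ⟨c, x, ?_, hx0', hc⟩
    rintro rfl
    apply hz1
    ext v
    rw [hc v]; simp [Tv]
  · right
    have hex : ∃ y ∈ I, y ≠ 0 ∧ N y = 0 := by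
      have : I ≠ ⊥ := by intro h; rw [h] at h1; simp at h1
      obtain ⟨v, hv, hv0⟩ := Submodule.exists_mem_ne_zero_of_ne_bot this
      exact nil_ker hnil I (fun v _ => hNI v) hv hv0
    obtain ⟨y, hyI, hy0, hNy⟩ := hex
    have hti := ti_of_rad hω h1 hyI hy0 ((hK y).1 hNy)
    have hIK : I = LinearMap.ker N := by
      apply Submodule.eq_of_le_of_finrank_eq
      · intro v hv; exact (hK v).2 (hti v hv)
      · omega
    have hNI0 : ∀ v ∈ I, N v = 0 := fun v hv => (hK v).2 (hti v hv)
    have sym : ∀ v w, ω v (N w) = ω w (N v) := by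
      intro v w
      have e1 := hz v w
      have e2 := hti _ (hNI v) _ (hNI w)
      have e3 : z v = v + N v := by rw [hN]; abel
      have e4 : z w = w + N w := by rw [hN]; abel
      rw [e3, e4] at e1
      simp only [map_add, LinearMap.add_apply, e2] at e1
      rw [hω.skew w]
      linear_combination e1
    have inv : ∀ v w, ω (s v) (N (s w)) = ω v (N w) := by
      intro v w; rw [← hNs, hs]
    obtain ⟨t, d, hrel⟩ := two_rel h1 (s := (s : V →ₗ[F] V)) hsI
    simp only [LinearEquiv.coe_coe] at hrel
    have adj : ∀ w, N (w - t • s w + d • s (s w)) = 0 := by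
      intro w
      apply hω.nd
      intro v
      rw [hω.skew, neg_eq_zero]
      have e1 := hrel (N v) (hNI v)
      rw [hNs, hNs] at e1
      have e2 := congrArg (ω (s (s w))) e1
      simp only [map_sub, map_smul, inv] at e2
      simp only [map_sub, map_add, map_smul, smul_eq_mul] at e2 ⊢
      rw [sym v w, sym v (s w), sym v (s (s w))]
      linear_combination e2
    have comb : ∀ u ∈ I, (1 - d ^ 2) • u = (t * (1 - d)) • s u := by
      rintro _ ⟨w, rfl⟩
      have e1 := adj w
      have e2 := hrel _ (hNI w)
      simp only [map_sub, map_add, map_smul, ← hNs, e2] at e1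
      rw [← sub_eq_zero, ← e1]
      module
    have lift : ∀ t d : F, (∀ u ∈ I, s (s u) = t • s u - d • u) → ∀ v, s (s v) = t • s v - d • v := by
      intro t d hP
      have hR : aeval (s : V →ₗ[F] V) ((X ^ 2 - C t * X + C d) ^ 2) = 0 := by
        ext v
        have e1 : ∀ v, aeval (s : V →ₗ[F] V) (X ^ 2 - C t * X + C d) v = s (s v) - t • s v + d • v := by
          intro v; simp [pow_two, Module.algebraMap_end_apply]
        rw [pow_two, map_mul, Module.End.mul_apply, e1 v]
        have e2 : s (s v) - t • s v + d • v ∈ I := by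
          rw [hIK, LinearMap.mem_ker]
          simp only [map_add, map_sub, map_smul, ← hNs]
          rw [hP _ (hNI v)]
          module
        rw [e1, hP _ e2]
        simp
      have := LemSS hω.dim hn hsn hR
      intro v
      have e3 := congrArg (fun φ => φ v) this
      simp [pow_two, Module.algebraMap_end_apply] at e3
      rw [← sub_eq_zero, ← e3]; module
    have hI0' : ∃ u ∈ I, u ≠ 0 := ⟨y, hyI, hy0⟩
    by_cases hd2 : d ^ 2 = 1
    · rcases mul_self_eq_one_iff.1 ((sq _).symm.trans hd2) with rfl | rfl
      · right
        refine ⟨t, I, h1, hti, hsI, fun v => by rw [← hN]; exact hNI v, fun v hv => ?_, ?_⟩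
        · have := hNI0 v hv
          rwa [hN, sub_eq_zero] at this
        · intro v; simpa using lift t 1 hrel v
      · left
        have e0 := comb y hyI
        have ht : t = 0 := by
          have hsy : s y ≠ 0 := by simpa using hy0
          have e4 : (t * (1 - -1)) • s y = 0 := by rw [← e0]; simp
          rcases smul_eq_zero.1 e4 with h | h
          · rcases mul_eq_zero.1 h with h | h
            · exact h
            · exact absurd (by linear_combination h : (2 : F) = 0) Q.two
          · exact absurd h hsy
        intro v; simpa [ht] using lift t (-1) hrel v
    · left
      have h1d : 1 - d ^ 2 ≠ 0 := fun h => hd2 (by linear_combination -h)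
      have e0 := comb y hyI
      have hk : t * (1 - d) ≠ 0 := by
        intro h
        rw [h, zero_smul] at e0
        exact (smul_ne_zero h1d hy0) e0
      obtain ⟨c, hc⟩ : ∃ c : F, ∀ u ∈ I, s u = c • u := by
        refine ⟨(t * (1 - d))⁻¹ * (1 - d ^ 2), fun u hu => ?_⟩
        rw [mul_smul, comb u hu, smul_smul, inv_mul_cancel₀ hk, one_smul]
      have hc2 : c ^ 2 = 1 := by
        obtain ⟨w, hw⟩ := hyI
        obtain ⟨v, hv⟩ := hω.nd' hy0
        rw [hω.skew, neg_ne_zero, ← hw] at hv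
        have e5 : ω v (N w) = c ^ 2 * ω v (N w) := by
          conv_lhs => rw [← inv, ← hNs, hc _ (hNI w), map_smul, sym, ← hNs, hc _ (hNI v), map_smul, sym]
          simp only [smul_eq_mul]; ring
        apply mul_right_cancel₀ hv
        rw [one_mul, ← e5]
      intro v
      have := lift 0 (-1) (fun u hu => by
        rw [hc u hu, map_smul, hc u hu, smul_smul, ← sq, hc2]; simp) v
      simpa using this
  · right; left
    have hk1 : finrank F (LinearMap.ker N) = 1 := by omega
    obtain ⟨x, hx0, hx⟩ := finrank_eq_one_iff'.1 hk1
    have hx0' : (x : V) ≠ 0 := by simpa using hx0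
    have hker : ∀ v, N v = 0 → ∃ c : F, v = c • (x : V) := by
      intro v hv
      obtain ⟨c, hc⟩ := hx ⟨v, hv⟩
      exact ⟨c, by simpa using (congrArg Subtype.val hc).symm⟩
    have hNx : N x = 0 := x.2
    obtain ⟨l, hl⟩ := hker (s x) (by rw [← hNs, hNx, map_zero])
    by_cases hsc : ∀ v, s v = l • v
    · obtain ⟨w, hw⟩ := hω.nd1 hx0'
      have e1 := hs x w
      rw [hsc, hsc, hw] at e1
      simp [hw] at e1
      intro v
      rw [hsc (s v), hsc v, smul_smul, e1, one_smul]
    · exfalso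
      push Not at hsc
      obtain ⟨v0, hv0⟩ := hsc
      have hex := nil_ker hnil (LinearMap.range ((s : V →ₗ[F] V) - l • 1)) (by
        rintro _ ⟨v, rfl⟩
        exact ⟨N v, by simp [hNs]⟩) (v := s v0 - l • v0) ⟨v0, by simp⟩ (sub_ne_zero.2 hv0)
      obtain ⟨y, ⟨v, hv⟩, hy0, hNy⟩ := hex
      have hv' : s v = l • v + y := by rw [← hv]; simp
      obtain ⟨c, hc⟩ := hker y hNy
      have hsy : s y = l • y := by rw [hc, map_smul, hl, smul_comm]
      have hpw : ∀ k : ℕ, (s ^ (k + 1)) v = l ^ (k + 1) • v + ((k + 1 : ℕ) * l ^ k) • y := by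
        intro k
        induction k with
        | zero => simp [hv']
        | succ k ih =>
          rw [pow_succ', LinearEquiv.mul_apply, ih, map_add, map_smul, map_smul, hv', hsy]
          push_cast
          module
      have hn0 : n ≠ 0 := by rintro rfl; simp at hn
      obtain ⟨k, rfl⟩ := Nat.exists_eq_succ_of_ne_zero hn0
      have e2 := hpw k
      have e3 := pow_eig hsy (k + 1)
      rw [hsn] at e2 e3
      have hl1 : l ^ (k + 1) = 1 := by
        have : (1 - l ^ (k + 1)) • y = 0 := by rw [sub_smul, ← e3]; simp
        rcases smul_eq_zero.1 this with h | h
        · linear_combination -h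
        · exact absurd h hy0
      have hl0 : l ≠ 0 := by rintro rfl; simp at hl1
      rw [hl1] at e2
      have : (((k + 1 : ℕ) : F) * l ^ k) • y = 0 := by
        simpa using e2
      rcases smul_eq_zero.1 this with h | h
      · exact (mul_ne_zero hn (pow_ne_zero _ hl0)) h
      · exact hy0 h
end PSp

open Module
section PSp
open scoped Pointwise
open Polynomial
set_option linter.unusedSectionVars false

variable {F V : Type*} [Field F] [AddCommGroup V] [Module F V] [Finite F] [Finite V]
variable {ω : V →ₗ[F] V →ₗ[F] F} {H : Subgroup (V ≃ₗ[F] V)} {p f q : ℕ}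

def Pm (g : V ≃ₗ[F] V) : Prop := (∀ v, g v = v) ∨ ∀ v, g v = -v
def POrd (g : V ≃ₗ[F] V) (n : ℕ) : Prop := ∀ k : ℕ, Pm (g ^ k) ↔ n ∣ k

theorem QF.q0 (h : QF F p f q) : (q : F) = 0 := by
  have := h.hch
  have : ((p : ℕ) : F) = 0 := CharP.cast_eq_zero F p
  rw [h.hq, Nat.cast_pow, this, zero_pow h.f0]

theorem Pm.two {g : V ≃ₗ[F] V} {k : ℕ} (h : Pm (g ^ k)) : g ^ (2 * k) = 1 := by
  rw [two_mul, pow_add]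
  ext v
  rcases h with h | h <;> simp [h]

theorem POrd.pow {g : V ≃ₗ[F] V} {m n : ℕ} (h : POrd g (m * n)) (hm : 0 < m) : POrd (g ^ m) n := by
  intro k
  rw [← pow_mul, h (m * k)]
  exact Nat.mul_dvd_mul_iff_left hm

theorem iso_pow {s : V ≃ₗ[F] V} (hs : ∀ v w, ω (s v) (s w) = ω v w) (k : ℕ) (v w : V) :
    ω ((s ^ k) v) ((s ^ k) w) = ω v w := by
  induction k with
  | zero => simp
  | succ k ih => rw [pow_succ', LinearEquiv.mul_apply, LinearEquiv.mul_apply, hs, ih]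

theorem avg (hω : Sy ω) {s : V ≃ₗ[F] V}
    (hs : ∀ v w, ω (s v) (s w) = ω v w) {n : ℕ} (hn : (n : F) ≠ 0)
    (hsn : s ^ n = 1) {x : V} (hx0 : x ≠ 0) (hx : s x = x) : ∃ x', ω x x' = 1 ∧ s x' = x' := by
  obtain ⟨v, hv⟩ := hω.nd1 hx0
  have hk : ∀ k : ℕ, ω x ((s ^ k) v) = 1 := by
    intro k
    have := iso_pow hs k x v
    rwa [pow_eig (c := 1) (by simpa using hx), one_pow, one_smul, hv] at this
  refine ⟨(n : F)⁻¹ • ∑ i ∈ Finset.range n, (s ^ i) v, ?_, ?_⟩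
  · simp [hk, hn]
  · rw [map_smul, map_sum]
    congr 1
    have h1 := Finset.sum_range_succ' (fun i => (s ^ i) v) n
    have h2 := Finset.sum_range_succ (fun i => (s ^ i) v) n
    rw [h1, hsn] at h2
    simp only [pow_zero] at h2
    have := add_right_cancel h2
    rw [← this]
    refine Finset.sum_congr rfl fun i _ => ?_
    rw [pow_succ', LinearEquiv.mul_apply]

theorem sq1 (hV : finrank F V = 4) {s : V ≃ₗ[F] V} {n : ℕ} (hn : (n : F) ≠ 0) (hs : s ^ n = 1)
    (h : ∀ v, s (s (s (s v))) = (2 : F) • s (s v) - v) (v : V) : s (s v) = v := by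
  have := LemSS hV hn hs (P := X ^ 2 - 1) (k := 2) (by
    ext v
    have e1 : ∀ v, aeval (s : V →ₗ[F] V) (X ^ 2 - 1 : F[X]) v = s (s v) - v := by
      intro v; simp [pow_two]
    rw [pow_two, map_mul, Module.End.mul_apply, e1, e1]
    simp only [map_sub, h, LinearMap.zero_apply]
    module)
  have e3 := congrArg (fun φ => φ v) this
  simpa [pow_two, sub_eq_zero] using e3

theorem rel4 {s : V ≃ₗ[F] V} {t : F} (ht : t ^ 2 = 4) {v : V} (h : s (s v) = t • s v - v) :
    s (s (s (s v))) = (2 : F) • s (s v) - v := by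
  simp only [h, map_sub, map_smul, smul_sub, smul_smul]
  have : t * t = 4 := by rw [← ht]; ring
  rw [this]; module

theorem W_rel (hω : Sy ω) {s : V ≃ₗ[F] V} (hs : ∀ v w, ω (s v) (s w) = ω v w) {x x' : V}
    (hx : ω x x' = 1) (hsx : s x = x) (hsx' : s x' = x') :
    (∀ w ∈ perp2 ω x x', s w ∈ perp2 ω x x') ∧ ∃ t : F, ∀ w ∈ perp2 ω x x', s (s w) = t • s w - w := by
  have hW : ∀ w ∈ perp2 ω x x', s w ∈ perp2 ω x x' := by
    intro w hw
    rw [mem_perp2] at hw ⊢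
    have h1 := hs x w
    have h2 := hs x' w
    rw [hsx] at h1
    rw [hsx'] at h2
    exact ⟨h1.trans hw.1, h2.trans hw.2⟩
  refine ⟨hW, ?_⟩
  obtain ⟨a, b, hab, h3, h4, h5, h6⟩ := hω.complete hx
  have ha : a ∈ perp2 ω x x' := mem_perp2.2 ⟨h3, h5⟩
  have hb : b ∈ perp2 ω x x' := mem_perp2.2 ⟨h4, h6⟩
  have ex : ∀ w ∈ perp2 ω x x', w = ω w b • a - ω w a • b := by
    intro w hw
    have := perp2_plane hω hx ha hb hw
    rwa [hab, one_smul] at this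
  obtain ⟨α, hα⟩ : ∃ α, α = ω (s a) b := ⟨_, rfl⟩
  obtain ⟨β, hβ⟩ : ∃ α, α = - ω (s a) a := ⟨_, rfl⟩
  obtain ⟨γ, hγ⟩ : ∃ α, α = ω (s b) b := ⟨_, rfl⟩
  obtain ⟨δ, hδ⟩ : ∃ α, α = - ω (s b) a := ⟨_, rfl⟩
  have e1 : s a = α • a + β • b := by rw [ex _ (hW a ha), ← hα, hβ]; module
  have e2 : s b = γ • a + δ • b := by rw [ex _ (hW b hb), ← hγ, hδ]; module
  have hba : ω b a = -1 := by rw [hω.skew, hab]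
  have hd : α * δ - β * γ = 1 := by
    have := hs a b
    rw [e1, e2] at this
    simp only [map_add, map_smul, LinearMap.add_apply, LinearMap.smul_apply, hω.alt, hab, hba, smul_eq_mul] at this
    linear_combination this
  refine ⟨α + δ, fun w hw => ?_⟩
  have ea : s (s a) = (α + δ) • s a - a := by
    simp only [e1, e2, map_add, map_smul]
    have : a = (α * δ - β * γ) • a := by rw [hd, one_smul]
    conv_rhs => rhs; rw [this]
    module
  have eb : s (s b) = (α + δ) • s b - b := by
    simp only [e1, e2, map_add, map_smul]
    have : b = (α * δ - β * γ) • b := by rw [hd, one_smul]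
    conv_rhs => rhs; rw [this]
    module
  rw [ex w hw]
  simp only [map_sub, map_smul, ea, eb]
  module

/-- decomposition of a vector along a hyperbolic pair -/
theorem dec2 (hω : Sy ω) {x x' : V} (hx : ω x x' = 1) (v : V) :
    ∃ (a b : F) (w : V), w ∈ perp2 ω x x' ∧ v = a • x + b • x' + w := by
  refine ⟨ω v x', - ω v x, v - ω v x' • x + ω v x • x', ?_, by module⟩
  rw [mem_perp2]
  simp only [map_add, map_sub, map_smul, hω.alt, hx, hω.skew x' x, smul_eq_mul]
  rw [hω.skew x v, hω.skew x' v]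
  constructor <;> ring

theorem Dcls (hω : Sy ω) (Q : QF F p f q) {g : V ≃ₗ[F] V} (hg : ∀ v w, ω (g v) (g w) = ω v w)
    (hD : POrd g (p * (q + 1))) : ∃ (c : F) (x x' : V) (s : V ≃ₗ[F] V), c ≠ 0 ∧ ω x x' = 1 ∧
    ((∀ v, s v = (g ^ p) v) ∨ (∀ v, s v = -(g ^ p) v)) ∧ s x = x ∧ s x' = x' ∧
    (∀ w ∈ perp2 ω x x', (s ^ ((q + 1) / 2)) w = - w) ∧
    (∀ w ∈ perp2 ω x x', w ≠ 0 → ∀ k : ℕ, (s ^ k) w = w → (q + 1) / 2 ∣ k) ∧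
    ∀ v, (g ^ (2 * (q + 1))) v = Tv ω c x v := by
  have hs := hD.pow Q.hp.pos
  have hp3 := Q.p3
  have h5 := Q.h5
  have hs1 := iso_pow hg p
  have hn : ((2 * (q + 1) : ℕ) : F) ≠ 0 := by
    push_cast; rw [Q.q0, zero_add, mul_one]; exact Q.two
  have hsn : (g ^ p) ^ (2 * (q + 1)) = 1 := Pm.two ((hs (q + 1)).2 dvd_rfl)
  have hss : ¬ ∀ v, (g ^ p) ((g ^ p) v) = v := by
    intro h
    have := (hs 2).1 (Or.inl fun v => by simp [pow_two, h])
    have := Nat.le_of_dvd (by norm_num) this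
    omega
  have hz1 : g ^ (2 * (q + 1)) ≠ 1 := by
    intro h
    have := (hD (2 * (q + 1))).1 (Or.inl fun v => by rw [h]; rfl)
    have := Nat.le_of_dvd (by norm_num) (Nat.dvd_of_mul_dvd_mul_right (by omega) this)
    omega
  have hzp : (g ^ (2 * (q + 1))) ^ p = 1 := by rw [← pow_mul, mul_comm, pow_mul]; exact hsn
  have key : ∀ (t : F) (ht : t ^ 2 ≠ 4) (W : Submodule F V) (s : V ≃ₗ[F] V)
      (_ : ∀ w ∈ W, s (s w) = t • s w - w)
      (_ : ∀ k, (∀ w ∈ W, (s ^ k) w = w) → q + 1 ∣ k), (∀ c : F, c ^ 2 - t * c + 1 ≠ 0) ∧ 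
        ∀ w ∈ W, (s ^ ((q + 1) / 2)) w = - w := by
    intro t ht W s hst hW
    rcases LemR Q ht with ⟨-, h⟩ | ⟨hr, ε, rfl | rfl, h⟩
    · have h1 := hW (q - 1) fun w hw => by rw [rel_pow (hst w hw) h, one_smul]
      have := Nat.le_of_dvd (by omega) h1
      omega
    · have h1 := hW ((q + 1) / 2) fun w hw => by rw [rel_pow (hst w hw) h, one_smul]
      have := Nat.le_of_dvd (by omega) h1
      omega
    · exact ⟨hr, fun w hw => by rw [rel_pow (hst w hw) h, neg_smul, one_smul]⟩
  rcases Uni hω Q (iso_pow hg (2 * (q + 1))) hs1 (fun v => by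
    rw [← LinearEquiv.mul_apply, ← LinearEquiv.mul_apply, ← pow_add, ← pow_add, add_comm]) hzp hz1 hn hsn with
    ⟨c, x, hc, hx0, hT⟩ | h | ⟨t, U, -, -, -, -, -, hst⟩
  · obtain ⟨y, hy⟩ := hω.nd1 hx0
    have hyx : ω y x = -1 := by rw [hω.skew, hy]
    obtain ⟨l, hl, hl2⟩ : ∃ l : F, (g ^ p) x = l • x ∧ l * l = 1 := by
      have e1 : (g ^ p) ((g ^ (2 * (q + 1))) y) = (g ^ (2 * (q + 1))) ((g ^ p) y) := by
        rw [← LinearEquiv.mul_apply, ← LinearEquiv.mul_apply, ← pow_add, ← pow_add, add_comm]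
      rw [hT, hT] at e1
      simp only [Tv, map_add, map_smul] at e1
      have e2 := add_left_cancel e1
      rw [hyx, mul_smul, mul_smul] at e2
      have e3 := smul_right_injective V hc e2
      have e4 : (g ^ p) x = (- ω ((g ^ p) y) x) • x := by
        rw [neg_smul, ← e3]; simp
      refine ⟨_, e4, ?_⟩
      have e5 := hs1 y x
      rw [e4, hyx, map_smul, smul_eq_mul] at e5
      linear_combination -e5
    obtain ⟨s, hse, hsx⟩ : ∃ s : V ≃ₗ[F] V, ((∀ v, s v = (g ^ p) v) ∨ (∀ v, s v = -(g ^ p) v)) ∧ s x = x := by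
      rcases mul_self_eq_one_iff.1 hl2 with rfl | rfl
      · exact ⟨g ^ p, Or.inl fun _ => rfl, by simpa using hl⟩
      · exact ⟨(g ^ p).trans (LinearEquiv.neg F), Or.inr fun v => by simp, by simp [hl]⟩
    have hsk : ∀ k, (∀ v, (s ^ k) v = ((g ^ p) ^ k) v) ∨ (∀ v, (s ^ k) v = -((g ^ p) ^ k) v) := by
      intro k
      induction k with
      | zero => left; simp
      | succ k ih =>
        simp only [pow_succ' s, pow_succ' (g ^ p), LinearEquiv.mul_apply]
        rcases hse with h | h <;> rcases ih with h' | h' <;> simp [h, h']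
    have hsi : ∀ v w, ω (s v) (s w) = ω v w := by
      intro v w
      rcases hse with h | h <;> simp [h, hs1]
    have hs' : ∀ k, (∀ v, (s ^ k) v = v) → q + 1 ∣ k := by
      intro k hk
      rw [← hs k]
      rcases hsk k with h | h
      · left; intro v; rw [← h, hk]
      · right; intro v; rw [← neg_eq_iff_eq_neg, ← h, hk]
    have hsn' : s ^ (2 * (q + 1)) = 1 := by
      apply Pm.two
      have := (hs (q + 1)).2 dvd_rfl
      rcases this with h | h <;> rcases hsk (q + 1) with h' | h'
      · left; intro v; rw [h', h]
      · right; intro v; rw [h', h]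
      · right; intro v; rw [h', h]
      · left; intro v; rw [h', h, neg_neg]
    obtain ⟨x', hx, hsx'⟩ := avg hω hsi hn hsn' hx0 hsx
    obtain ⟨hW, t, ht⟩ := W_rel hω hsi hx hsx hsx'
    have hfix : ∀ k, (∀ w ∈ perp2 ω x x', (s ^ k) w = w) → ∀ v, (s ^ k) v = v := by
      intro k hk v
      obtain ⟨a, b, w, hw, rfl⟩ := dec2 hω hx v
      have e1 := pow_eig (s := s) (c := 1) (v := x) (by simpa using hsx) k
      have e2 := pow_eig (s := s) (c := 1) (v := x') (by simpa using hsx') k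
      simp only [one_pow, one_smul] at e1 e2
      simp [e1, e2, hk w hw]
    have ht4 : t ^ 2 ≠ 4 := by
      intro h4
      have h1 := sq1 hω.dim hn hsn' (fun v => by
        obtain ⟨a, b, w, hw, rfl⟩ := dec2 hω hx v
        simp only [map_add, map_smul, hsx, hsx', rel4 h4 (ht w hw)]
        module)
      have := hs' 2 (fun v => by simp [pow_two, h1])
      have := Nat.le_of_dvd (by norm_num) this
      omega
    obtain ⟨hr, hse'⟩ := key t ht4 (perp2 ω x x') s ht (fun k hk => hs' k (hfix k hk))
    refine ⟨c, x, x', s, hc, hx, hse, hsx, hsx', hse', ?_, hT⟩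
    intro w hw hw0 k hk
    have hww : ω w (s w) ≠ 0 := by
      intro h0
      have e1 : ∀ y ∈ perp2 ω x x', ω y (s w) • w = ω y w • s w := by
        intro y hy
        have := perp2_plane hω hx hw (hW w hw) hy
        rw [h0, zero_smul] at this
        exact sub_eq_zero.1 this.symm
      obtain ⟨y', hy'⟩ := hω.nd1 hw0
      obtain ⟨a, b, y, hy, rfl⟩ := dec2 hω hx y'
      rw [mem_perp2] at hw
      simp only [map_add, map_smul, hω.skew0 hw.1, hω.skew0 hw.2, smul_zero, zero_add] at hy'
      have e2 := e1 y hy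
      rw [hω.skew y w, hy'] at e2
      have e3 : s w = (- ω y (s w)) • w := by rw [neg_smul, e2]; simp
      obtain ⟨d, hd⟩ : ∃ d : F, s w = d • w := ⟨_, e3⟩
      have e4 := ht w (mem_perp2.2 hw)
      rw [hd, map_smul, hd] at e4
      apply hr d
      have e5 : (d ^ 2 - t * d + 1) • w = 0 := by
        have : (d ^ 2 - t * d + 1) • w = d • d • w - (t • d • w - w) := by module
        rw [this, e4, sub_self]
      exact (smul_eq_zero.1 e5).resolve_right hw0
    have hk' : (s ^ k) (s w) = s w := by
      rw [← LinearEquiv.mul_apply, ← pow_succ, pow_succ', LinearEquiv.mul_apply, hk]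
    refine dvd_trans ⟨2, by rw [mul_comm]; exact Q.e2⟩ (hs' k (hfix k fun y hy => ?_))
    have e1 := perp2_plane hω hx hw (hW w hw) hy
    apply smul_right_injective V hww
    simp only
    rw [← map_smul, e1, map_sub, map_smul, map_smul, hk, hk']
  · exact absurd h hss
  · exfalso
    have ht4 : t ^ 2 ≠ 4 := fun h4 => hss (sq1 hω.dim hn hsn fun v => rel4 h4 (hst v))
    have := (key t ht4 ⊤ (g ^ p) (fun w _ => hst w) (fun k hk => (hs k).1 (Or.inl fun v => hk v trivial))).2
    have h1 := (hs ((q + 1) / 2)).1 (Or.inr fun v => this v trivial)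
    have := Nat.le_of_dvd (by omega) h1
    omega
end PSp

open Module
section PSp
open scoped Pointwise
open Polynomial
set_option linter.unusedSectionVars false

variable {F V : Type*} [Field F] [AddCommGroup V] [Module F V] [Finite F] [Finite V]
variable {ω : V →ₗ[F] V →ₗ[F] F} {H : Subgroup (V ≃ₗ[F] V)} {p f q : ℕ}

theorem memF {K : Type*} [Field K] [Algebra F K] {a : K} (h : a ^ Nat.card F = a) :
    ∃ c : F, algebraMap F K c = a := by
  have : Fintype F := Fintype.ofFinite F
  rw [Nat.card_eq_fintype_card] at h
  have h1 : ((X ^ Fintype.card F - X : F[X]).roots.map (fun a => X - C a)).prod = X ^ Fintype.card F - X := by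
    apply Polynomial.prod_multiset_X_sub_C_of_monic_of_roots_card_eq
    · apply monic_X_pow_sub
      rw [degree_X]
      exact_mod_cast Fintype.one_lt_card
    · rw [FiniteField.roots_X_pow_card_sub_X, FiniteField.X_pow_card_sub_X_natDegree_eq _ Fintype.one_lt_card]
      rfl
  have h2 := congrArg (aeval a) h1
  rw [map_multiset_prod, Multiset.map_map] at h2
  simp only [map_sub, map_pow, aeval_X, h, sub_self] at h2
  rw [Multiset.prod_eq_zero_iff, Multiset.mem_map] at h2
  obtain ⟨c, -, hc⟩ := h2
  refine ⟨c, ?_⟩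
  simp [sub_eq_zero] at hc
  exact hc.symm

theorem primRoot (n : ℕ) (h : (n : F) ≠ 0) : ∃ ζ : AlgebraicClosure F, IsPrimitiveRoot ζ n := by
  have : NeZero (n : AlgebraicClosure F) := ⟨by
    intro h0; apply h; apply (algebraMap F (AlgebraicClosure F)).injective; simpa using h0⟩
  exact HasEnoughRootsOfUnity.exists_primitiveRoot (AlgebraicClosure F) n

theorem QF.frob (Q : QF F p f q) (a b : AlgebraicClosure F) : (a + b) ^ q = a ^ q + b ^ q := by
  have := Q.hch
  have : CharP (AlgebraicClosure F) p := charP_of_injective_algebraMap (algebraMap F _).injective p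
  have : Fact p.Prime := ⟨Q.hp⟩
  rw [Q.hq, add_pow_char_pow]

theorem Xi (Q : QF F p f q) : ∃ τ : F, (∀ c : F, c ^ 2 - τ * c + 1 ≠ 0) ∧
    ∀ (s : V ≃ₗ[F] V) (v : V), v ≠ 0 → s (s v) = τ • s v - v → ∀ k : ℕ, (s ^ k) v = v ↔ q + 1 ∣ k := by
  obtain ⟨ξ, hξ⟩ := primRoot (F := F) (q + 1) (by push_cast; rw [Q.q0]; simp)
  have h5 := Q.h5
  have h0 : ξ ≠ 0 := hξ.ne_zero (by omega)
  have hq : ξ ^ q = ξ⁻¹ := by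
    apply eq_inv_of_mul_eq_one_left; rw [← pow_succ, hξ.pow_eq_one]
  obtain ⟨τ, hτ⟩ := memF (F := F) (a := ξ + ξ⁻¹) (by
    rw [Q.hc, Q.frob, inv_pow, hq, inv_inv, add_comm])
  have hP : aeval ξ (X ^ 2 - C τ * X + 1 : F[X]) = 0 := by
    simp [hτ]; field_simp; ring
  have hroot : ∀ c : F, c ^ 2 - τ * c + 1 ≠ 0 := by
    intro c hc
    have hc0 : c ≠ 0 := by rintro rfl; simp at hc
    have e1 : (ξ - algebraMap F _ c) * (ξ - algebraMap F _ c⁻¹) = 0 := by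
      have : τ = c + c⁻¹ := by field_simp; linear_combination -hc
      have e2 : ξ + ξ⁻¹ = algebraMap F _ c + algebraMap F _ c⁻¹ := by rw [← hτ, this, map_add]
      have e3 : algebraMap F (AlgebraicClosure F) c * algebraMap F _ c⁻¹ = 1 := by
        rw [← map_mul, mul_inv_cancel₀ hc0, map_one]
      have e4 : ξ * ξ⁻¹ = 1 := mul_inv_cancel₀ h0
      linear_combination ξ * e2 + e3 - e4
    have key : ∀ d : F, d ≠ 0 → ξ - algebraMap F _ d = 0 → False := by
      intro d hd h
      have : ξ ^ (q - 1) = 1 := by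
        rw [sub_eq_zero.1 h, ← map_pow, Q.fpow hd, map_one]
      have := Nat.le_of_dvd (by omega) (hξ.dvd_of_pow_eq_one _ this)
      omega
    rcases mul_eq_zero.1 e1 with h | h
    · exact key c hc0 h
    · exact key _ (inv_ne_zero hc0) h
  have hdeg : (X ^ 2 - C τ * X + 1 : F[X]).natDegree = 2 := by
    compute_degree!
  have hmon : (X ^ 2 - C τ * X + 1 : F[X]).Monic := by
    monicity!
  have hirr : Irreducible (X ^ 2 - C τ * X + 1 : F[X]) := by
    rw [Polynomial.Monic.irreducible_iff_roots_eq_zero_of_degree_le_three hmon (by omega) (by omega)]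
    rw [Multiset.eq_zero_iff_forall_notMem]
    intro c hc
    rw [mem_roots hmon.ne_zero, IsRoot] at hc
    apply hroot c
    simpa using hc
  refine ⟨τ, hroot, fun s v hv hsv k => ?_⟩
  rcases (EuclideanDomain.dvd_or_coprime _ (X ^ k - C 1) hirr).symm with hco | hdv
  · have h1 : ξ ^ k ≠ 1 := by
      intro h
      obtain ⟨a, b, hab⟩ := hco
      have := congrArg (aeval ξ) hab
      rw [map_add, map_mul, map_mul, hP] at this
      simp [h] at this
    have h2 : (s ^ k) v ≠ v := by
      intro h
      obtain ⟨a, b, hab⟩ := hco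
      have := congrArg (fun P => aeval (s : V →ₗ[F] V) P v) hab
      rw [mul_comm a, mul_comm b, mul_comm _ a, mul_comm _ b] at this
      simp [end_pow, h, Module.End.mul_apply, pow_two, hsv, Module.algebraMap_end_apply] at this
      exact hv this.symm
    constructor
    · intro h; exact absurd h h2
    · intro h; exact absurd ((hξ.pow_eq_one_iff_dvd k).2 h) h1
  · have h1 : (s ^ k) v = v := by rw [rel_pow hsv hdv, one_smul]
    have h2 : ξ ^ k = 1 := by
      obtain ⟨R, hR⟩ := hdv
      have := congrArg (aeval ξ) hR
      rw [map_mul, hP, zero_mul] at this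
      simpa [sub_eq_zero] using this
    exact ⟨fun _ => (hξ.pow_eq_one_iff_dvd k).1 h2, fun _ => h1⟩

theorem isoEquiv (hω : Sy ω) (φ : V →ₗ[F] V) (h : ∀ v w, ω (φ v) (φ w) = ω v w) :
    ∃ g : V ≃ₗ[F] V, ∀ v, g v = φ v := by
  have hfd : FiniteDimensional F V := FiniteDimensional.of_finrank_pos (by rw [hω.dim]; norm_num)
  have hinj : Function.Injective φ := by
    rw [← LinearMap.ker_eq_bot, LinearMap.ker_eq_bot']
    intro v hv
    apply hω.nd
    intro w
    rw [← h, hv]; simp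
  exact ⟨LinearEquiv.ofInjectiveEndo φ hinj, fun v => rfl⟩

theorem mkIso (hω : Sy ω) {e f e' f' : V} (h1 : ω e f = 1) (h2 : ω e' f' = 1)
    (h3 : ω e e' = 0) (h4 : ω e f' = 0) (h5 : ω f e' = 0) (h6 : ω f f' = 0) {a b a' b' : V}
    (k1 : ω a b = 1) (k2 : ω a' b' = 1)
    (k3 : ω a a' = 0) (k4 : ω a b' = 0) (k5 : ω b a' = 0) (k6 : ω b b' = 0) :
    ∃ g : V ≃ₗ[F] V, (∀ v w, ω (g v) (g w) = ω v w) ∧ g e = a ∧ g f = b ∧ g e' = a' ∧ g f' = b' := by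
  let φ : V →ₗ[F] V := (ω.flip f).smulRight a - (ω.flip e).smulRight b + (ω.flip f').smulRight a'
    - (ω.flip e').smulRight b'
  have hφ : ∀ v, φ v = ω v f • a - ω v e • b + ω v f' • a' - ω v e' • b' := fun v => by simp [φ]
  have hiso : ∀ v w, ω (φ v) (φ w) = ω v w := by
    intro v w
    have : ω v w = ω (ω v f • e - ω v e • f + ω v f' • e' - ω v e' • f')
        (ω w f • e - ω w e • f + ω w f' • e' - ω w e' • f') := by
      rw [← hω.expand h1 h2 h3 h4 h5 h6 v, ← hω.expand h1 h2 h3 h4 h5 h6 w]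
    rw [this, hφ, hφ]
    simp only [map_add, map_sub, map_smul, LinearMap.add_apply, LinearMap.sub_apply, LinearMap.smul_apply,
      hω.alt, h1, h2, h3, h4, h5, h6, k1, k2, k3, k4, k5, k6, hω.skew f e, hω.skew e' e, hω.skew f' e,
      hω.skew e' f, hω.skew f' f, hω.skew f' e', hω.skew b a, hω.skew a' a, hω.skew b' a,
      hω.skew a' b, hω.skew b' b, hω.skew b' a']
  obtain ⟨g, hg⟩ := isoEquiv hω φ hiso
  refine ⟨g, fun v w => by rw [hg, hg, hiso], ?_, ?_, ?_, ?_⟩ <;> rw [hg, hφ] <;>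
  simp [hω.alt, h1, h2, h3, h4, h5, h6, hω.skew f e, hω.skew e' e, hω.skew f' e,
      hω.skew e' f, hω.skew f' f, hω.skew f' e']

theorem DEx (hω : Sy ω) (Q : QF F p f q) {x : V} (hx0 : x ≠ 0) {c : F} (hc : c ≠ 0) :
    ∃ h : V ≃ₗ[F] V, (∀ v w, ω (h v) (h w) = ω v w) ∧ POrd h (p * (q + 1)) ∧
      ∀ v, (h ^ (q + 1)) v = Tv ω c x v := by
  obtain ⟨x', hx⟩ := hω.nd1 hx0
  obtain ⟨a, b, hab, h3, h4, h5, h6⟩ := hω.complete hx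
  obtain ⟨τ, -, hτ⟩ := Xi (V := V) Q
  obtain ⟨h, hi, hhx, hhx', ha, hb⟩ := mkIso hω hx hab h3 h4 h5 h6 (a := x) (b := x' - c • x)
    (a' := b) (b' := τ • b - a) (by simp [hω.alt, hx]) (by simp [hω.alt, hω.skew b a, hab]) h4
    (by simp [h3, h4]) (by simp [h4, h6]) (by simp [h3, h4, h5, h6])
  have hrel : ∀ w ∈ perp2 ω x x', h (h w) = τ • h w - w := by
    intro w hw
    have := perp2_plane hω hx (mem_perp2.2 ⟨h3, h5⟩) (mem_perp2.2 ⟨h4, h6⟩) hw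
    rw [hab, one_smul] at this
    rw [this]
    simp only [map_sub, map_smul, ha, hb]
    module
  have hk1 : ∀ k : ℕ, (h ^ k) x = x := fun k => by
    have := pow_eig (s := h) (c := 1) (v := x) (by simpa using hhx) k
    simpa using this
  have hk2 : ∀ k : ℕ, (h ^ k) x' = x' - ((k : F) * c) • x := by
    intro k
    induction k with
    | zero => simp
    | succ k ih =>
      rw [pow_succ', LinearEquiv.mul_apply, ih, map_sub, map_smul, hhx, hhx']
      push_cast; module
  have hk3 : ∀ k : ℕ, q + 1 ∣ k → ∀ w ∈ perp2 ω x x', (h ^ k) w = w := by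
    intro k hk w hw
    by_cases hw0 : w = 0
    · simp [hw0]
    · exact (hτ h w hw0 (hrel w hw) k).2 hk
  have ha0 : a ≠ 0 := by rintro rfl; simp at hab
  have := Q.hch
  refine ⟨h, hi, fun k => ⟨?_, ?_⟩, ?_⟩
  · rintro (hk | hk)
    · have e1 := (hτ h a ha0 (hrel a (mem_perp2.2 ⟨h3, h5⟩)) k).1 (hk a)
      have e2 := hk2 k
      rw [hk] at e2
      have e3 : ((k : F) * c) • x = 0 := by
        have := congrArg (fun y => x' - y) e2
        simpa using this.symm
      have e4 : (k : F) = 0 := by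
        simpa [hx0, hc] using e3
      rw [CharP.cast_eq_zero_iff F p] at e4
      apply Nat.Coprime.mul_dvd_of_dvd_of_dvd _ e4 e1
      rw [Q.hp.coprime_iff_not_dvd, ← CharP.cast_eq_zero_iff F p]
      push_cast; rw [Q.q0]; simp
    · exfalso
      have e1 := hk1 k
      rw [hk] at e1
      have : (2 : F) • x = 0 := by
        rw [two_smul]; nth_rw 1 [← e1]; simp
      rcases smul_eq_zero.1 this with h | h
      · exact Q.two h
      · exact hx0 h
  · intro hk
    left
    intro v
    obtain ⟨α, β, w, hw, rfl⟩ := dec2 hω hx v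
    have e1 : (k : F) = 0 := (CharP.cast_eq_zero_iff F p k).2 (dvd_of_mul_right_dvd hk)
    simp [hk1, hk2, hk3 k (dvd_of_mul_left_dvd hk) w hw, e1]
  · intro v
    obtain ⟨α, β, w, hw, rfl⟩ := dec2 hω hx v
    have hw' := mem_perp2.1 hw
    simp only [map_add, map_smul, hk1, hk2, hk3 _ dvd_rfl w hw, Tv, LinearMap.add_apply,
      LinearMap.smul_apply, hω.alt, hω.skew x' x, hx, hω.skew0 hw'.1]
    push_cast
    rw [Q.q0]
    simp only [smul_eq_mul]
    module

structure ED (ω : V →ₗ[F] V →ₗ[F] F) (q : ℕ) (s u : V ≃ₗ[F] V) (τ : F) (U : Submodule F V) : Prop where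
  dim : finrank F U = 2
  ti : ∀ v ∈ U, ∀ w ∈ U, ω v w = 0
  sU : ∀ v ∈ U, s v ∈ U
  uV : ∀ v, u v - v ∈ U
  uU : ∀ v ∈ U, u v = v
  rel : ∀ v, s (s v) = τ • s v - v
  irr : ∀ c : F, c ^ 2 - τ * c + 1 ≠ 0
  comm : ∀ v, s (u v) = u (s v)
  ne : ∃ v, u v ≠ v
  ord : POrd s ((q + 1) / 2)
  si : ∀ v w, ω (s v) (s w) = ω v w
  ui : ∀ v w, ω (u v) (u w) = ω v w

theorem Ecls (hω : Sy ω) (Q : QF F p f q) {g : V ≃ₗ[F] V} (hg : ∀ v w, ω (g v) (g w) = ω v w)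
    (hE : POrd g (p * ((q + 1) / 2))) (hne : ∀ h : V ≃ₗ[F] V, (∀ v w, ω (h v) (h w) = ω v w) →
      POrd h (p * (q + 1)) → ¬ ∀ v, (h ^ (q + 1)) v = (g ^ (q + 1)) v) :
    ∃ (τ : F) (U : Submodule F V), ED ω q (g ^ p) (g ^ (q + 1)) τ U := by
  have hs := hE.pow Q.hp.pos
  have hp3 := Q.p3
  have h5 := Q.h5
  have he2 := Q.e2
  have he3 := Q.e3
  have hs1 := iso_pow hg p
  have hn : ((q + 1 : ℕ) : F) ≠ 0 := by
    push_cast; rw [Q.q0, zero_add]; exact one_ne_zero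
  have hsn : (g ^ p) ^ (q + 1) = 1 := by
    rw [he2]; exact Pm.two ((hs ((q + 1) / 2)).2 dvd_rfl)
  have hss : ¬ ∀ v, (g ^ p) ((g ^ p) v) = v := by
    intro h
    have := (hs 2).1 (Or.inl fun v => by simp [pow_two, h])
    have := Nat.le_of_dvd (by norm_num) this
    omega
  have hz1 : g ^ (q + 1) ≠ 1 := by
    intro h
    have h1 := (hE (q + 1)).1 (Or.inl fun v => by rw [h]; rfl)
    generalize (q + 1) / 2 = e at *
    rw [he2] at h1
    have := Nat.le_of_dvd (by norm_num) (Nat.dvd_of_mul_dvd_mul_right (by omega) h1)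
    omega
  have hzp : (g ^ (q + 1)) ^ p = 1 := by rw [← pow_mul, mul_comm, pow_mul]; exact hsn
  have hcomm : ∀ v, (g ^ p) ((g ^ (q + 1)) v) = (g ^ (q + 1)) ((g ^ p) v) := fun v => by
    rw [← LinearEquiv.mul_apply, ← LinearEquiv.mul_apply, ← pow_add, ← pow_add, add_comm]
  rcases Uni hω Q (iso_pow hg (q + 1)) hs1 hcomm hzp hz1 hn hsn with
    ⟨c, x, hc, hx0, hT⟩ | h | ⟨t, U, hU, hti, hsU, h1, h2, hst⟩
  · exfalso
    obtain ⟨h, hi, hD, hq⟩ := DEx hω Q hx0 hc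
    exact hne h hi hD fun v => by rw [hq, hT]
  · exact absurd h hss
  · have ht4 : t ^ 2 ≠ 4 := fun h4 => hss (sq1 hω.dim hn hsn fun v => rel4 h4 (hst v))
    rcases LemR Q ht4 with ⟨-, h⟩ | ⟨hr, -⟩
    · exfalso
      exact Q.en ((hs (q - 1)).1 (Or.inl fun v => by rw [rel_pow (hst v) h, one_smul]))
    · refine ⟨t, U, hU, hti, hsU, h1, h2, hst, hr, hcomm, ?_, hs, hs1, iso_pow hg _⟩
      by_contra hcon
      push Not at hcon
      exact hz1 (by ext v; exact hcon v)

theorem Acls (hV : finrank F V = 4) (Q : QF F p f q) {g : V ≃ₗ[F] V} (hA : POrd g ((q ^ 2 + 1) / 2))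
    (L : Submodule F V) (hL : finrank F L = 1 ∨ finrank F L = 2) {k : ℕ}
    (hk : ∀ v ∈ L, (g ^ k) v ∈ L) : (q ^ 2 + 1) / 2 ∣ k := by
  obtain ⟨m, hm⟩ := Q.ho
  have hN : (q ^ 2 + 1) / 2 = 2 * (m ^ 2 + m) + 1 := by
    have : q ^ 2 + 1 = 2 * (2 * (m ^ 2 + m) + 1) := by rw [hm]; ring
    omega
  have hN2 : q ^ 2 + 1 = 2 * ((q ^ 2 + 1) / 2) := by
    rw [hN, hm]; ring
  generalize hNd : (q ^ 2 + 1) / 2 = N at *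
  by_contra hcon
  have hNpos : 0 < N := by omega
  obtain ⟨d, M, K, hd, hcop, hNM, hkK⟩ := Nat.exists_coprime' (m := N) (n := k) (Nat.gcd_pos_of_pos_left k hNpos)
  have hM1 : M ≠ 1 := by
    rintro rfl
    apply hcon
    rw [hNM, hkK]; simp
  obtain ⟨r, hr, M', hM'⟩ := Nat.exists_prime_and_dvd hM1
  have hrN : r ∣ N := ⟨M' * d, by rw [hNM, hM']; ring⟩
  have hr2 : r ≠ 2 := by
    rintro rfl
    obtain ⟨j, hj⟩ := hrN
    omega
  have h1 : (g ^ (k * (2 * M'))) ^ r = 1 := by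
    rw [← pow_mul, show k * (2 * M') * r = 2 * (N * K) by rw [hNM, hkK, hM']; ring]
    exact Pm.two ((hA _).2 (dvd_mul_right _ _))
  have h2 : ∀ j : ℕ, ∀ v ∈ L, (g ^ (k * j)) v ∈ L := by
    intro j
    induction j with
    | zero => simp
    | succ j ih =>
      intro v hv
      rw [Nat.mul_succ, pow_add, LinearEquiv.mul_apply]
      exact ih _ (hk v hv)
  have h3 := LemA hV hr hr2 (by rw [Q.hc, hN2]; exact Dvd.dvd.mul_left hrN 2) h1 L hL (h2 _)
  have h4 := (hA _).1 (Or.inl fun v => by rw [h3]; rfl)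
  have hM0 : 0 < M' * d := by
    rcases Nat.eq_zero_or_pos (M' * d) with h | h
    · rw [hNM, hM', mul_assoc, h] at hNpos; simp at hNpos
    · exact h
  have h5 : r ∣ K * 2 := by
    rw [hNM, hkK, hM', show r * M' * d = r * (M' * d) by ring, show K * d * (2 * M') = K * 2 * (M' * d) by ring] at h4
    exact Nat.dvd_of_mul_dvd_mul_right hM0 h4
  rcases hr.dvd_mul.1 h5 with h | h
  · have := Nat.dvd_gcd (⟨M', hM'⟩ : r ∣ M) h
    rw [hcop] at this
    exact hr.one_lt.ne' (Nat.dvd_one.1 this)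
  · exact hr2 ((Nat.prime_dvd_prime_iff_eq hr Nat.prime_two).1 h)

theorem QF.N13 (Q : QF F p f q) : 13 ≤ (q ^ 2 + 1) / 2 := by
  have := Q.h5
  have : 5 ^ 2 ≤ q ^ 2 := Nat.pow_le_pow_left this 2
  omega

theorem hyp_dim (hω : Sy ω) {x x' : V} (hx : ω x x' = 1) : finrank F (Submodule.span F {x, x'}) = 2 := by
  have hx0 : x ≠ 0 := by rintro rfl; simp at hx
  have hli : LinearIndependent F ![x, x'] := by
    rw [LinearIndependent.pair_iff' hx0]
    intro a ha
    rw [← ha, map_smul, hω.alt] at hx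
    simp at hx
  have := finrank_span_eq_card hli
  rw [Matrix.range_cons_cons_empty] at this
  simpa using this

theorem sgn_mem (hneg : Has H (fun v => -v)) {g s : V ≃ₗ[F] V} (hg : g ∈ H)
    (hs : (∀ v, s v = g v) ∨ (∀ v, s v = -g v)) : s ∈ H := by
  rcases hs with h | h
  · have : s = g := by ext v; exact h v
    rwa [this]
  · obtain ⟨n, hn, hn'⟩ := hneg
    have : s = n * g := by ext v; rw [h, LinearEquiv.mul_apply, hn']
    rw [this]; exact H.mul_mem hn hg

theorem AD (hω : Sy ω) (hI : IsoS ω H) (Q : QF F p f q) (hneg : Has H (fun v => -v)) {a g : V ≃ₗ[F] V}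
    (ha : a ∈ H) (hg : g ∈ H) (hA : POrd a ((q ^ 2 + 1) / 2)) (hD : POrd g (p * (q + 1))) : AllS ω H := by
  obtain ⟨c, x, x', s, hc, hx, hse, hsx, hsx', h1, h2, hT⟩ := Dcls hω Q (hI g hg) hD
  have hs : s ∈ H := sgn_mem hneg (H.pow_mem hg p) hse
  have hN := Q.N13
  have hx0 : x ≠ 0 := by rintro rfl; simp at hx
  rcases LemG hω hI Q hs hx hsx hsx' h1 h2 hc ((Has.of (H.pow_mem hg _)).congr hT) with h | h | h
  · exact h
  · exfalso
    have := Acls hω.dim Q hA (Submodule.span F {x}) (Or.inl (finrank_span_singleton hx0)) (k := 1) (by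
      intro v hv
      obtain ⟨b, rfl⟩ := Submodule.mem_span_singleton.1 hv
      obtain ⟨d, hd⟩ := h a ha
      rw [pow_one, map_smul, hd]
      exact Submodule.smul_mem _ _ (Submodule.smul_mem _ _ (Submodule.mem_span_singleton_self x)))
    have := Nat.le_of_dvd (by norm_num) this
    omega
  · exfalso
    have := Acls hω.dim Q hA _ (Or.inr (hyp_dim hω hx)) (k := 2) (by
      intro v hv
      rw [pow_two, LinearEquiv.mul_apply]
      exact h a ha v hv)
    have := Nat.le_of_dvd (by norm_num) this
    omega

theorem ED.noeig {s u : V ≃ₗ[F] V} {τ : F} {U : Submodule F V} (E : ED ω q s u τ U) {x : V} (hx : x ≠ 0)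
    (c : F) : s x ≠ c • x := by
  intro hc
  have e4 := E.rel x
  rw [hc, map_smul, hc] at e4
  apply E.irr c
  have e5 : (c ^ 2 - τ * c + 1) • x = 0 := by
    have : (c ^ 2 - τ * c + 1) • x = c • c • x - (τ • c • x - x) := by module
    rw [this, e4, sub_self]
  exact (smul_eq_zero.1 e5).resolve_right hx

theorem ED.t0 {s u : V ≃ₗ[F] V} {τ : F} {U : Submodule F V} (E : ED ω q s u τ U) (Q : QF F p f q) : τ ≠ 0 := by
  rintro rfl
  have := (E.ord 2).1 (Or.inr fun v => by simp [pow_two, E.rel])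
  have := Nat.le_of_dvd (by norm_num) this
  have := Q.e3
  omega

theorem DE (hω : Sy ω) (hI : IsoS ω H) (Q : QF F p f q) (hneg : Has H (fun v => -v)) {g s u : V ≃ₗ[F] V}
    {τ : F} {U : Submodule F V} (hsH : s ∈ H) (hu : u ∈ H) (E : ED ω q s u τ U)
    (hg : g ∈ H) (hD : POrd g (p * (q + 1))) : AllS ω H := by
  have hfd : FiniteDimensional F V := FiniteDimensional.of_finrank_pos (by rw [hω.dim]; norm_num)
  obtain ⟨c, x, x', s1, hc, hx, hse, hsx, hsx', h1, h2, hT⟩ := Dcls hω Q (hI g hg) hD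
  have hs : s1 ∈ H := sgn_mem hneg (H.pow_mem hg p) hse
  have hx0 : x ≠ 0 := by rintro rfl; simp at hx
  rcases LemG hω hI Q hs hx hsx hsx' h1 h2 hc ((Has.of (H.pow_mem hg _)).congr hT) with h | h | h
  · exact h
  · exfalso
    obtain ⟨d, hd⟩ := h s hsH
    exact E.noeig hx0 d hd
  · exfalso
    have hYU : ∀ m ∈ Submodule.span F {x, x'}, m ∈ U → m = 0 := by
      intro m hm hmU
      by_contra hm0
      have e1 := h s hsH m hm
      rw [E.rel] at e1
      have e2 : τ • s m ∈ Submodule.span F {x, x'} := by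
        have := Submodule.add_mem _ e1 hm
        simpa using this
      have e3 : s m ∈ Submodule.span F {x, x'} := by
        have := Submodule.smul_mem _ τ⁻¹ e2
        rwa [smul_smul, inv_mul_cancel₀ (E.t0 Q), one_smul] at this
      have e0 := E.ti m hmU _ (E.sU m hmU)
      obtain ⟨a, b, hab⟩ := Submodule.mem_span_pair.1 hm
      obtain ⟨a', b', hab'⟩ := Submodule.mem_span_pair.1 e3
      rw [← hab', ← hab] at e0
      simp only [map_add, map_smul, LinearMap.add_apply, LinearMap.smul_apply, hω.alt, hx, hω.skew x' x,
        smul_eq_mul] at e0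
      by_cases ha : a = 0
      · have hb : b ≠ 0 := by
          rintro rfl
          exact hm0 (by rw [← hab, ha]; simp)
        apply E.noeig hm0 (b' * b⁻¹)
        have ha' : a' = 0 := by
          rw [ha] at e0
          have : b * a' = 0 := by linear_combination -e0
          exact (mul_eq_zero.1 this).resolve_left hb
        rw [← hab', ← hab, ha, ha']; simp only [zero_smul, zero_add, smul_smul]; rw [inv_mul_cancel_right₀ hb]
      · apply E.noeig hm0 (a' * a⁻¹)
        rw [← hab', ← hab, smul_add, smul_smul, smul_smul, inv_mul_cancel_right₀ ha]
        congr 2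
        field_simp
        linear_combination e0
    have hfix : ∀ y ∈ Submodule.span F {x, x'}, u y = y := by
      intro y hy
      have e1 := h u hu y hy
      have e2 : u (u y) - y = (2 : F) • (u y - y) := by
        have := E.uU _ (E.uV y)
        rw [map_sub, sub_eq_iff_eq_add] at this
        rw [this]; module
      have e3 := hYU (u (u y) - y) (Submodule.sub_mem _ e1 hy) (by rw [e2]; exact U.smul_mem _ (E.uV y))
      rw [e2] at e3
      exact sub_eq_zero.1 ((smul_eq_zero.1 e3).resolve_left Q.two)
    have hinf : Submodule.span F {x, x'} ⊓ U = ⊥ := by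
      rw [Submodule.eq_bot_iff]
      rintro m ⟨hm, hm'⟩
      exact hYU m hm hm'
    have hdim := Submodule.finrank_sup_add_finrank_inf_eq (Submodule.span F {x, x'}) U
    rw [hinf, finrank_bot, E.dim, hyp_dim hω hx] at hdim
    have htop : Submodule.span F {x, x'} ⊔ U = ⊤ := Submodule.eq_top_of_finrank_eq (by rw [hω.dim]; omega)
    obtain ⟨v, hv⟩ := E.ne
    apply hv
    have hvm : v ∈ Submodule.span F {x, x'} ⊔ U := htop ▸ trivial
    obtain ⟨y, hy, z, hz, rfl⟩ := Submodule.mem_sup.1 hvm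
    rw [map_add, hfix y hy, E.uU z hz]
end PSp

open Module
section PSp
open scoped Pointwise
set_option linter.unusedSectionVars false

variable {F V : Type*} [Field F] [AddCommGroup V] [Module F V] [Finite F] [Finite V]
variable {ω : V →ₗ[F] V →ₗ[F] F} {H : Subgroup (V ≃ₗ[F] V)} {p f q : ℕ}
variable {s u : V ≃ₗ[F] V} {τ : F} {U : Submodule F V}

theorem frame0 (hω : Sy ω) {x y : V} (hx : x ≠ 0) (hxy : ω x y = 0) (hind : ∀ c : F, y ≠ c • x) :
    ∃ x' y', ω x x' = 1 ∧ ω y y' = 1 ∧ ω x y' = 0 ∧ ω x' y = 0 ∧ ω x' y' = 0 := by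
  obtain ⟨x1, h1⟩ := hω.nd1 hx
  obtain ⟨k, hk⟩ : ∃ k, k = ω y x1 := ⟨_, rfl⟩
  have hy1 : y - k • x ≠ 0 := fun h => hind k (sub_eq_zero.1 h)
  obtain ⟨v, hv⟩ := hω.nd1 hy1
  obtain ⟨a, b, w, hw, rfl⟩ := dec2 hω h1 v
  rw [mem_perp2] at hw
  have e1 : ω (y - k • x) w = 1 := by
    rw [← hv]
    simp [hω.alt, h1, hω.skew0 hxy, ← hk]
    ring
  have hyw : ω y w = 1 := by
    simpa [hw.1] using e1
  refine ⟨x1 - k • w, w, ?_, hyw, hw.1, ?_, ?_⟩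
  · simp [h1, hw.1]
  · rw [hω.skew]; simp [hyw, ← hk]
  · simp [hω.alt, hw.2]

def Qm (ω : V →ₗ[F] V →ₗ[F] F) (a b c : F) (x y : V) : V → V :=
  fun v => v + (a * ω v x + b * ω v y) • x + (b * ω v x + c * ω v y) • y

theorem Qm_mul (hω : Sy ω) {x y : V} (hxy : ω x y = 0) (a b c a' b' c' : F) (v : V) :
    Qm ω a b c x y (Qm ω a' b' c' x y v) = Qm ω (a + a') (b + b') (c + c') x y v := by
  simp only [Qm, map_add, map_smul, LinearMap.add_apply, LinearMap.smul_apply, hω.alt, hxy, hω.skew0 hxy,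
    smul_eq_mul]
  module

theorem Qm_zero (x y v : V) : Qm ω 0 0 0 x y v = v := by simp [Qm]

theorem Qm_inj (hω : Sy ω) {x y : V} (hx : x ≠ 0) (hxy : ω x y = 0) (hind : ∀ c : F, y ≠ c • x)
    {a b c a' b' c' : F} (h : ∀ v, Qm ω a b c x y v = Qm ω a' b' c' x y v) : a = a' ∧ b = b' ∧ c = c' := by
  obtain ⟨x', y', h1, h2, h4, h5, h6⟩ := frame0 hω hx hxy hind
  have e1 := congrArg (fun z => ω z x') (h x')
  have e2 := congrArg (fun z => ω z y') (h x')
  have e3 := congrArg (fun z => ω z y') (h y')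
  simp only [Qm, map_add, map_smul, LinearMap.add_apply, LinearMap.smul_apply, hω.alt, h1, h2, h4, h5, h6,
    hω.skew0 h5, hω.skew0 h4, hω.skew0 h6, hω.skew x' x, hω.skew y' y, smul_eq_mul] at e1 e2 e3
  refine ⟨by linear_combination -e1, by linear_combination -e2, by linear_combination -e3⟩

theorem Qm_conj (hs : ∀ v w, ω (s v) (s w) = ω v w) {x : V} (hrel : s (s x) = τ • s x - x) (a b c : F) (v : V) :
    s (Qm ω a b c x (s x) v) = Qm ω c (-b - τ * c) (a + 2 * τ * b + τ ^ 2 * c) x (s x) (s v) := by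
  have e1 : ω v x = ω (s v) (s x) := (hs v x).symm
  have e2 : ω v (s x) = τ * ω (s v) (s x) - ω (s v) x := by
    rw [← hs v (s x), hrel, map_sub, map_smul, smul_eq_mul]
  simp only [Qm, map_add, map_smul, hrel, e1, e2]
  module

theorem ED.nd (E : ED ω q s u τ U) {x : V} (hx0 : x ≠ 0) (c : F) : s x ≠ c • x := E.noeig hx0 c

theorem ED.x0 (E : ED ω q s u τ U) {x : V} (hx : x ∈ U) : ω x (s x) = 0 := E.ti x hx _ (E.sU x hx)

theorem ti_span (hω : Sy ω) {x y : V} (hx : x ≠ 0) (hxy : ω x y = 0) (hind : ∀ c : F, y ≠ c • x)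
    {z : V} (h1 : ω z x = 0) (h2 : ω z y = 0) : ∃ a b : F, z = a • x + b • y := by
  obtain ⟨x', y', k1, k2, k4, k5, k6⟩ := frame0 hω hx hxy hind
  have := hω.expand k1 k2 hxy k4 k5 k6 z
  rw [h1, h2] at this
  exact ⟨_, _, by simpa using this⟩

theorem ED.span (hω : Sy ω) (E : ED ω q s u τ U) {x z : V} (hx : x ∈ U) (hx0 : x ≠ 0) (hz : z ∈ U) :
    ∃ a b : F, z = a • x + b • s x :=
  ti_span hω hx0 (E.x0 hx) (E.nd hx0) (E.ti z hz x hx) (E.ti z hz _ (E.sU x hx))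

theorem ED.ex (E : ED ω q s u τ U) : ∃ x ∈ U, x ≠ 0 := by
  have : U ≠ ⊥ := by intro h; have := E.dim; rw [h] at this; simp at this
  exact Submodule.exists_mem_ne_zero_of_ne_bot this

theorem ED.perp (hω : Sy ω) (E : ED ω q s u τ U) {z : V} (h : ∀ v ∈ U, ω z v = 0) : z ∈ U := by
  obtain ⟨x, hx, hx0⟩ := E.ex
  obtain ⟨a, b, rfl⟩ := ti_span hω hx0 (E.x0 hx) (E.nd hx0) (h x hx) (h _ (E.sU x hx))
  exact U.add_mem (U.smul_mem _ hx) (U.smul_mem _ (E.sU x hx))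

def RU (U : Submodule F V) (r : V ≃ₗ[F] V) : Prop := (∀ v, r v - v ∈ U) ∧ ∀ v ∈ U, r v = v

theorem ED.Qform (hω : Sy ω) (E : ED ω q s u τ U) {r : V ≃ₗ[F] V} (hr : ∀ v w, ω (r v) (r w) = ω v w)
    (hR : RU U r) {x : V} (hx : x ∈ U) (hx0 : x ≠ 0) : ∃ a b c : F, ∀ v, r v = Qm ω a b c x (s x) v := by
  obtain ⟨x', y', k1, k2, k4, k5, k6⟩ := frame0 hω hx0 (E.x0 hx) (E.nd hx0)
  obtain ⟨a, b, h1⟩ := E.span hω hx hx0 (hR.1 x')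
  obtain ⟨b', c, h2⟩ := E.span hω hx hx0 (hR.1 y')
  have h1' : r x' = x' + (a • x + b • s x) := by rw [← h1]; abel
  have h2' : r y' = y' + (b' • x + c • s x) := by rw [← h2]; abel
  have hb : b = b' := by
    have := hr x' y'
    rw [h1', h2'] at this
    simp only [map_add, map_smul, LinearMap.add_apply, LinearMap.smul_apply, hω.alt, k1, k2, k4, k5, k6,
      E.x0 hx, hω.skew0 (E.x0 hx), hω.skew x' x, smul_eq_mul] at this
    linear_combination this
  refine ⟨-a, -b, -c, fun v => ?_⟩
  have e := hω.expand k1 k2 (E.x0 hx) k4 k5 k6 v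
  have e2 := congrArg r e
  simp only [map_add, map_sub, map_smul, hR.2 x hx, hR.2 _ (E.sU x hx), h1', h2', ← hb] at e2
  rw [e2]
  simp only [Qm]
  generalize ω v x = A1 at *
  generalize ω v (s x) = A2 at *
  generalize ω v x' = A3 at *
  generalize ω v y' = A4 at *
  rw [e]
  module

/-- the second vector of the diagonal form -/
def wx (s : V ≃ₗ[F] V) (τ : F) (x : V) : V := s x - (τ / 2) • x

theorem ED.diag (hω : Sy ω) (Q : QF F p f q) (E : ED ω q s u τ U) {x : V} (hx : x ∈ U) (hx0 : x ≠ 0) :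
    ∃ c : F, c ≠ 0 ∧ ∀ v, u v = v + (c * (1 - τ ^ 2 / 4) * ω v x) • x + (c * ω v (wx s τ x)) • wx s τ x := by
  obtain ⟨a, b, c, h⟩ := E.Qform hω E.ui ⟨E.uV, E.uU⟩ hx hx0
  have h2 := Q.two
  have e1 : ∀ v, Qm ω a b c x (s x) v = Qm ω c (-b - τ * c) (a + 2 * τ * b + τ ^ 2 * c) x (s x) v := by
    intro v
    have e1 := E.comm (s⁻¹ v)
    rw [h, h, app_inv, Qm_conj E.si (E.rel x), app_inv] at e1
    exact e1.symm
  obtain ⟨h3, h4, -⟩ := Qm_inj hω hx0 (E.x0 hx) (E.nd hx0) e1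
  have hb : b = - (τ / 2) * a := by
    field_simp
    rw [← h3] at h4
    linear_combination h4
  have h4' : (4 : F) ≠ 0 := by
    have : (4 : F) = 2 * 2 := by norm_num
    rw [this]; exact mul_ne_zero h2 h2
  subst h3
  refine ⟨a, ?_, fun v => ?_⟩
  · rintro rfl
    obtain ⟨v, hv⟩ := E.ne
    apply hv
    rw [h, hb]
    simp [Qm]
  · rw [h, hb]
    simp only [Qm, wx, map_sub, map_smul, smul_eq_mul]
    have : τ ^ 2 / 4 = (τ / 2) * (τ / 2) := by field_simp; ring
    rw [this]
    module

theorem ED.k0 (Q : QF F p f q) (E : ED ω q s u τ U) : 1 - τ ^ 2 / 4 ≠ 0 := by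
  have h2 := Q.two
  have h4 : (4 : F) ≠ 0 := by
    have : (4 : F) = 2 * 2 := by norm_num
    rw [this]; exact mul_ne_zero h2 h2
  intro h
  apply E.irr (τ / 2)
  rw [← h]
  field_simp
  ring

theorem ED.pw (E : ED ω q s u τ U) (hω : Sy ω) (k : ℕ) : ∃ A B : F, (∀ v, (s ^ k) v = A • s v + B • v) ∧
    (A = 0 → (q + 1) / 2 ∣ k) := by
  have : ∃ A B : F, (∀ v, (s ^ k) v = A • s v + B • v) := by
    induction k with
    | zero => exact ⟨0, 1, by simp⟩
    | succ k ih =>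
      obtain ⟨A, B, h⟩ := ih
      refine ⟨τ * A + B, -A, fun v => ?_⟩
      rw [pow_succ', LinearEquiv.mul_apply, h, map_add, map_smul, map_smul, E.rel]
      module
  obtain ⟨A, B, h⟩ := this
  refine ⟨A, B, h, fun hA => (E.ord k).1 ?_⟩
  subst hA
  obtain ⟨x, -, hx0⟩ := E.ex
  obtain ⟨y, hy⟩ := hω.nd1 hx0
  have e1 := iso_pow E.si k x y
  simp only [h, zero_smul, zero_add] at e1
  simp only [map_smul, LinearMap.smul_apply, hy, smul_eq_mul, mul_one] at e1
  rcases mul_self_eq_one_iff.1 e1 with rfl | rfl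
  · left; intro v; rw [h]; simp
  · right; intro v; rw [h]; simp

theorem conj_pow_app (g s : V ≃ₗ[F] V) (k : ℕ) (v : V) : ((g * s * g⁻¹) ^ k) v = g ((s ^ k) (g⁻¹ v)) := by
  rw [conj_pow]; rfl

theorem mem_sm {g : V ≃ₗ[F] V} {L : Submodule F V} {v : V} : v ∈ g • L ↔ g⁻¹ v ∈ L := by
  constructor
  · rintro ⟨y, hy, rfl⟩
    exact (inv_app g y).symm ▸ hy
  · intro h
    exact ⟨g⁻¹ v, h, app_inv g v⟩

theorem dim_sm (g : V ≃ₗ[F] V) (L : Submodule F V) : finrank F (g • L : Submodule F V) = finrank F L := by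
  exact LinearEquiv.finrank_map_eq g L

theorem ED.conj (E : ED ω q s u τ U) {g : V ≃ₗ[F] V} (hg : ∀ v w, ω (g v) (g w) = ω v w) :
    ED ω q (g * s * g⁻¹) (g * u * g⁻¹) τ (g • U) := by
  have hg' : ∀ v w, ω (g⁻¹ v) (g⁻¹ w) = ω v w := fun v w => by rw [← hg, app_inv, app_inv]
  have ev : ∀ r : V ≃ₗ[F] V, ∀ v, (g * r * g⁻¹) v = g (r (g⁻¹ v)) := fun _ _ => rfl
  constructor
  · rw [dim_sm, E.dim]
  · intro v hv w hw
    rw [mem_sm] at hv hw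
    rw [← hg', E.ti _ hv _ hw]
  · intro v hv
    rw [mem_sm] at hv ⊢
    rw [ev, inv_app]; exact E.sU _ hv
  · intro v
    rw [mem_sm, ev, map_sub, inv_app]; exact E.uV _
  · intro v hv
    rw [mem_sm] at hv
    rw [ev, E.uU _ hv, app_inv]
  · intro v
    rw [ev, ev, inv_app, E.rel, map_sub, map_smul, app_inv]
  · exact E.irr
  · intro v
    simp only [ev, inv_app, E.comm]
  · obtain ⟨v, hv⟩ := E.ne
    refine ⟨g v, ?_⟩
    rw [ev, inv_app]
    exact fun h => hv (g.injective h)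
  · intro k
    rw [← E.ord k]
    constructor
    · rintro (h | h)
      · left; intro v
        have := h (g v)
        rw [conj_pow_app, inv_app] at this
        exact g.injective this
      · right; intro v
        have := h (g v)
        rw [conj_pow_app, inv_app, ← map_neg] at this
        exact g.injective this
    · rintro (h | h)
      · left; intro v
        rw [conj_pow_app, h, app_inv]
      · right; intro v
        rw [conj_pow_app, h, map_neg, app_inv]
  · intro v w; rw [ev, ev, hg, E.si, hg']
  · intro v w; rw [ev, ev, hg, E.ui, hg']

/-- every vector is non-perpendicular to some translate -/
theorem Anp (hω : Sy ω) (hI : IsoS ω H) (Q : QF F p f q) {a : V ≃ₗ[F] V}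
    (ha : a ∈ H) (hA : POrd a ((q ^ 2 + 1) / 2)) {x : V} (hx : x ≠ 0) : ∃ h ∈ H, ω x (h x) ≠ 0 := by
  have hfd : FiniteDimensional F V := FiniteDimensional.of_finrank_pos (by rw [hω.dim]; norm_num)
  by_contra hcon
  push Not at hcon
  set M := Submodule.span F {y | ∃ h ∈ H, y = h x} with hM
  have hxM : x ∈ M := Submodule.subset_span ⟨1, H.one_mem, rfl⟩
  have hti : ∀ v ∈ M, ∀ w ∈ M, ω v w = 0 := by
    intro v hv w hw
    induction hv, hw using Submodule.span_induction₂ with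
    | mem_mem v w hv hw =>
      obtain ⟨h, hh, rfl⟩ := hv
      obtain ⟨k, hk, rfl⟩ := hw
      have := hcon (h⁻¹ * k) (H.mul_mem (H.inv_mem hh) hk)
      rw [← hI h hh, LinearEquiv.mul_apply, app_inv] at this
      exact this
    | zero_left => simp
    | zero_right => simp
    | add_left _ _ _ _ _ _ h1 h2 => simp [h1, h2]
    | add_right _ _ _ _ _ _ h1 h2 => simp [h1, h2]
    | smul_left _ _ _ _ _ h1 => simp [h1]
    | smul_right _ _ _ _ _ h1 => simp [h1]
  have haM : ∀ v ∈ M, (a ^ 1) v ∈ M := by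
    intro v hv
    rw [pow_one]
    induction hv using Submodule.span_induction with
    | mem v hv =>
      obtain ⟨h, hh, rfl⟩ := hv
      exact Submodule.subset_span ⟨a * h, H.mul_mem ha hh, rfl⟩
    | zero => simp
    | add _ _ _ _ h1 h2 => rw [map_add]; exact M.add_mem h1 h2
    | smul _ _ _ h1 => rw [map_smul]; exact M.smul_mem _ h1
  have hdim : finrank F M = 1 ∨ finrank F M = 2 := by
    have h0 : finrank F M ≠ 0 := by
      intro h
      rw [Submodule.finrank_eq_zero] at h
      rw [h] at hxM
      exact hx (by simpa using hxM)
    have h2 : finrank F M ≤ 2 := by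
      by_cases hy : ∃ y ∈ M, ∀ c : F, y ≠ c • x
      · obtain ⟨y, hy, hyc⟩ := hy
        have : M ≤ Submodule.span F {x, y} := by
          intro z hz
          obtain ⟨α, β, rfl⟩ := ti_span hω hx (hti x hxM y hy) hyc (hti z hz x hxM) (hti z hz y hy)
          exact Submodule.mem_span_pair.2 ⟨_, _, rfl⟩
        refine (Submodule.finrank_mono this).trans ?_
        classical
        have := finrank_span_le_card (R := F) ({x, y} : Set V)
        refine this.trans ?_
        rw [Set.toFinset_card]
        simpa [Set.toFinset_insert] using Finset.card_le_two (a := x) (b := y)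
      · push Not at hy
        have : M ≤ Submodule.span F {x} := by
          intro z hz
          obtain ⟨c, hc⟩ := hy z hz
          exact Submodule.mem_span_singleton.2 ⟨c, hc.symm⟩
        have := Submodule.finrank_mono this
        rw [finrank_span_singleton hx] at this
        omega
    omega
  have := Acls hω.dim Q hA M hdim haM
  have := Nat.le_of_dvd (by norm_num) this
  have := Q.N13
  omega
end PSp

open Module
section PSp
open scoped Pointwise
set_option linter.unusedSectionVars false

variable {F V : Type*} [Field F] [AddCommGroup V] [Module F V] [Finite F] [Finite V]
variable {ω : V →ₗ[F] V →ₗ[F] F} {H : Subgroup (V ≃ₗ[F] V)} {p f q : ℕ}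
variable {s u : V ≃ₗ[F] V} {τ : F} {U : Submodule F V}

/-- conjugation by `s` on the two-dimensional module -/
def th2 (τ : F) : (F × F) ≃ₗ[F] (F × F) where
  toFun m := (-m.1 - τ * m.2, τ * m.1 + (τ ^ 2 - 1) * m.2)
  invFun m := ((τ ^ 2 - 1) * m.1 + τ * m.2, -τ * m.1 - m.2)
  map_add' m n := by ext <;> simp <;> ring
  map_smul' c m := by ext <;> simp <;> ring
  left_inv m := by ext <;> simp <;> ring
  right_inv m := by ext <;> simp <;> ring

theorem th2_smul (m : F × F) : th2 τ • m = (-m.1 - τ * m.2, τ * m.1 + (τ ^ 2 - 1) * m.2) := rfl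

def Q2 (ω : V →ₗ[F] V →ₗ[F] F) (τ : F) (m : F × F) (x y : V) : V → V := Qm ω m.1 m.2 (-m.1 - τ * m.2) x y

theorem Q2_conj (E : ED ω q s u τ U) (x : V) (m : F × F) (v : V) :
    s (Q2 ω τ m x (s x) v) = Q2 ω τ (th2 τ • m) x (s x) (s v) := by
  rw [Q2, Qm_conj E.si (E.rel x), Q2, th2_smul]
  congr 1 <;> ring

theorem M2all (hω : Sy ω) (hI : IsoS ω H) (Q : QF F p f q) (hs : s ∈ H) (E : ED ω q s u τ U)
    {r : V ≃ₗ[F] V} (hr : r ∈ H) (hR : RU U r) (hnc : ∃ v, s (r v) ≠ r (s v))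
    {x : V} (hx : x ∈ U) (hx0 : x ≠ 0) (m : F × F) : Has H (Q2 ω τ m x (s x)) := by
  have hxy := E.x0 hx
  have hk0 := E.k0 Q
  have h2 := Q.two
  have hneg : ∀ a b c : F, Has H (Qm ω a b c x (s x)) → Has H (Qm ω (-a) (-b) (-c) x (s x)) := by
    intro a b c h
    refine h.inv fun v => ?_
    rw [Qm_mul hω hxy, add_neg_cancel, add_neg_cancel, add_neg_cancel, Qm_zero]
  have hcj : ∀ f g : V → V, Has H f → (∀ v, s (f v) = g (s v)) → Has H g := by
    intro f g hf h
    refine (((Has.of hs).mul hf).mul (Has.of (H.inv_mem hs))).congr fun v => ?_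
    rw [h, app_inv]
  let A : AddSubgroup (F × F) :=
    { carrier := {m | Has H (Q2 ω τ m x (s x))}
      zero_mem' := by
        refine (Has.of H.one_mem).congr fun v => ?_
        simp [Q2, Qm]
      add_mem' := by
        intro m n hm hn
        refine (Has.mul hm hn).congr fun v => ?_
        rw [Q2, Q2, Qm_mul hω hxy, Q2]
        congr 1
        simp; ring
      neg_mem' := by
        intro m hm
        refine (hneg _ _ _ hm).congr fun v => ?_
        rw [Q2]
        congr 1
        simp; ring }
  have hpw : ∀ (k : ℕ) (m : F × F) v, (s ^ k) (Q2 ω τ m x (s x) v) = Q2 ω τ (th2 τ ^ k • m) x (s x) ((s ^ k) v) := by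
    intro k
    induction k with
    | zero => intro m v; simp
    | succ k ih =>
      intro m v
      rw [pow_succ', pow_succ', LinearEquiv.mul_apply, LinearEquiv.mul_apply, ih, Q2_conj E, mul_smul]
  have hinj : ∀ m n : F × F, (∀ v, Q2 ω τ m x (s x) v = Q2 ω τ n x (s x) v) → m = n := by
    intro m n h
    obtain ⟨h1, h2, -⟩ := Qm_inj hω hx0 hxy (E.nd hx0) h
    exact Prod.ext h1 h2
  have hAtop : A = ⊤ := by
    refine LemS Q.hp Q.hq Q.h5 Q.ho (th2 τ) A ⊤ le_top ?_ ?_ ?_ ?_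
    · rw [AddSubgroup.card_top, Nat.card_prod, Q.hc, pow_two]
    · obtain ⟨a, b, c, h⟩ := E.Qform hω (hI r hr) hR hx hx0
      have h1 : Has H (Qm ω a b c x (s x)) := (Has.of hr).congr h
      have h2 := hcj _ _ h1 (Qm_conj E.si (E.rel x) a b c)
      refine ⟨(c + -a, -b - τ * c + -b), (h2.mul (hneg _ _ _ h1)).congr fun v => ?_, ?_⟩
      · rw [Qm_mul hω hxy, Q2]
        congr 1
        simp; ring
      · intro h0
        obtain ⟨v, hv⟩ := hnc
        apply hv
        rw [h, h, Qm_conj E.si (E.rel x)]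
        rw [Prod.mk_eq_zero] at h0
        congr 1
        · linear_combination h0.1
        · linear_combination h0.2
        · linear_combination - h0.1 - τ * h0.2
    · intro m hm
      exact hcj _ _ hm (Q2_conj E x m)
    · intro m hm hm0 k hk
      obtain ⟨A, B, h, hA⟩ := E.pw hω k
      apply hA
      by_contra hA0
      apply hm0
      have hlin : ∀ (a b : F) (v w : V), Q2 ω τ m x (s x) (a • v + b • w) = a • Q2 ω τ m x (s x) v + b • Q2 ω τ m x (s x) w := by
        intro a b v w
        simp only [Q2, Qm, map_add, map_smul, LinearMap.add_apply, LinearMap.smul_apply, smul_eq_mul]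
        module
      have hfix : th2 τ • m = m := by
        apply hinj
        intro v
        have e1 := hpw k m (s⁻¹ v)
        rw [hk, h, h, hlin, Q2_conj E] at e1
        have e2 := add_right_cancel e1
        have := smul_right_injective V hA0 e2
        simpa only [app_inv] using this
      rw [th2_smul] at hfix
      have f1 := congrArg Prod.fst hfix
      have f2 := congrArg Prod.snd hfix
      simp only at f1 f2
      have hb : m.2 = 0 := by
        have : (2 * 2 * (1 - τ ^ 2 / 4)) * m.2 = 0 := by
          have h4 : (4 : F) ≠ 0 := by
            have : (4 : F) = 2 * 2 := by norm_num
            rw [this]; exact mul_ne_zero h2 h2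
          field_simp
          linear_combination - 4 * τ * f1 - 8 * f2
        exact (mul_eq_zero.1 this).resolve_left (mul_ne_zero (mul_ne_zero h2 h2) hk0)
      have ha : m.1 = 0 := by
        have : 2 * m.1 = 0 := by rw [hb] at f1; linear_combination - f1
        exact (mul_eq_zero.1 this).resolve_left h2
      exact Prod.ext ha hb
  have : m ∈ A := hAtop ▸ AddSubgroup.mem_top m
  exact this

/-- what one gets at each point of the line -/
def PL (ω : V →ₗ[F] V →ₗ[F] F) (H : Subgroup (V ≃ₗ[F] V)) (L : Submodule F V) : Prop :=
  ∀ x ∈ L, x ≠ 0 → ∃ w ∈ L, (∀ z ∈ L, ∃ a b : F, z = a • x + b • w) ∧ (∀ c : F, Has H (Sv ω x (c • w))) ∧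
    ∃ c : F, c ≠ 0 ∧ Has H (Tv ω c x)

theorem PL_conj (hI : IsoS ω H) {L : Submodule F V} (h : PL ω H L) {g : V ≃ₗ[F] V} (hg : g ∈ H) :
    PL ω H (g • L) := by
  intro x hx hx0
  rw [mem_sm] at hx
  have hx0' : g⁻¹ x ≠ 0 := fun h => hx0 (by rw [← app_inv g x, h, map_zero])
  obtain ⟨w, hw, h1, h2, c, hc, h3⟩ := h _ hx hx0'
  refine ⟨g w, by rw [mem_sm, inv_app]; exact hw, ?_, ?_, c, hc, ?_⟩
  · intro z hz
    rw [mem_sm] at hz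
    obtain ⟨a, b, e⟩ := h1 _ hz
    refine ⟨a, b, ?_⟩
    rw [← app_inv g z, e]
    simp [app_inv]
  · intro c
    have := (h2 c).Sconj hI hg
    rwa [app_inv, map_smul] at this
  · have := h3.Tconj hI hg
    rwa [app_inv] at this

theorem M2PL (hω : Sy ω) (hI : IsoS ω H) (Q : QF F p f q) (hs : s ∈ H) (hu : u ∈ H) (E : ED ω q s u τ U)
    {r : V ≃ₗ[F] V} (hr : r ∈ H) (hR : RU U r) (hnc : ∃ v, s (r v) ≠ r (s v)) : PL ω H U := by
  intro x hx hx0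
  have hm := M2all hω hI Q hs E hr hR hnc hx hx0
  have hwU : wx s τ x ∈ U := U.sub_mem (E.sU x hx) (U.smul_mem _ hx)
  have h2 := Q.two
  refine ⟨wx s τ x, hwU, ?_, ?_, ?_⟩
  · intro z hz
    obtain ⟨a, b, rfl⟩ := E.span hω hx hx0 hz
    exact ⟨a + b * (τ / 2), b, by simp only [wx]; module⟩
  · intro c
    refine (hm (-c * τ, c)).congr fun v => ?_
    simp only [Q2, Qm, Sv, wx, map_sub, map_smul, smul_eq_mul]
    have : τ = τ / 2 + τ / 2 := by field_simp; ring
    generalize τ / 2 = t at *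
    subst this
    module
  · obtain ⟨c, hc, h⟩ := E.diag hω Q hx hx0
    refine ⟨2 * c * (1 - τ ^ 2 / 4), mul_ne_zero (mul_ne_zero h2 hc) (E.k0 Q), ?_⟩
    refine ((Has.of hu).mul (hm (2 * c * (1 - τ ^ 2 / 4) - c, c * (τ / 2)))).congr fun v => ?_
    have h4 : (4 : F) ≠ 0 := by
      have : (4 : F) = 2 * 2 := by norm_num
      rw [this]; exact mul_ne_zero h2 h2
    have e4 : τ ^ 2 / 4 = (τ / 2) ^ 2 := by field_simp; ring
    have : τ = τ / 2 + τ / 2 := by field_simp; ring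
    rw [e4] at h ⊢
    simp only [Q2, Qm, Tv, h]
    simp only [map_add, map_smul, LinearMap.add_apply, LinearMap.smul_apply, hω.alt, E.x0 hx, hω.skew0 (E.x0 hx),
      smul_eq_mul, wx, map_sub, LinearMap.sub_apply]
    generalize τ / 2 = t at *
    subst this
    module

theorem PLmeet (hω : Sy ω) (Q : QF F p f q) (E : ED ω q s u τ U) (hU : PL ω H U)
    {L : Submodule F V} (hL : PL ω H L) (hti : ∀ v ∈ L, ∀ w ∈ L, ω v w = 0) (hd : finrank F L = 2) (hne : L ≠ U)
    {x : V} (hx0 : x ≠ 0) (hxU : x ∈ U) (hxL : x ∈ L) : Ep ω H x := by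
  have hfd : FiniteDimensional F V := FiniteDimensional.of_finrank_pos (by rw [hω.dim]; norm_num)
  obtain ⟨w, hw, h1, h2, -⟩ := hU x hxU hx0
  obtain ⟨w', hw', h1', h2', -⟩ := hL x hxL hx0
  have hxw : ω x w = 0 := E.ti x hxU w hw
  have hxw' : ω x w' = 0 := hti x hxL w' hw'
  have h20 := Q.two
  have hD : ω w w' ≠ 0 := by
    intro h0
    apply hne
    have hwU : w' ∈ U := by
      apply E.perp hω
      intro v hv
      obtain ⟨a, b, rfl⟩ := h1 v hv
      simp [hω.skew0 hxw', hω.skew0 h0]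
    apply Submodule.eq_of_le_of_finrank_eq
    · intro z hz
      obtain ⟨a, b, rfl⟩ := h1' z hz
      exact U.add_mem (U.smul_mem _ hxU) (U.smul_mem _ hwU)
    · rw [hd, E.dim]
  have hT : ∀ c, Has H (Tv ω c x) := by
    intro c
    have e1 : ω w' w = - ω w w' := hω.skew _ _
    refine ((((h2 (- c / (2 * ω w w'))).mul (h2' 1)).mul (h2 (c / (2 * ω w w')))).mul (h2' (-1))).congr fun v => ?_
    simp only [Sv, Tv, map_add, map_smul, LinearMap.add_apply, LinearMap.smul_apply, hω.alt, hxw, hxw',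
      hω.skew0 hxw, hω.skew0 hxw', smul_eq_mul, e1]
    generalize ω v x = A
    generalize ω v w = B
    generalize ω v w' = C
    clear e1
    obtain ⟨D, hDD⟩ : ∃ D, D = ω w w' := ⟨_, rfl⟩
    rw [← hDD] at hD ⊢
    match_scalars
    all_goals first | ring1 | (field_simp; ring1) | field_simp
  intro z hz
  set β := ω z w' / ω w w' with hβ
  set γ := - ω z w / ω w w' with hγ
  have hz' : ∃ a : F, z = a • x + β • w + γ • w' := by
    have hzU : z - β • w - γ • w' ∈ U := by
      apply E.perp hω
      intro v hv
      obtain ⟨a, b, rfl⟩ := h1 v hv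
      simp only [map_sub, map_add, map_smul, LinearMap.sub_apply, LinearMap.smul_apply, hω.skew0 hz,
        hω.skew0 hxw, hω.skew0 hxw', hω.alt, hω.skew w' w, smul_eq_mul, hγ]
      field_simp
      ring
    obtain ⟨a, b, e⟩ := h1 _ hzU
    have hb : b = 0 := by
      have e1 := congrArg (fun t => ω t w') e
      simp only [map_sub, map_add, map_smul, LinearMap.sub_apply, LinearMap.add_apply, LinearMap.smul_apply,
        hxw', hω.alt, smul_eq_mul, hβ] at e1
      have : b * ω w w' = 0 := by
        field_simp at e1
        linear_combination - e1
      exact (mul_eq_zero.1 this).resolve_right hD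
    refine ⟨a, ?_⟩
    rw [hb] at e
    rw [sub_sub, sub_eq_iff_eq_add] at e
    rw [e]
    module
  obtain ⟨a, ha⟩ := hz'
  clear_value β γ
  subst ha
  refine (((h2 β).mul (h2' γ)).mul (hT (2 * a + β * γ * ω w w'))).congr fun v => ?_
  simp only [Sv, Tv, map_add, map_smul, LinearMap.add_apply, LinearMap.smul_apply, hω.alt, hxw, hxw',
      hω.skew0 hxw, hω.skew0 hxw', smul_eq_mul, hω.skew w' w]
  module

theorem AE2a (hω : Sy ω) (hI : IsoS ω H) (Q : QF F p f q) (hs : s ∈ H) (hu : u ∈ H) (E : ED ω q s u τ U)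
    {a : V ≃ₗ[F] V} (ha : a ∈ H) (hA : POrd a ((q ^ 2 + 1) / 2))
    {r : V ≃ₗ[F] V} (hr : r ∈ H) (hR : RU U r) (hnc : ∃ v, s (r v) ≠ r (s v)) : AllS ω H := by
  have hP := M2PL hω hI Q hs hu E hr hR hnc
  have hEg : ∀ g ∈ H, ED ω q (g * s * g⁻¹) (g * u * g⁻¹) τ (g • U) := fun g hg => E.conj (hI g hg)
  by_cases hm : ∃ g ∈ H, g • U ≠ U ∧ ∃ x, x ≠ 0 ∧ x ∈ U ∧ x ∈ g • U
  · obtain ⟨g, hg, hne, x, hx0, hxU, hxL⟩ := hm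
    have hEp := PLmeet hω Q E hP (PL_conj hI hP hg) (hEg g hg).ti (hEg g hg).dim hne hx0 hxU hxL
    obtain ⟨h, hh, hne⟩ := Anp hω hI Q ha hA hx0
    exact LemE hω hI Q.two hEp hh hne
  · exfalso
    push Not at hm
    have haU : a • U ≠ U := by
      intro h
      have := Acls hω.dim Q hA U (Or.inr E.dim) (k := 1) (by
        intro v hv
        rw [pow_one, ← h, mem_sm, inv_app]; exact hv)
      have := Nat.le_of_dvd (by norm_num) this
      have := Q.N13
      omega
    have hdis : ∀ x ∈ U, x ∈ a • U → x = 0 := by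
      intro x hx hx'
      by_contra h0
      exact hm a ha haU x h0 hx hx'
    have : ∃ x ∈ U, ∃ y ∈ a • U, ω y x ≠ 0 := by
      by_contra hcon
      push Not at hcon
      obtain ⟨y, hy, hy0⟩ := (hEg a ha).ex
      exact hy0 (hdis y (E.perp hω fun v hv => hcon v hv y hy) hy)
    obtain ⟨x, hx, y, hy, hxy⟩ := this
    have hx0 : x ≠ 0 := by rintro rfl; simp at hxy
    have hy0 : y ≠ 0 := by rintro rfl; simp at hxy
    obtain ⟨-, -, -, -, c, hc, t, ht, hT⟩ := hP x hx hx0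
    set s' := a * s * a⁻¹
    have E' := hEg a ha
    set z := s' y - (ω (s' y) x / ω y x) • y with hz
    have hzL : z ∈ a • U := Submodule.sub_mem _ (E'.sU y hy) (Submodule.smul_mem _ _ hy)
    have hz0 : z ≠ 0 := fun h => E'.nd hy0 _ (sub_eq_zero.1 h)
    have hzx : ω z x = 0 := by
      simp only [hz, map_sub, map_smul, LinearMap.sub_apply, LinearMap.smul_apply, smul_eq_mul]
      field_simp
      ring
    have htz : t z = z := by rw [hT, Tv, hzx]; simp
    have hst : (a⁻¹ * t * a) • U = U := by
      by_contra hne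
      refine hm _ (H.mul_mem (H.mul_mem (H.inv_mem ha) ht) ha) hne (a⁻¹ z) ?_ (mem_sm.1 hzL) ?_
      · intro h; exact hz0 (by rw [← app_inv a z, h, map_zero])
      · rw [mul_smul, mul_smul, mem_sm, inv_inv, app_inv, mem_sm]
        have : t⁻¹ z = z := by conv_lhs => rw [← htz, inv_app]
        rw [this]; exact hzL
    have hty : t y ∈ a • U := by
      have : t y ∈ t • a • U := by rw [mem_sm, inv_app]; exact hy
      have e : t • a • U = a • U := by
        conv_rhs => rw [← hst]
        rw [← mul_smul, ← mul_smul]; congr 1; group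
      rwa [e] at this
    apply hx0
    apply hdis x hx
    have h3 : (c * ω y x) • x ∈ a • U := by
      have := Submodule.sub_mem _ hty hy
      rw [hT, Tv, add_sub_cancel_left] at this
      exact this
    exact (Submodule.smul_mem_iff _ (mul_ne_zero hc hxy)).1 h3
end PSp

open Module
section PSp
open scoped Pointwise
set_option linter.unusedSectionVars false

variable {F V : Type*} [Field F] [AddCommGroup V] [Module F V] [Finite F] [Finite V]
variable {ω : V →ₗ[F] V →ₗ[F] F} {H : Subgroup (V ≃ₗ[F] V)} {p f q : ℕ}
variable {s u : V ≃ₗ[F] V} {τ : F} {U : Submodule F V}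

structure Gd (ω : V →ₗ[F] V →ₗ[F] F) (H : Subgroup (V ≃ₗ[F] V)) (q : ℕ) (τ : F) (s u : V ≃ₗ[F] V)
    (U : Submodule F V) : Prop where
  E : ED ω q s u τ U
  sH : s ∈ H
  uH : u ∈ H
  C : ∀ r ∈ H, RU U r → ∀ v, s (r v) = r (s v)

theorem Gd.conj (hI : IsoS ω H) (G : Gd ω H q τ s u U) {g : V ≃ₗ[F] V} (hg : g ∈ H) :
    Gd ω H q τ (g * s * g⁻¹) (g * u * g⁻¹) (g • U) := by
  refine ⟨G.E.conj (hI g hg), H.mul_mem (H.mul_mem hg G.sH) (H.inv_mem hg),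
    H.mul_mem (H.mul_mem hg G.uH) (H.inv_mem hg), fun r hr hR v => ?_⟩
  have := G.C (g⁻¹ * r * g) (H.mul_mem (H.mul_mem (H.inv_mem hg) hr) hg) ⟨?_, ?_⟩ (g⁻¹ v)
  · have := congrArg g this
    simp only [LinearEquiv.mul_apply, app_inv] at this ⊢
    exact this
  · intro v
    have := mem_sm.1 (hR.1 (g v))
    rwa [map_sub, inv_app] at this
  · intro v hv
    have := hR.2 (g v) (by rw [mem_sm, inv_app]; exact hv)
    simp only [LinearEquiv.mul_apply, this, inv_app]

theorem Gd.noT (hω : Sy ω) (G : Gd ω H q τ s u U) {x : V} (hx : x ∈ U) (hx0 : x ≠ 0) {c : F}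
    (h : Has H (Tv ω c x)) : c = 0 := by
  by_contra hc
  obtain ⟨g, hg, hT⟩ := h
  have hcm := G.C g hg ⟨fun v => by
      rw [hT, Tv, add_sub_cancel_left]; exact U.smul_mem _ hx, fun v hv => by
      rw [hT, Tv, G.E.ti v hv x hx]; simp⟩
  obtain ⟨v, hv⟩ := hω.nd1 hx0
  have e := hcm v
  rw [hT, hT, Tv, Tv, map_add, map_smul] at e
  have e2 := add_left_cancel e
  rw [hω.skew v x, hv] at e2
  refine G.E.nd hx0 ((c * -1)⁻¹ * (c * ω (s v) x)) ?_
  rw [mul_smul, ← e2, smul_smul, inv_mul_cancel₀ (by simpa using hc), one_smul]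

theorem rel_n (Q : QF F p f q) {h : V ≃ₗ[F] V} {t : F} (ht : t ^ 2 ≠ 4) {v : V} (hv : h (h v) = t • h v - v) :
    (h ^ ((q - 1) * (q + 1))) v = v := by
  rcases LemR Q ht with ⟨-, h1⟩ | ⟨-, ε, hε, h1⟩
  · have := rel_pow hv h1
    rw [one_smul] at this
    exact pow_fix this _
  · have := rel_pow hv h1
    have e : (q - 1) * (q + 1) = ((q + 1) / 2) * (2 * (q - 1)) := by
      conv_lhs => rw [Q.e2]
      ring
    have h2 : ε ^ 2 = 1 := by rcases hε with rfl | rfl <;> ring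
    rw [e, pow_mul, pow_eig this, pow_mul, h2, one_pow, one_smul]

theorem BB (hω : Sy ω) (Q : QF F p f q) {x w w' : V} (h1 : ω x w = 0) (h2 : ω x w' = 0) (hD : ω w w' ≠ 0)
    {A α β : F} (ht : (2 - α * β * ω w w' ^ 2) ^ 2 ≠ 4) {h : V ≃ₗ[F] V}
    (hh : ∀ v, h v = Tv ω A x (Tv ω α w (Tv ω β w' v))) (v : V) :
    (h ^ ((q - 1) * (q + 1))) v = Tv ω (-A) x v := by
  have hw : (h ^ ((q - 1) * (q + 1))) w = w := by
    refine rel_n Q ht ?_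
    simp only [hh, Tv, map_add, map_smul, LinearMap.add_apply, LinearMap.smul_apply, hω.alt, h1, h2,
      hω.skew0 h1, hω.skew0 h2, hω.skew w' w, smul_eq_mul]
    module
  have hw' : (h ^ ((q - 1) * (q + 1))) w' = w' := by
    refine rel_n Q ht ?_
    simp only [hh, Tv, map_add, map_smul, LinearMap.add_apply, LinearMap.smul_apply, hω.alt, h1, h2,
      hω.skew0 h1, hω.skew0 h2, hω.skew w' w, smul_eq_mul]
    module
  have hz : ∀ z, ω z w = 0 → ω z w' = 0 → ∀ k : ℕ, (h ^ k) z = z + (k * A * ω z x) • x := by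
    intro z hz hz' k
    induction k with
    | zero => simp
    | succ k ih =>
      rw [pow_succ', LinearEquiv.mul_apply, ih, hh]
      simp only [Tv, map_add, map_smul, LinearMap.add_apply, LinearMap.smul_apply, hω.alt, h1, h2,
        hz, hz', smul_eq_mul]
      push_cast
      module
  have hn : (((q - 1) * (q + 1) : ℕ) : F) = -1 := by
    have := Q.q0
    have h5 := Q.h5
    push_cast [Nat.cast_sub (show 1 ≤ q by omega)]
    rw [this]; ring
  set a := ω v w' / ω w w' with ha
  set b := - ω v w / ω w w' with hb
  have e1 : ω (v - a • w - b • w') w = 0 := by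
    simp only [map_sub, map_smul, LinearMap.sub_apply, LinearMap.smul_apply, hω.alt, hω.skew w' w, smul_eq_mul, hb]
    field_simp
    ring
  have e2 : ω (v - a • w - b • w') w' = 0 := by
    simp only [map_sub, map_smul, LinearMap.sub_apply, LinearMap.smul_apply, hω.alt, smul_eq_mul, ha]
    field_simp
    ring
  have e3 := hz _ e1 e2 ((q - 1) * (q + 1))
  rw [hn, map_sub, map_sub, map_smul, map_smul, hw, hw'] at e3
  simp only [map_sub, map_smul, LinearMap.sub_apply, LinearMap.smul_apply, hω.skew0 h1, hω.skew0 h2] at e3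
  rw [sub_sub, sub_eq_iff_eq_add] at e3
  rw [e3, Tv]
  module

theorem wx_mem (E : ED ω q s u τ U) {x : V} (hx : x ∈ U) : wx s τ x ∈ U :=
  U.sub_mem (E.sU x hx) (U.smul_mem _ hx)

theorem wx_span (hω : Sy ω) (E : ED ω q s u τ U) {x z : V} (hx : x ∈ U) (hx0 : x ≠ 0) (hz : z ∈ U) :
    ∃ a b : F, z = a • x + b • wx s τ x := by
  obtain ⟨a, b, rfl⟩ := E.span hω hx hx0 hz
  exact ⟨a + b * (τ / 2), b, by simp only [wx]; module⟩

theorem line_ne (hω : Sy ω) {L : Submodule F V} {s' u' : V ≃ₗ[F] V} (E : ED ω q s u τ U)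
    (E' : ED ω q s' u' τ L) (hne : L ≠ U) {x : V} (hx0 : x ≠ 0) (hxU : x ∈ U) (hxL : x ∈ L) :
    ω (wx s τ x) (wx s' τ x) ≠ 0 := by
  have hfd : FiniteDimensional F V := FiniteDimensional.of_finrank_pos (by rw [hω.dim]; norm_num)
  intro h0
  apply hne
  have hwU : wx s' τ x ∈ U := by
    apply E.perp hω
    intro v hv
    obtain ⟨a, b, rfl⟩ := wx_span hω E hxU hx0 hv
    simp [E'.ti _ (wx_mem E' hxL) x hxL, hω.skew0 h0]
  apply Submodule.eq_of_le_of_finrank_eq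
  · intro z hz
    obtain ⟨a, b, rfl⟩ := wx_span hω E' hxL hx0 hz
    exact U.add_mem (U.smul_mem _ hxU) (U.smul_mem _ hwU)
  · rw [E.dim, E'.dim]

theorem diag_pow (hω : Sy ω) {x w : V} (hxw : ω x w = 0) {a c : F} (h : ∀ v, u v = v + (a * ω v x) • x + (c * ω v w) • w)
    (i : ℕ) (v : V) : (u ^ i) v = v + (i * a * ω v x) • x + (i * c * ω v w) • w := by
  induction i with
  | zero => simp
  | succ k ih =>
    rw [pow_succ', LinearEquiv.mul_apply, ih, h]
    simp only [map_add, map_smul, LinearMap.add_apply, LinearMap.smul_apply, hω.alt, hxw, hω.skew0 hxw, smul_eq_mul]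
    push_cast
    module

theorem meet (hω : Sy ω) (Q : QF F p f q) {L : Submodule F V} {s' u' : V ≃ₗ[F] V} (G : Gd ω H q τ s u U)
    (G' : Gd ω H q τ s' u' L) (hne : L ≠ U) {x : V} (hx0 : x ≠ 0) (hxU : x ∈ U) (hxL : x ∈ L) {c : F} (hc : c ≠ 0)
    (hd : ∀ v, u v = v + (c * (1 - τ ^ 2 / 4) * ω v x) • x + (c * ω v (wx s τ x)) • wx s τ x) :
    p = 3 ∧ (c * ω (wx s τ x) (wx s' τ x)) ^ 2 = 1 := by
  have hD := line_ne hω G.E G'.E hne hx0 hxU hxL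
  obtain ⟨c', hc', hd'⟩ := G'.E.diag hω Q hxL hx0
  have hk := G.E.k0 Q
  have hxw := G.E.ti x hxU _ (wx_mem G.E hxU)
  have hxw' := G'.E.ti x hxL _ (wx_mem G'.E hxL)
  generalize wx s τ x = w at *
  generalize wx s' τ x = w' at *
  generalize 1 - τ ^ 2 / 4 = κ at *
  set D := ω w w' with hDd
  have key : ∀ i : ℕ, (i : F) ≠ 0 → i * (c * c' * D ^ 2) ≠ 4 → i * c + c' = 0 := by
    intro i hi0 hi
    have h1 := BB hω Q hxw hxw' hD (A := (i * c + c') * κ) (α := i * c) (β := c') (h := u ^ i * u') (by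
      intro h
      have : (i * (c * c' * D ^ 2)) * (i * (c * c' * D ^ 2) - 4) = 0 := by
        rw [← hDd] at h
        linear_combination h
      rcases mul_eq_zero.1 this with h0 | h0
      · exact mul_ne_zero hi0 (mul_ne_zero (mul_ne_zero hc hc') (pow_ne_zero 2 hD)) h0
      · exact hi (sub_eq_zero.1 h0)) (by
      intro v
      rw [LinearEquiv.mul_apply, diag_pow hω hxw hd, hd']
      simp only [Tv, map_add, map_smul, LinearMap.add_apply, LinearMap.smul_apply, hω.alt, hxw, hxw',
        hω.skew0 hxw, hω.skew0 hxw', smul_eq_mul]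
      module)
    have h2 := G.noT hω hxU hx0 ((Has.of (H.pow_mem (H.mul_mem (H.pow_mem G.uH i) G'.uH) _)).congr h1)
    rw [neg_eq_zero] at h2
    exact (mul_eq_zero.1 h2).resolve_right hk
  have h2 := Q.two
  have k1 := key 1 (by simp)
  have k2 := key 2 (by simpa using h2)
  have k3 := key 3
  push_cast at k1 k2 k3
  set γ := c * c' * D ^ 2 with hγ
  by_cases h3 : (3 : F) = 0
  · constructor
    · have := Q.hch
      have h3' : ((3 : ℕ) : F) = 0 := by exact_mod_cast h3
      exact (Nat.prime_dvd_prime_iff_eq Q.hp Nat.prime_three).1 ((CharP.cast_eq_zero_iff F p 3).1 h3')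
    · by_cases hg : γ = 1
      · have e := k2 (by
          rw [hg]
          intro h
          apply h2
          linear_combination - h)
        have e1 : c' = c := by linear_combination e - c * h3
        rw [mul_pow, ← hg, hγ, e1]; ring
      · have e := k1 (by
          intro h
          apply hg
          linear_combination h + h3)
        by_cases hg' : γ = -1
        · have e1 : c' = - c := by linear_combination e
          have : c * c' * D ^ 2 = -1 := hg'
          rw [e1] at this
          linear_combination - this
        · exfalso
          have e' := k2 (by
            intro h
            apply hg'
            have : 2 * (γ + 1) = 0 := by linear_combination h + 2 * h3
            linear_combination (mul_eq_zero.1 this).resolve_left h2)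
          apply hc
          linear_combination e' - e
  · exfalso
    have k3 := k3 h3
    apply hc
    by_cases g1 : 1 * γ = 4
    · have e2 := k2 (by
        intro h
        have : (2 : F) * 2 = 0 := by linear_combination h - 2 * g1
        exact mul_ne_zero h2 h2 this)
      have e3 := k3 (by
        intro h
        have : (2 : F) * 2 * 2 = 0 := by linear_combination h - 3 * g1
        exact mul_ne_zero (mul_ne_zero h2 h2) h2 this)
      linear_combination e3 - e2
    · have e1 := k1 g1
      by_cases g2 : 2 * γ = 4
      · have e3 := k3 (by
          intro h
          have : (2 : F) * 2 = 0 := by linear_combination 2 * h - 3 * g2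
          exact mul_ne_zero h2 h2 this)
        have : 2 * c = 0 := by linear_combination e3 - e1
        exact (mul_eq_zero.1 this).resolve_left h2
      · linear_combination k2 g2 - e1

theorem sq1' {t : F} (h : t ^ 2 = 1) : t = 1 ∨ t = -1 := by
  rw [pow_two] at h; exact mul_self_eq_one_iff.1 h

theorem lines4 (hω : Sy ω) (Q : QF F p f q) {O : Set (Submodule F V)}
    (hO : ∀ L ∈ O, ∃ s u, Gd ω H q τ s u L) {x : V} (hx0 : x ≠ 0) :
    {L ∈ O | x ∈ L}.ncard ≤ 4 ∧ (p ≠ 3 → {L ∈ O | x ∈ L}.ncard ≤ 1) := by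
  have hfd : FiniteDimensional F V := FiniteDimensional.of_finrank_pos (by rw [hω.dim]; norm_num)
  have hfin : Finite (Submodule F V) := inferInstance
  by_cases hex : ∃ U1 ∈ O, ∃ U2 ∈ O, x ∈ U1 ∧ x ∈ U2 ∧ U2 ≠ U1
  · obtain ⟨U1, h1, U2, h2, hx1, hx2, hne⟩ := hex
    obtain ⟨s1, u1, G1⟩ := hO U1 h1
    obtain ⟨s2, u2, G2⟩ := hO U2 h2
    obtain ⟨c1, hc1, hd1⟩ := G1.E.diag hω Q hx1 hx0
    obtain ⟨c2, hc2, hd2⟩ := G2.E.diag hω Q hx2 hx0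
    obtain ⟨hp3, m12⟩ := meet hω Q G1 G2 hne hx0 hx1 hx2 hc1 hd1
    obtain ⟨-, m21⟩ := meet hω Q G2 G1 hne.symm hx0 hx2 hx1 hc2 hd2
    have hD := line_ne hω G1.E G2.E hne hx0 hx1 hx2
    have hxw1 := G1.E.ti x hx1 _ (wx_mem G1.E hx1)
    have hxw2 := G2.E.ti x hx2 _ (wx_mem G2.E hx2)
    refine ⟨?_, fun h => absurd hp3 h⟩
    set w1 := wx s1 τ x with hw1
    set w2 := wx s2 τ x with hw2
    have hsub : {L ∈ O | x ∈ L} ⊆ {U1, U2, Submodule.span F {x, w1 + w2}, Submodule.span F {x, w1 - w2}} := by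
      rintro L ⟨hL, hxL⟩
      simp only [Set.mem_insert_iff, Set.mem_singleton_iff]
      by_cases hL1 : L = U1
      · exact Or.inl hL1
      by_cases hL2 : L = U2
      · exact Or.inr (Or.inl hL2)
      obtain ⟨s3, u3, G3⟩ := hO L hL
      obtain ⟨-, m1⟩ := meet hω Q G1 G3 hL1 hx0 hx1 hxL hc1 hd1
      obtain ⟨-, m2⟩ := meet hω Q G2 G3 hL2 hx0 hx2 hxL hc2 hd2
      have hxw := G3.E.ti x hxL _ (wx_mem G3.E hxL)
      have hwL := wx_mem G3.E hxL
      have hsp : ∀ z ∈ L, ∃ a b : F, z = a • x + b • wx s3 τ x := fun z hz => wx_span hω G3.E hxL hx0 hz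
      rw [← hw1] at m1
      rw [← hw2] at m2
      generalize wx s3 τ x = w at *
      have hz : ∃ a : F, w = a • x + (ω w w2 / ω w1 w2) • w1 + (- ω w w1 / ω w1 w2) • w2 := by
        set β := ω w w2 / ω w1 w2 with hβ
        set γ := - ω w w1 / ω w1 w2 with hγ
        have hzU : w - β • w1 - γ • w2 ∈ U1 := by
          apply G1.E.perp hω
          intro v hv
          obtain ⟨a, b, rfl⟩ := wx_span hω G1.E hx1 hx0 hv
          rw [← hw1]
          simp only [map_sub, map_add, map_smul, LinearMap.sub_apply, LinearMap.smul_apply,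
            hω.skew0 hxw, hω.skew0 hxw1, hω.skew0 hxw2, hω.alt, hω.skew w2 w1, smul_eq_mul, hγ]
          field_simp
          ring
        obtain ⟨a, b, e⟩ := wx_span hω G1.E hx1 hx0 hzU
        rw [← hw1] at e
        have hb : b = 0 := by
          have e1 := congrArg (fun t => ω t w2) e
          simp only [map_sub, map_add, map_smul, LinearMap.sub_apply, LinearMap.add_apply, LinearMap.smul_apply,
            hxw2, hω.alt, smul_eq_mul, hβ] at e1
          have : b * ω w1 w2 = 0 := by
            field_simp at e1
            linear_combination - e1
          exact (mul_eq_zero.1 this).resolve_right hD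
        refine ⟨a, ?_⟩
        rw [hb] at e
        rw [sub_sub, sub_eq_iff_eq_add] at e
        conv_lhs => rw [e]
        module
      obtain ⟨a, hz⟩ := hz
      have hq1 : (ω w w2 / ω w1 w2) ^ 2 = 1 := by
        rw [div_pow, div_eq_one_iff_eq (pow_ne_zero 2 hD)]
        rw [hω.skew w2 w] at m2
        rw [hω.skew w2 w1] at m21
        apply mul_left_cancel₀ (pow_ne_zero 2 hc2)
        linear_combination m2 - m21
      have hq2 : (- ω w w1 / ω w1 w2) ^ 2 = 1 := by
        rw [div_pow, div_eq_one_iff_eq (pow_ne_zero 2 hD)]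
        rw [hω.skew w1 w] at m1
        apply mul_left_cancel₀ (pow_ne_zero 2 hc1)
        linear_combination m1 - m12
      have fin : ∀ b y, b ≠ (0 : F) → w = a • x + b • y → L = Submodule.span F {x, y} := by
        intro b y hb e
        apply le_antisymm
        · intro z hz
          obtain ⟨a', b', rfl⟩ := hsp z hz
          rw [Submodule.mem_span_pair]
          exact ⟨a' + b' * a, b' * b, by rw [e]; module⟩
        · rw [Submodule.span_le, Set.insert_subset_iff, Set.singleton_subset_iff]
          refine ⟨hxL, ?_⟩
          have : y = b⁻¹ • (w - a • x) := by
            rw [e, add_sub_cancel_left, smul_smul, inv_mul_cancel₀ hb, one_smul]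
          rw [this]
          exact L.smul_mem _ (L.sub_mem hwL (L.smul_mem _ hxL))
      generalize ω w w2 / ω w1 w2 = β at *
      generalize - ω w w1 / ω w1 w2 = γ at *
      have n1 : (-1 : F) ≠ 0 := by simp
      rcases sq1' hq1 with rfl | rfl <;> rcases sq1' hq2 with rfl | rfl
      · exact Or.inr (Or.inr (Or.inl (fin 1 _ one_ne_zero (by rw [hz]; module))))
      · exact Or.inr (Or.inr (Or.inr (fin 1 _ one_ne_zero (by rw [hz]; module))))
      · exact Or.inr (Or.inr (Or.inr (fin (-1) _ n1 (by rw [hz]; module))))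
      · exact Or.inr (Or.inr (Or.inl (fin (-1) _ n1 (by rw [hz]; module))))
    refine (Set.ncard_le_ncard hsub (Set.toFinite _)).trans ?_
    refine (Set.ncard_insert_le _ _).trans ?_
    refine (Nat.add_le_add_right (Set.ncard_insert_le _ _) 1).trans ?_
    have := Set.ncard_insert_le (Submodule.span F {x, w1 + w2}) {Submodule.span F {x, w1 - w2}}
    rw [Set.ncard_singleton] at this
    omega
  · push Not at hex
    have : {L ∈ O | x ∈ L}.ncard ≤ 1 := by
      rw [Set.ncard_le_one_iff]
      rintro a b ⟨ha, ha'⟩ ⟨hb, hb'⟩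
      exact hex b hb a ha hb' ha'
    exact ⟨this.trans (by norm_num), fun _ => this⟩
end PSp

open Module
section PSp
open scoped Pointwise
set_option linter.unusedSectionVars false

variable {F V : Type*} [Field F] [AddCommGroup V] [Module F V] [Finite F] [Finite V]
variable {ω : V →ₗ[F] V →ₗ[F] F} {H : Subgroup (V ≃ₗ[F] V)} {p f q : ℕ}
variable {s u : V ≃ₗ[F] V} {τ : F} {U : Submodule F V}

theorem RU_pow {t : V ≃ₗ[F] V} (h : RU U t) (k : ℕ) (v : V) : (t ^ k) v = v + (k : F) • (t v - v) := by
  induction k with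
  | zero => simp
  | succ k ih =>
    rw [pow_succ', LinearEquiv.mul_apply, ih, map_add, map_smul, h.2 _ (h.1 v)]
    push_cast
    module

theorem ED.sq (E : ED ω q s u τ U) (Q : QF F p f q) : s ^ (q + 1) = 1 := by
  rw [Q.e2]
  exact Pm.two ((E.ord _).2 dvd_rfl)

theorem rest_eq (hω : Sy ω) (hI : IsoS ω H) (Q : QF F p f q) (G : Gd ω H q τ s u U) {y : V ≃ₗ[F] V} (hy : y ∈ H)
    (hq : y ^ (q + 1) = 1) (h : ∀ l ∈ U, y l = s l) : s = y := by
  have hI' := hI _ (H.mul_mem (H.inv_mem G.sH) hy)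
  have h1 : ∀ l ∈ U, (s⁻¹ * y) l = l := fun l hl => by rw [LinearEquiv.mul_apply, h l hl, inv_app]
  have hR : RU U (s⁻¹ * y) := by
    refine ⟨fun v => G.E.perp hω fun l hl => ?_, h1⟩
    have := hI' v l
    rw [h1 l hl] at this
    rw [map_sub, LinearMap.sub_apply, this, sub_self]
  have hc := G.C _ (H.mul_mem (H.inv_mem G.sH) hy) hR
  have hcm : Commute s⁻¹ y := by
    have : s * (s⁻¹ * y) = (s⁻¹ * y) * s := LinearEquiv.ext hc
    rw [mul_inv_cancel_left] at this
    have h3 : Commute s y := by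
      have := congrArg (s * ·) this
      simpa [Commute, SemiconjBy, mul_assoc] using this
    exact h3.inv_left
  have hp : (s⁻¹ * y) ^ (q + 1) = 1 := by
    rw [hcm.mul_pow, inv_pow, G.E.sq Q, hq]; simp
  have : s⁻¹ * y = 1 := by
    ext v
    have := RU_pow hR (q + 1) v
    rw [hp] at this
    push_cast at this
    rw [Q.q0] at this
    simp only [zero_add, one_smul, LinearEquiv.coe_one, id_eq] at this ⊢
    rw [add_sub_cancel] at this
    exact this.symm
  exact (inv_mul_eq_one.1 this)

theorem ED.fix (hω : Sy ω) (Q : QF F p f q) (E : ED ω q s u τ U) {v : V} (h : u v = v) : v ∈ U := by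
  obtain ⟨x, hx, hx0⟩ := E.ex
  obtain ⟨c, hc, hd⟩ := E.diag hω Q hx hx0
  have hk := E.k0 Q
  have e := hd v
  rw [h, add_assoc] at e
  have e' := left_eq_add.1 e
  have hW : ω v (wx s τ x) = 0 := by
    by_contra h0
    have h1 : c * ω v (wx s τ x) ≠ 0 := mul_ne_zero hc h0
    apply E.nd hx0 (τ / 2 - (c * ω v (wx s τ x))⁻¹ * (c * (1 - τ ^ 2 / 4) * ω v x))
    generalize c * ω v (wx s τ x) = d at *
    have e2 : wx s τ x = d⁻¹ • (- ((c * (1 - τ ^ 2 / 4) * ω v x) • x)) := by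
      rw [eq_inv_smul_iff₀ h1, eq_neg_iff_add_eq_zero, add_comm, e']
    rw [wx, sub_eq_iff_eq_add] at e2
    rw [e2]
    module
  have hX : ω v x = 0 := by
    rw [hW] at e'
    simp only [mul_zero, zero_smul, add_zero, smul_eq_zero, mul_eq_zero] at e'
    tauto
  apply E.perp hω
  intro z hz
  obtain ⟨a, b, rfl⟩ := wx_span hω E hx hx0 hz
  simp [hX, hW]

theorem notop (hω : Sy ω) (E : ED ω q s u τ U) : ∃ v, v ∉ U := by
  by_contra h
  push Not at h
  have h1 : U = ⊤ := Submodule.eq_top_iff'.2 h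
  have := E.dim
  rw [h1, finrank_top, hω.dim] at this
  omega

theorem comm_u (hω : Sy ω) (Q : QF F p f q) {L : Submodule F V} {s' u' : V ≃ₗ[F] V}
    (G : Gd ω H q τ s u U) (G' : Gd ω H q τ s' u' L) (hI : IsoS ω H) (hs : ∀ v ∈ L, s v ∈ L)
    (hs2 : ∀ v ∈ L, s⁻¹ v ∈ L) (v : V) : s (u' v) = u' (s v) := by
  set r := s * u' * s⁻¹ with hr
  have hrH : r ∈ H := H.mul_mem (H.mul_mem G.sH G'.uH) (H.inv_mem G.sH)
  have ev : ∀ v, r v = s (u' (s⁻¹ v)) := fun _ => rfl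
  have hR : RU L r := by
    constructor
    · intro v
      have := hs _ (G'.E.uV (s⁻¹ v))
      rw [map_sub, app_inv] at this
      exact this
    · intro v hv
      rw [ev, G'.E.uU _ (hs2 v hv), app_inv]
  have E' := G'.E
  have E2 : ED ω q s' r τ L := by
    refine ⟨E'.dim, E'.ti, E'.sU, hR.1, hR.2, E'.rel, E'.irr, G'.C r hrH hR, ?_, E'.ord, E'.si, hI r hrH⟩
    obtain ⟨v, hv⟩ := E'.ne
    refine ⟨s v, ?_⟩
    rw [ev, inv_app]
    exact fun h => hv (s.injective h)
  obtain ⟨x, hx, hx0⟩ := E'.ex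
  obtain ⟨c1, hc1, hd1⟩ := E'.diag hω Q hx hx0
  obtain ⟨c2, hc2, hd2⟩ := E2.diag hω Q hx hx0
  obtain ⟨μ, hμ⟩ : ∃ μ, μ = c2 / c1 := ⟨_, rfl⟩
  have hμ0 : μ ≠ 0 := by rw [hμ]; exact div_ne_zero hc2 hc1
  have hc2' : c2 = μ * c1 := by rw [hμ]; field_simp
  have hN : ∀ v, s (u' v - v) = μ • (u' (s v) - s v) := by
    intro v
    have : s (u' v - v) = r (s v) - s v := by rw [ev, inv_app, map_sub]
    rw [this, hd1, hd2, hc2']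
    module
  by_cases h1 : μ = 1
  · have := hN v
    rw [h1, one_smul, map_sub] at this
    exact sub_left_injective this
  · exfalso
    have hτ := E'.t0 Q
    have key : ∀ v, s v - ((1 + μ) / (τ * μ)) • v ∈ L := by
      intro v
      apply E'.fix hω Q
      have e1 := hN v
      have e2 := hN (s v)
      rw [G.E.rel] at e2
      have e3 := G.E.rel (u' v - v)
      rw [e1, map_smul, e2] at e3
      rw [← sub_eq_zero]
      have hne : (1 - μ) * (τ * μ) ≠ 0 := mul_ne_zero (sub_ne_zero.2 (Ne.symm h1)) (mul_ne_zero hτ hμ0)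
      have : ((1 - μ) * (τ * μ)) • (u' (s v - ((1 + μ) / (τ * μ)) • v) - (s v - ((1 + μ) / (τ * μ)) • v)) = 0 := by
        have h4 : ((1 - μ) * (τ * μ)) • (u' (s v - ((1 + μ) / (τ * μ)) • v) - (s v - ((1 + μ) / (τ * μ)) • v))
           = ((1 - μ) * (τ * μ)) • (u' (s v) - s v) - ((1 - μ) * (1 + μ)) • (u' v - v) := by
          rw [map_sub, map_smul]
          have : ((1 - μ) * (1 + μ)) = ((1 - μ) * (τ * μ)) * ((1 + μ) / (τ * μ)) := by field_simp
          rw [this]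
          module
        rw [h4]
        rw [map_sub, map_smul] at e3
        have e4 := sub_eq_zero.2 e3
        rw [← neg_eq_zero, ← e4]
        module
      exact (smul_eq_zero.1 this).resolve_left hne
    obtain ⟨v, hv⟩ := notop hω E'
    set d := (1 + μ) / (τ * μ)
    have h3 := key (s v)
    rw [G.E.rel] at h3
    have h4 := L.sub_mem h3 (L.smul_mem (τ - d) (key v))
    have h5 : (τ • s v - v - d • s v - (τ - d) • (s v - d • v)) = (-(d ^ 2 - τ * d + 1)) • v := by module
    rw [h5] at h4
    exact hv ((L.smul_mem_iff (neg_ne_zero.2 (E'.irr d))).1 h4)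

theorem block0 (hω : Sy ω) (hI : IsoS ω H) (Q : QF F p f q) {L : Submodule F V} {s' u' : V ≃ₗ[F] V}
    (G : Gd ω H q τ s u U) (G' : Gd ω H q τ s' u' L) (hL : s • L = L) : s' = s ∨ s' = s⁻¹ := by
  have hs2 : ∀ v ∈ L, s⁻¹ v ∈ L := fun v hv => mem_sm.1 (by rw [hL]; exact hv)
  have hs : ∀ v ∈ L, s v ∈ L := fun v hv => by rw [← hL, mem_sm, inv_app]; exact hv
  have hcm := comm_u hω Q G G' hI hs hs2
  have E' := G'.E
  have E := G.E
  have E2 : ED ω q s u' τ L :=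
    ⟨E'.dim, E'.ti, hs, E'.uV, E'.uU, E.rel, E.irr, hcm, E'.ne, E.ord, E.si, E'.ui⟩
  obtain ⟨x, hx, hx0⟩ := E'.ex
  obtain ⟨c1, hc1, hd1⟩ := E'.diag hω Q hx hx0
  obtain ⟨c2, hc2, hd2⟩ := E2.diag hω Q hx hx0
  obtain ⟨α, β, hw⟩ := wx_span hω E2 hx hx0 (wx_mem E' hx)
  have hxw : ω x (wx s τ x) = 0 := E'.ti x hx _ (wx_mem E2 hx)
  have hind : ∀ c : F, wx s τ x ≠ c • x := by
    intro c h
    rw [wx, sub_eq_iff_eq_add, ← add_smul] at h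
    exact E2.nd hx0 _ h
  obtain ⟨h1, h2, h3⟩ := Qm_inj hω hx0 hxw hind (a := c2 * (1 - τ ^ 2 / 4)) (b := 0) (c := c2)
    (a' := c1 * (1 - τ ^ 2 / 4) + c1 * α ^ 2) (b' := c1 * α * β) (c' := c1 * β ^ 2) (by
      intro v
      have e1 := hd1 v
      rw [hd2, hw] at e1
      simp only [map_add, map_smul, smul_eq_mul] at e1
      simp only [Qm, zero_mul, add_zero, zero_add]
      rw [e1]
      module)
  have hβ : β ≠ 0 := by rintro rfl; apply hc2; rw [h3]; ring
  have hα : α = 0 := by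
    have := h2.symm
    simp only [mul_eq_zero] at this
    tauto
  subst hα
  have hc : c2 = c1 := mul_right_cancel₀ (E'.k0 Q) (by linear_combination h1)
  have hβ1 : β ^ 2 = 1 := mul_left_cancel₀ hc1 (by rw [← h3, hc, mul_one])
  have hsp : ∀ l ∈ L, ∃ a b : F, l = a • x + b • s x := fun l hl => E2.span hω hx hx0 hl
  have h20 := Q.two
  have ht : τ = τ / 2 + τ / 2 := by field_simp; ring
  have hw2 : s' x = β • s x + ((1 - β) * (τ / 2)) • x := by
    rw [wx, wx, sub_eq_iff_eq_add] at hw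
    rw [hw]; module
  rcases sq1' hβ1 with rfl | rfl
  · left
    refine rest_eq hω hI Q G' G.sH (E.sq Q) fun l hl => ?_
    obtain ⟨a, b, rfl⟩ := hsp l hl
    have e : s' x = s x := by rw [hw2]; module
    have e2 : s' (s x) = s (s x) := by rw [E.rel, ← e, E'.rel]
    rw [map_add, map_add, map_smul, map_smul, map_smul, map_smul, e, e2]
  · right
    refine rest_eq hω hI Q G' (H.inv_mem G.sH) (by rw [inv_pow, E.sq Q, inv_one]) fun l hl => ?_
    obtain ⟨a, b, rfl⟩ := hsp l hl
    have e : s x = τ • x - s' x := by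
      rw [hw2]
      generalize τ / 2 = t at *
      subst ht
      module
    have e2 : s' (s x) = x := by rw [e, map_sub, map_smul, E'.rel]; module
    have e3 : s⁻¹ x = s' x := by
      rw [← inv_app s (s' x)]
      congr 1
      have : s' x = τ • x - s x := by rw [e]; module
      rw [this, map_sub, map_smul, E.rel]; module
    rw [map_add, map_add, map_smul, map_smul, map_smul, map_smul, e2, e3, inv_app]
end PSp

open Module
section PSp
open scoped Pointwise
set_option linter.unusedSectionVars false

variable {F V : Type*} [Field F] [AddCommGroup V] [Module F V] [Finite F] [Finite V]
variable {ω : V →ₗ[F] V →ₗ[F] F} {H : Subgroup (V ≃ₗ[F] V)} {p f q : ℕ}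
variable {s u : V ≃ₗ[F] V} {τ : F} {U : Submodule F V}

theorem dcount (hω : Sy ω) (Q : QF F p f q) {O : Set (Submodule F V)} (hd : ∀ L ∈ O, finrank F L = 2) {N : ℕ}
    (hN : ∀ x : V, x ≠ 0 → {L ∈ O | x ∈ L}.ncard ≤ N) : O.ncard * (q ^ 2 - 1) ≤ (q ^ 4 - 1) * N := by
  classical
  have : Fintype V := Fintype.ofFinite V
  have hfin : Finite (Submodule F V) := inferInstance
  have : Fintype (Submodule F V) := Fintype.ofFinite _
  have h1 := Finset.card_mul_le_card_mul (s := O.toFinset) (t := Finset.univ.filter (fun x : V => x ≠ 0))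
    (fun L x => x ∈ L) (m := q ^ 2 - 1) (n := N) ?_ ?_
  · rw [Set.ncard_eq_toFinset_card']
    refine h1.trans (le_of_eq ?_)
    congr 1
    have e : (Finset.univ.filter (fun x : V => x ≠ 0)) = Finset.univ.erase 0 := by ext; simp
    rw [e, Finset.card_erase_of_mem (Finset.mem_univ _), Finset.card_univ, ← Nat.card_eq_fintype_card]
    have := ncard_sub (F := F) (V := V) ⊤
    rw [finrank_top, hω.dim, Q.hc, Submodule.top_coe, Set.ncard_univ] at this
    rw [this]
  · intro L hL
    rw [Set.mem_toFinset] at hL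
    have e : (Finset.univ.filter (fun x : V => x ≠ 0)).bipartiteAbove (fun (L : Submodule F V) x => x ∈ L) L
        = (L : Set V).toFinset.erase 0 := by
      ext x; simp [Finset.mem_bipartiteAbove]
    rw [e, Finset.card_erase_of_mem (by simp), ← Set.ncard_eq_toFinset_card', ncard_sub, hd L hL, Q.hc]
  · intro x hx
    have := hN x (by simpa using hx)
    refine le_trans (le_of_eq ?_) this
    rw [Set.ncard_eq_toFinset_card']
    congr 1
    ext L
    simp [Finset.mem_bipartiteBelow]

theorem eq_of_le2 (hω : Sy ω) {L M : Submodule F V} (hL : finrank F L = 2) (hM : finrank F M = 2) (h : L ≤ M) :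
    L = M := by
  have hfd : FiniteDimensional F V := FiniteDimensional.of_finrank_pos (by rw [hω.dim]; norm_num)
  exact Submodule.eq_of_le_of_finrank_eq h (by rw [hL, hM])

theorem sm_eq (hω : Sy ω) {g : V ≃ₗ[F] V} {L : Submodule F V} (hL : finrank F L = 2) (h : ∀ v ∈ L, g v ∈ L) :
    g • L = L := by
  apply eq_of_le2 hω (by rw [dim_sm, hL]) hL
  intro v hv
  have := h _ (mem_sm.1 hv)
  rwa [app_inv] at this

theorem mem_of_sm {g : V ≃ₗ[F] V} {L : Submodule F V} (h : g • L = L) {v : V} (hv : v ∈ L) : g v ∈ L := by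
  rw [← h, mem_sm, inv_app]; exact hv

/-- the unipotent element moves every other line freely -/
theorem ufree (hω : Sy ω) (Q : QF F p f q) (E : ED ω q s u τ U) {L : Submodule F V} (hd : finrank F L = 2)
    (hti : ∀ v ∈ L, ∀ w ∈ L, ω v w = 0) (hne : L ≠ U) {k : ℕ} (hk : u ^ k • L = L) : p ∣ k := by
  have hch := Q.hch
  rw [← CharP.cast_eq_zero_iff F p k]
  by_contra hk0
  apply hne
  apply eq_of_le2 hω hd E.dim
  intro v hv
  by_contra hvU
  have h1 : u v - v ∈ L := by
    have := L.sub_mem (mem_of_sm hk hv) hv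
    rw [RU_pow (U := U) ⟨E.uV, E.uU⟩, add_sub_cancel_left] at this
    exact (L.smul_mem_iff hk0).1 this
  have hn0 : u v - v ≠ 0 := fun h => hvU (E.fix hω Q (sub_eq_zero.1 h))
  obtain ⟨c, hc, hdg⟩ := E.diag hω Q (E.uV v) hn0
  have e := hdg v
  set n := u v - v with hn
  rw [hti v hv n h1, mul_zero, zero_smul, add_zero] at e
  have e2 : n = (c * ω v (wx s τ n)) • wx s τ n := by rw [hn, ← sub_eq_iff_eq_add'.2 e]
  have hd0 : c * ω v (wx s τ n) ≠ 0 := by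
    intro h0; rw [h0, zero_smul] at e2; exact hn0 e2
  generalize c * ω v (wx s τ n) = d at *
  refine E.nd hn0 (d⁻¹ + τ / 2) ?_
  have e3 : d⁻¹ • n = wx s τ n := by rw [inv_smul_eq_iff₀ hd0]; exact e2
  rw [add_smul, e3, wx]; abel

/-- lines stable under `s` -/
theorem sline (hω : Sy ω) (E : ED ω q s u τ U) {L M : Submodule F V} (hL : finrank F L = 2)
    (hti : ∀ v ∈ L, ∀ w ∈ L, ω v w = 0) (hM : finrank F M = 2)
    (hsL : s • L = L) (hsM : s • M = M) {x : V} (hx0 : x ≠ 0) (hxL : x ∈ L) (hxM : x ∈ M) : L = M := by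
  apply eq_of_le2 hω hL hM
  intro z hz
  have hsx := mem_of_sm hsL hxL
  obtain ⟨a, b, rfl⟩ := ti_span hω hx0 (hti x hxL _ hsx) (E.nd hx0) (hti z hz x hxL) (hti z hz _ hsx)
  exact M.add_mem (M.smul_mem _ hxM) (M.smul_mem _ (mem_of_sm hsM hxM))

theorem sfew (hω : Sy ω) (Q : QF F p f q) (E : ED ω q s u τ U) {O : Set (Submodule F V)}
    (hd : ∀ L ∈ O, finrank F L = 2) (hti : ∀ L ∈ O, ∀ v ∈ L, ∀ w ∈ L, ω v w = 0) (hs : ∀ L ∈ O, s • L = L)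
    (hU : U ∉ O) : O.ncard ≤ q := by
  classical
  have hfd : FiniteDimensional F V := FiniteDimensional.of_finrank_pos (by rw [hω.dim]; norm_num)
  have hsU : s • U = U := sm_eq hω E.dim E.sU
  obtain ⟨v, hv⟩ := notop hω E
  have hz : ∀ L ∈ O, ∃ z ∈ U, v - z ∈ L := by
    intro L hL
    have hbot : L ⊓ U = ⊥ := by
      rw [Submodule.eq_bot_iff]
      rintro x ⟨hxL, hxU⟩
      by_contra hx0
      have := sline hω E (hd L hL) (hti L hL) E.dim (hs L hL) hsU hx0 hxL hxU
      exact hU (this ▸ hL)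
    have h1 := Submodule.finrank_sup_add_finrank_inf_eq L U
    rw [hbot, finrank_bot, hd L hL, E.dim] at h1
    have htop : L ⊔ U = ⊤ := Submodule.eq_top_of_finrank_eq (by rw [hω.dim]; omega)
    have : v ∈ L ⊔ U := htop ▸ Submodule.mem_top
    obtain ⟨l, hl, z, hz, rfl⟩ := Submodule.mem_sup.1 this
    exact ⟨z, hz, by simpa using hl⟩
  choose! z hzU hzL using hz
  have h2 := Q.two
  have key : ∀ L ∈ O, ω v (s v) - 2 * ω v (s (z L)) + τ * ω v (z L) = 0 := by
    intro L hL
    have e1 := hti L hL _ (hzL L hL) _ (mem_of_sm (hs L hL) (hzL L hL))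
    have e2 := E.x0 (hzU L hL)
    have e3 : ω (z L) (s v) = - τ * ω v (z L) + ω v (s (z L)) := by
      rw [← E.si, E.rel, map_sub, map_smul, E.si, hω.skew (z L) v, hω.skew (s (z L)) v]
      simp
    simp only [map_sub, LinearMap.sub_apply, e2, e3] at e1
    linear_combination e1
  have hinj : Set.InjOn (fun L => ω v (z L)) O := by
    intro L hL M hM h
    simp only at h
    have hzz : z L = z M := by
      by_contra hne
      apply hv
      have hd0 : z L - z M ≠ 0 := sub_ne_zero.2 hne
      have hdU : z L - z M ∈ U := U.sub_mem (hzU L hL) (hzU M hM)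
      have k1 : ω v (s (z L)) = ω v (s (z M)) := by
        apply mul_left_cancel₀ h2
        linear_combination key M hM - key L hL + τ * h
      apply E.perp hω
      intro w hw
      obtain ⟨a, b, rfl⟩ := E.span hω hdU hd0 hw
      simp [h, k1]
    have hl0 : v - z L ≠ 0 := fun h0 => hv (by rw [sub_eq_zero.1 h0]; exact hzU L hL)
    exact sline hω E (hd L hL) (hti L hL) (hd M hM) (hs L hL) (hs M hM) hl0 (hzL L hL) (hzz ▸ hzL M hM)
  have := Set.ncard_le_ncard_of_injOn (t := Set.univ) _ (fun a _ => Set.mem_univ _) hinj (Set.toFinite _)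
  rwa [Set.ncard_univ, Q.hc] at this

theorem blockdvd {X α : Type*} [Group X] [Finite X] [MulAction X α] (H B : Subgroup X) (x : α) (hB : B ≤ H)
    (h : ∀ g ∈ H, g • x = x → g ∈ B) :
    {y | ∃ g ∈ B, y = g • x}.ncard ∣ {y | ∃ g ∈ H, y = g • x}.ncard := by
  have e : ∀ K : Subgroup X, {y | ∃ g ∈ K, y = g • x}.ncard = (MulAction.stabilizer X x).relIndex K := by
    intro K
    have h1 := MulAction.index_stabilizer K x
    have h2 : MulAction.stabilizer K x = (MulAction.stabilizer X x).subgroupOf K := by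
      ext g; rfl
    rw [Subgroup.relIndex, ← h2, h1]
    congr 1
    ext y
    constructor
    · rintro ⟨g, hg, rfl⟩; exact ⟨⟨g, hg⟩, rfl⟩
    · rintro ⟨g, rfl⟩; exact ⟨g, g.2, rfl⟩
  rw [e, e]
  have e2 : MulAction.stabilizer X x ⊓ B = MulAction.stabilizer X x ⊓ H := by
    ext g
    constructor
    · rintro ⟨h1, h2⟩; exact ⟨h1, hB h2⟩
    · rintro ⟨h1, h2⟩; exact ⟨h1, h g h2 h1⟩
  rw [← Subgroup.inf_relIndex_right _ B, ← Subgroup.inf_relIndex_right _ H, ← e2,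
    ← Subgroup.relIndex_mul_relIndex _ B H inf_le_right hB]
  exact dvd_mul_right _ _

theorem arith {n m fc e : ℕ} (hp : p.Prime) (hq : q = p ^ f) (h5 : 5 ≤ q) (ho : Odd q) (he : q + 1 = 2 * e)
    {N : ℕ} (hN : N ≤ 4) (hN1 : p ≠ 3 → N ≤ 1)
    (hc : n * (q ^ 2 - 1) ≤ (q ^ 4 - 1) * N) (hn : 2 * n = m * (q ^ 2 + 1)) (hn1 : n % p = 1) (hf : fc % p = 1)
    (hfe : (n : ℤ) ≡ fc [ZMOD e]) (hfq : fc ≤ q + 1) (hfn : fc ∣ n) : False := by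
  have hf0 : f ≠ 0 := by rintro rfl; rw [pow_zero] at hq; omega
  have hpq : p ∣ q := hq ▸ dvd_pow_self p hf0
  have hm : m ≤ 2 * N := by
    have h1 : q ^ 4 - 1 = (q ^ 2 - 1) * (q ^ 2 + 1) := by
      have h2' : 1 ≤ q ^ 2 := Nat.one_le_pow _ _ (by omega)
      have h4' : 1 ≤ q ^ 4 := Nat.one_le_pow _ _ (by omega)
      zify [h2', h4']; ring
    have h2 : 0 < q ^ 2 - 1 := by
      have : 5 ^ 2 ≤ q ^ 2 := Nat.pow_le_pow_left h5 2
      omega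
    rw [h1] at hc
    have h3 : n ≤ (q ^ 2 + 1) * N := by
      apply Nat.le_of_mul_le_mul_right _ h2
      calc n * (q ^ 2 - 1) ≤ _ := hc
        _ = _ := by ring
    have h4 : m * (q ^ 2 + 1) ≤ (2 * N) * (q ^ 2 + 1) := by rw [← hn]; nlinarith
    exact Nat.le_of_mul_le_mul_right h4 (by positivity)
  have hp3 : 3 ≤ p := by
    rcases hp.eq_two_or_odd with h | h
    · rw [h] at hpq; rcases ho with ⟨k, hk⟩; omega
    · have := hp.two_le; omega
  have hmp : (p : ℤ) ∣ (m : ℤ) - 2 := by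
    have h1 : (p : ℤ) ∣ (n : ℤ) - 1 := by
      have := Nat.div_add_mod n p
      rw [hn1] at this
      have h' : (p : ℤ) * (n / p : ℕ) + 1 = n := by exact_mod_cast this
      exact ⟨(n / p : ℕ), by linear_combination - h'⟩
    obtain ⟨a, ha⟩ := h1
    obtain ⟨b, hb⟩ := hpq
    refine ⟨2 * a - m * b * q, ?_⟩
    have hn' : (2 : ℤ) * n = m * (q ^ 2 + 1) := by exact_mod_cast hn
    have hb' : (q : ℤ) = p * b := by exact_mod_cast hb
    have : (m : ℤ) * (q * q) = m * q * (p * b) := by rw [← hb']; ring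
    linear_combination - hn' + 2 * ha - this
  have hfp : (p : ℤ) ∣ (fc : ℤ) - 1 := by
    have := Nat.div_add_mod fc p
    rw [hf] at this
    have h' : (p : ℤ) * (fc / p : ℕ) + 1 = fc := by exact_mod_cast this
    exact ⟨(fc / p : ℕ), by linear_combination - h'⟩
  have hqe : (q : ℤ) = 2 * e - 1 := by have : (q : ℤ) + 1 = 2 * e := by exact_mod_cast he
                                       linarith
  have hnm : (n : ℤ) = m * (2 * e ^ 2 - 2 * e + 1) := by
    have hn' : (2 : ℤ) * n = m * (q ^ 2 + 1) := by exact_mod_cast hn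
    rw [hqe] at hn'
    linarith
  have hfm : ∃ k : ℤ, (fc : ℤ) = m + k * e := by
    obtain ⟨k, hk⟩ := hfe.dvd
    exact ⟨k + m * (2 * e - 2), by rw [hnm] at hk; linear_combination hk⟩
  obtain ⟨k, hk⟩ := hfm
  have hfc1 : 1 ≤ fc := by
    rcases Nat.eq_zero_or_pos fc with h | h
    · rw [h, Nat.zero_mod] at hf; omega
    · exact h
  have hfe2 : (fc : ℤ) ≤ 2 * e := by
    have : (fc : ℤ) ≤ q + 1 := by exact_mod_cast hfq
    linarith
  have he3 : (3 : ℤ) ≤ e := by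
    have : 3 ≤ e := by omega
    exact_mod_cast this
  have hm0 : m ≠ 0 := by
    rintro rfl
    have : n = 0 := by omega
    rw [this, Nat.zero_mod] at hn1; omega
  by_cases h3 : p = 3
  · subst h3
    have hf2 : 2 ≤ f := by
      by_contra h
      have : f ≤ 1 := by omega
      have := Nat.pow_le_pow_right (show 0 < 3 by norm_num) this
      omega
    obtain ⟨j, rfl⟩ := Nat.exists_eq_add_of_le hf2
    have h9 : q = 9 * 3 ^ j := by rw [hq, pow_add]; norm_num
    have hj : 1 ≤ 3 ^ j := Nat.one_le_pow _ _ (by norm_num)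
    have he2 : ∃ t : ℤ, (e : ℤ) = 9 * t + 5 := by
      have : ∃ t, e = 9 * t + 5 := ⟨e / 9, by omega⟩
      obtain ⟨t, ht⟩ := this
      exact ⟨t, by exact_mod_cast ht⟩
    obtain ⟨t, ht⟩ := he2
    have he5 : (5 : ℤ) ≤ e := by
      have : 5 ≤ e := by omega
      exact_mod_cast this
    have hm8 : m ≤ 8 := by omega
    have hkl : k = 1 := by
      have hk1 : k ≤ 1 := by
        by_contra h
        have : (2 : ℤ) ≤ k := by omega
        have : 2 * (e : ℤ) ≤ k * e := by nlinarith
        omega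
      have hk2 : -1 ≤ k := by
        by_contra h
        have : k ≤ -2 := by omega
        have : k * (e : ℤ) ≤ -2 * e := by nlinarith
        omega
      have : k = -1 ∨ k = 0 ∨ k = 1 := by omega
      rcases this with rfl | rfl | rfl
      · omega
      · omega
      · rfl
    subst hkl
    have hdv : (fc : ℤ) ∣ m * (2 * m ^ 2 + 2 * m + 1) := by
      have h1 : (fc : ℤ) ∣ n := by exact_mod_cast hfn
      obtain ⟨a, ha⟩ := h1
      refine ⟨a - m * (2 * e - 2 * m - 2), ?_⟩
      rw [mul_sub, ← ha, hnm, hk]; ring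
    have hdv2 : 9 * 3 ^ j + 2 * m + 1 ∣ 2 * (m * (2 * m ^ 2 + 2 * m + 1)) := by
      have h1 : fc ∣ m * (2 * m ^ 2 + 2 * m + 1) := by exact_mod_cast hdv
      have : 9 * 3 ^ j + 2 * m + 1 = 2 * fc := by omega
      rw [this]; exact Nat.mul_dvd_mul_left 2 h1
    have hmm : m = 2 ∨ m = 5 ∨ m = 8 := by omega
    have hj6 : j < 6 := by
      by_contra h
      have h6 : 3 ^ 6 ≤ 3 ^ j := Nat.pow_le_pow_right (by norm_num) (by omega)
      have := Nat.le_of_dvd (by positivity) hdv2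
      rcases hmm with rfl | rfl | rfl <;> omega
    clear * - hdv2 hmm hj6
    interval_cases j <;> rcases hmm with rfl | rfl | rfl <;> revert hdv2 <;> decide
  · have hN1 := hN1 h3
    have hp5 : 5 ≤ p := by
      by_contra h
      have : p = 4 := by omega
      rw [this] at hp; exact absurd hp (by decide)
    have hm2 : m = 2 := by
      have hmle : m ≤ 2 := by omega
      interval_cases m
      · omega
      · exfalso
        have := Int.le_of_dvd (by norm_num) (dvd_neg.2 hmp)
        norm_num at this; omega
      · rfl
    subst hm2
    have hk01 : k = 0 ∨ k = 1 := by
      have hk1 : k ≤ 1 := by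
        by_contra h
        have : (2 : ℤ) ≤ k := by omega
        have : 2 * (e : ℤ) ≤ k * e := by nlinarith
        omega
      have hk2 : 0 ≤ k := by
        by_contra h
        have : k ≤ -1 := by omega
        have : k * (e : ℤ) ≤ -1 * e := by nlinarith
        omega
      omega
    have hpq' : (p : ℤ) ∣ q := by exact_mod_cast hpq
    rcases hk01 with rfl | rfl
    · have : (p : ℤ) ∣ 1 := by
        have : (fc : ℤ) - 1 = 1 := by rw [hk]; norm_num
        rwa [this] at hfp
      have := Int.le_of_dvd (by norm_num) this
      omega
    · have : (p : ℤ) ∣ 3 := by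
        have h1 : (3 : ℤ) = 2 * (fc - 1) - q := by rw [hk, hqe]; push_cast; ring
        rw [h1]
        exact dvd_sub (dvd_mul_of_dvd_right hfp _) hpq'
      have := Int.le_of_dvd (by norm_num) this
      omega
end PSp

open Module
section PSp
open scoped Pointwise
set_option linter.unusedSectionVars false

variable {F V : Type*} [Field F] [AddCommGroup V] [Module F V] [Finite F] [Finite V]
variable {ω : V →ₗ[F] V →ₗ[F] F} {H : Subgroup (V ≃ₗ[F] V)} {p f q : ℕ}
variable {s u : V ≃ₗ[F] V} {τ : F} {U : Submodule F V}

theorem blk (hω : Sy ω) (hI : IsoS ω H) (Q : QF F p f q) (G : Gd ω H q τ s u U) {g : V ≃ₗ[F] V} (hg : g ∈ H)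
    (h : s • g • U = g • U) (M : Submodule F V) : s • g • M = g • M ↔ s • M = M := by
  rcases block0 hω hI Q G (G.conj hI hg) h with h1 | h1
  · have e : s * g = g * s := by rw [mul_inv_eq_iff_eq_mul] at h1; exact h1.symm
    rw [← mul_smul, e, mul_smul]
    exact smul_left_cancel_iff g
  · have e : s⁻¹ * g = g * s := by rw [mul_inv_eq_iff_eq_mul] at h1; exact h1.symm
    have : s • g • M = g • M ↔ s⁻¹ • g • M = g • M := by
      rw [inv_smul_eq_iff]; exact eq_comm
    rw [this, ← mul_smul, e, mul_smul]
    exact smul_left_cancel_iff g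

theorem AE (hω : Sy ω) (hI : IsoS ω H) (Q : QF F p f q) {a : V ≃ₗ[F] V} (ha : a ∈ H)
    (hA : POrd a ((q ^ 2 + 1) / 2)) (hs : s ∈ H) (hu : u ∈ H) (E : ED ω q s u τ U) : AllS ω H := by
  classical
  by_cases hr : ∃ r ∈ H, RU U r ∧ ∃ v, s (r v) ≠ r (s v)
  · obtain ⟨r, hr, hR, hnc⟩ := hr
    exact AE2a hω hI Q hs hu E ha hA hr hR hnc
  exfalso
  push Not at hr
  have G : Gd ω H q τ s u U := ⟨E, hs, hu, hr⟩
  have hfd : FiniteDimensional F V := FiniteDimensional.of_finrank_pos (by rw [hω.dim]; norm_num)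
  have hfin : Finite (Submodule F V) := inferInstance
  have hfin2 : Finite (V ≃ₗ[F] V) := Finite.of_injective (fun g : V ≃ₗ[F] V => (g : V → V)) DFunLike.coe_injective
  set O : Set (Submodule F V) := {L | ∃ g ∈ H, L = g • U} with hOdef
  have hOG : ∀ L ∈ O, ∃ s u, Gd ω H q τ s u L := by
    rintro L ⟨g, hg, rfl⟩; exact ⟨_, _, G.conj hI hg⟩
  have hOd : ∀ L ∈ O, finrank F L = 2 := fun L hL => by
    obtain ⟨_, _, h⟩ := hOG L hL; exact h.E.dim
  have hOt : ∀ L ∈ O, ∀ v ∈ L, ∀ w ∈ L, ω v w = 0 := fun L hL => by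
    obtain ⟨_, _, h⟩ := hOG L hL; exact h.E.ti
  have hOs : ∀ g ∈ H, ∀ L ∈ O, g • L ∈ O := by
    rintro g hg L ⟨h, hh, rfl⟩; exact ⟨g * h, H.mul_mem hg hh, (mul_smul _ _ _).symm⟩
  have hUO : U ∈ O := ⟨1, H.one_mem, (one_smul _ _).symm⟩
  have hsU : s • U = U := sm_eq hω E.dim E.sU
  have huU : u • U = U := sm_eq hω E.dim (fun v hv => by rw [E.uU v hv]; exact hv)
  have hsu : s * u = u * s := LinearEquiv.ext E.comm
  have hc := dcount hω Q hOd (N := if p = 3 then 4 else 1) (fun x hx => by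
    have := lines4 hω Q hOG hx
    split_ifs with h
    · exact this.1
    · exact this.2 h)
  -- A
  have hnA : (q ^ 2 + 1) / 2 ∣ O.ncard := by
    refine freeorb a _ O (hOs a ha) (fun L hL k hk => ?_)
    exact Acls hω.dim Q hA L (Or.inr (hOd L hL)) (fun v hv => mem_of_sm hk hv)
  obtain ⟨m, hm⟩ := hnA
  have hn : 2 * O.ncard = m * (q ^ 2 + 1) := by
    obtain ⟨t, ht⟩ := Q.ho
    have : q ^ 2 + 1 = 2 * (2 * (t ^ 2 + t) + 1) := by rw [ht]; ring
    rw [hm]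
    have h2 : q ^ 2 + 1 = 2 * ((q ^ 2 + 1) / 2) := by omega
    calc 2 * ((q ^ 2 + 1) / 2 * m) = m * (2 * ((q ^ 2 + 1) / 2)) := by ring
      _ = _ := by rw [← h2]
  have hp1 : 1 < p := by have := Q.p3; omega
  have umod : ∀ S : Set (Submodule F V), S ⊆ O → U ∈ S → (∀ L ∈ S, u • L ∈ S) → S.ncard % p = 1 := by
    intro S hS hU hst
    have h1 : p ∣ (S \ {U}).ncard := by
      refine freeorb u _ _ ?_ ?_
      · rintro L ⟨hL, hne⟩
        refine ⟨hst L hL, fun h => hne ?_⟩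
        rw [Set.mem_singleton_iff] at h ⊢
        rw [← huU] at h
        exact smul_left_cancel u h
      · rintro L ⟨hL, hne⟩ k hk
        exact ufree hω Q E (hOd L (hS hL)) (hOt L (hS hL)) hne hk
    rw [← Set.ncard_diff_singleton_add_one hU, Nat.add_mod, Nat.mod_eq_zero_of_dvd h1, zero_add,
      Nat.mod_mod, Nat.mod_eq_of_lt hp1]
  have hn1 := umod O subset_rfl hUO (hOs u hu)
  set S : Set (Submodule F V) := {L ∈ O | s • L = L} with hSdef
  have hUS : U ∈ S := ⟨hUO, hsU⟩
  have hSO : S ⊆ O := fun L h => h.1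
  have hf := umod S hSO hUS (by
    rintro L ⟨hL, hsL⟩
    refine ⟨hOs u hu L hL, ?_⟩
    rw [← mul_smul, hsu, mul_smul, hsL])
  have hfq : S.ncard ≤ q + 1 := by
    have : (S \ {U}).ncard ≤ q := sfew hω Q E (fun L hL => hOd L hL.1.1) (fun L hL => hOt L hL.1.1)
      (fun L hL => hL.1.2) (fun h => h.2 rfl)
    rw [← Set.ncard_diff_singleton_add_one hUS]; omega
  have hfe : (q + 1) / 2 ∣ (O \ S).ncard := by
    refine freeorb s _ _ ?_ ?_
    · rintro L ⟨hL, hne⟩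
      refine ⟨hOs s hs L hL, fun h => hne ⟨hL, ?_⟩⟩
      exact smul_left_cancel s h.2
    · rintro L ⟨hL, hne⟩ k hk
      obtain ⟨A, B, h1, h2⟩ := E.pw hω k
      apply h2
      by_contra hA0
      apply hne
      refine ⟨hL, sm_eq hω (hOd L hL) (fun v hv => ?_)⟩
      have h3 := L.sub_mem (mem_of_sm hk hv) (L.smul_mem B hv)
      rw [h1, add_sub_cancel_right] at h3
      exact (L.smul_mem_iff hA0).1 h3
  have hsum : (O \ S).ncard + S.ncard = O.ncard := Set.ncard_diff_add_ncard_of_subset hSO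
  have hfe' : (O.ncard : ℤ) ≡ S.ncard [ZMOD ((q + 1) / 2 : ℕ)] := by
    rw [Int.modEq_comm, Int.modEq_iff_dvd]
    rw [← hsum]; push_cast
    rw [add_sub_cancel_right]
    exact_mod_cast hfe
  have hfn : S.ncard ∣ O.ncard := by
    let B : Subgroup (V ≃ₗ[F] V) :=
      { carrier := {g | g ∈ H ∧ s • g • U = g • U}
        one_mem' := ⟨H.one_mem, by rw [one_smul, hsU]⟩
        mul_mem' := by
          rintro g h ⟨hg, hg2⟩ ⟨hh, hh2⟩
          refine ⟨H.mul_mem hg hh, ?_⟩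
          rw [mul_smul]
          exact (blk hω hI Q G hg hg2 _).2 hh2
        inv_mem' := by
          rintro g ⟨hg, hg2⟩
          refine ⟨H.inv_mem hg, ?_⟩
          rw [← blk hω hI Q G hg hg2, smul_inv_smul, hsU] }
    have := blockdvd H B U (fun g hg => hg.1) (fun g hg h => ⟨hg, by rw [h, hsU]⟩)
    convert this using 2
    ext L
    constructor
    · rintro ⟨⟨g, hg, rfl⟩, h⟩; exact ⟨g, ⟨hg, h⟩, rfl⟩
    · rintro ⟨g, ⟨hg, h⟩, rfl⟩; exact ⟨⟨g, hg, rfl⟩, h⟩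
  exact arith Q.hp Q.hq Q.h5 Q.ho Q.e2 (by split_ifs <;> norm_num) (fun h => by rw [if_neg h]) hc hn hn1 hf hfe' hfq hfn

end PSp

open Module
section PSp
open scoped Pointwise
open Polynomial
set_option linter.unusedSectionVars false

variable {F V : Type*} [Field F] [AddCommGroup V] [Module F V] [Finite F] [Finite V]
variable {ω : V →ₗ[F] V →ₗ[F] F} {H : Subgroup (V ≃ₗ[F] V)} {p f q : ℕ}

theorem Pm.powk {g : V ≃ₗ[F] V} (h : Pm g) (k : ℕ) : Pm (g ^ k) := by
  induction k with
  | zero => left; simp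
  | succ k ih =>
    rcases ih with h1 | h1 <;> rcases h with h2 | h2
    · left; intro v; rw [pow_succ, LinearEquiv.mul_apply, h1, h2]
    · right; intro v; rw [pow_succ, LinearEquiv.mul_apply, h1, h2]
    · right; intro v; rw [pow_succ, LinearEquiv.mul_apply, h1, h2]
    · left; intro v; rw [pow_succ, LinearEquiv.mul_apply, h1, h2, neg_neg]

theorem exPOrd (g : V ≃ₗ[F] V) : ∃ n, 0 < n ∧ POrd g n := by
  classical
  have hfin2 : Finite (V ≃ₗ[F] V) := Finite.of_injective (fun g : V ≃ₗ[F] V => (g : V → V)) DFunLike.coe_injective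
  have hex : ∃ n, 0 < n ∧ Pm (g ^ n) := ⟨orderOf g, orderOf_pos g, by left; simp [pow_orderOf_eq_one]⟩
  have h0 := Nat.find_spec hex
  have hmin := fun m => Nat.find_min hex (m := m)
  generalize Nat.find hex = n at *
  refine ⟨n, h0.1, fun k => ⟨fun hk => ?_, ?_⟩⟩
  · by_contra hd
    refine hmin (k % n) (Nat.mod_lt _ h0.1) ⟨Nat.pos_of_ne_zero (fun h => hd (Nat.dvd_of_mod_eq_zero h)), ?_⟩
    have h1 := h0.2.powk (k / n)
    rw [← pow_mul] at h1
    have e : g ^ k = g ^ (n * (k / n)) * g ^ (k % n) := by rw [← pow_add, Nat.div_add_mod]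
    rw [e] at hk
    rcases h1 with h1 | h1 <;> rcases hk with h2 | h2 <;>
      simp only [LinearEquiv.mul_apply, h1] at h2
    · left; exact h2
    · right; exact h2
    · right; intro v; exact neg_eq_iff_eq_neg.1 (h2 v)
    · left; intro v; exact neg_injective (h2 v)
  · rintro ⟨t, rfl⟩
    rw [pow_mul]; exact h0.2.powk t

theorem Sy.basis (hω : Sy ω) : ∃ e f e' f' : V, ω e f = 1 ∧ ω e' f' = 1 ∧ ω e e' = 0 ∧ ω e f' = 0 ∧
    ω f e' = 0 ∧ ω f f' = 0 := by
  have hnt : Nontrivial V := Module.nontrivial_of_finrank_pos (R := F) (by rw [hω.dim]; norm_num)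
  obtain ⟨x, hx⟩ := exists_ne (0 : V)
  obtain ⟨y, hy⟩ := hω.nd1 hx
  obtain ⟨a, b, h⟩ := hω.complete hy
  exact ⟨x, y, a, b, hy, h⟩

theorem AEx (hω : Sy ω) (Q : QF F p f q) : ∃ g : V ≃ₗ[F] V, (∀ v w, ω (g v) (g w) = ω v w) ∧
    POrd g ((q ^ 2 + 1) / 2) := by
  obtain ⟨e1, f1, e2, f2, h1, h2, h3, h4, h5, h6⟩ := hω.basis
  obtain ⟨ζ, hζ⟩ := primRoot (F := F) (q ^ 2 + 1) (by push_cast; rw [Q.q0]; simp)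
  have h0 : ζ ≠ 0 := hζ.ne_zero (by omega)
  have hc : ζ * ζ⁻¹ = 1 := mul_inv_cancel₀ h0
  obtain ⟨η, hη⟩ : ∃ η, η = ζ ^ q := ⟨_, rfl⟩
  have hη0 : η ≠ 0 := by rw [hη]; exact pow_ne_zero _ h0
  have hc' : η * η⁻¹ = 1 := mul_inv_cancel₀ hη0
  have hq : η ^ q = ζ⁻¹ := by
    apply eq_inv_of_mul_eq_one_left
    rw [hη, ← pow_mul, ← pow_succ, ← pow_two, hζ.pow_eq_one]
  obtain ⟨α, hα⟩ := memF (F := F) (a := ζ + ζ⁻¹ + (η + η⁻¹)) (by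
    rw [Q.hc, Q.frob, Q.frob, Q.frob, inv_pow, inv_pow, ← hη, hq, inv_inv]; ring)
  obtain ⟨β, hβ⟩ := memF (F := F) (a := (ζ + ζ⁻¹) * (η + η⁻¹)) (by
    rw [Q.hc, mul_pow, Q.frob, Q.frob, inv_pow, inv_pow, ← hη, hq, inv_inv]; ring)
  have hP : ζ ^ 4 - algebraMap F _ α * ζ ^ 3 + (2 + algebraMap F _ β) * ζ ^ 2 - algebraMap F _ α * ζ + 1 = 0 := by
    rw [hα, hβ]
    field_simp
    ring
  obtain ⟨g, hi, g1, g2, g3, g4⟩ := mkIso hω h1 h2 h3 h4 h5 h6 (a := e2) (b := f2 + α • f1) (a' := f1)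
    (b' := - e1 + α • e2 - (2 + β) • f1)
    (by simp [h2, hω.skew e2 f1, h5])
    (by simp [hω.alt, hω.skew f1 e1, h1, h5])
    (by rw [hω.skew, h5, neg_zero])
    (by simp [hω.alt, hω.skew e2 e1, h3, hω.skew e2 f1, h5])
    (by simp [hω.alt, hω.skew f2 f1, h6])
    (by simp [hω.alt, hω.skew f2 e1, h4, hω.skew f2 e2, h2, hω.skew f2 f1, h6, hω.skew f1 e1, h1, h5])
  let Λ : V →ₗ[F] AlgebraicClosure F := (ω.flip f1).smulRight 1 - (ω.flip e1).smulRight (ζ ^ 2)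
    + (ω.flip f2).smulRight ζ - (ω.flip e2).smulRight (ζ ^ 3 - algebraMap F _ α * ζ ^ 2)
  have hΛ : ∀ v, Λ v = ω v f1 • 1 - ω v e1 • ζ ^ 2 + ω v f2 • ζ - ω v e2 • (ζ ^ 3 - algebraMap F _ α * ζ ^ 2) :=
    fun v => by simp [Λ]
  have l1 : Λ e1 = 1 := by rw [hΛ]; simp [hω.alt, h1, h3, h4]
  have l2 : Λ f1 = ζ ^ 2 := by rw [hΛ]; simp [hω.alt, hω.skew f1 e1, h1, h5, h6]
  have l3 : Λ e2 = ζ := by rw [hΛ]; simp [hω.alt, hω.skew e2 e1, hω.skew e2 f1, h2, h3, h5]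
  have l4 : Λ f2 = ζ ^ 3 - algebraMap F _ α * ζ ^ 2 := by
    rw [hΛ]; simp [hω.alt, hω.skew f2 e1, hω.skew f2 f1, hω.skew f2 e2, h2, h4, h6]
  have hΛg : ∀ v, Λ (g v) = ζ * Λ v := by
    intro v
    rw [hω.expand h1 h2 h3 h4 h5 h6 v]
    simp only [map_add, map_sub, map_smul, map_neg, g1, g2, g3, g4, l1, l2, l3, l4, Algebra.smul_def, map_add, map_ofNat]
    linear_combination (algebraMap F (AlgebraicClosure F) (ω v e2)) * hP
  have hΛk : ∀ k : ℕ, Λ ((g ^ k) e1) = ζ ^ k := by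
    intro k
    induction k with
    | zero => simpa using l1
    | succ k ih => rw [pow_succ', LinearEquiv.mul_apply, hΛg, ih, pow_succ']
  have hdvd : ∀ k, Pm (g ^ k) → (q ^ 2 + 1) / 2 ∣ k := by
    intro k hk
    have h1 : ζ ^ (2 * k) = 1 := by
      have := hΛk k
      rw [mul_comm, pow_mul]
      rcases hk with hk | hk
      · rw [hk, l1] at this; rw [← this]; ring
      · rw [hk, map_neg, l1] at this; rw [← this]; ring
    have h2 := hζ.dvd_of_pow_eq_one _ h1
    obtain ⟨t, ht⟩ := Q.ho
    have e : q ^ 2 + 1 = 2 * (2 * (t ^ 2 + t) + 1) := by rw [ht]; ring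
    rw [e] at h2 ⊢
    rw [Nat.mul_div_cancel_left _ (by norm_num)]
    exact Nat.dvd_of_mul_dvd_mul_left (by norm_num) h2
  obtain ⟨n, hn, hP⟩ := exPOrd g
  obtain ⟨m, hm⟩ := hdvd n ((hP n).2 dvd_rfl)
  refine ⟨g ^ m, fun v w => iso_pow hi m v w, POrd.pow (m := m) (by rw [mul_comm, ← hm]; exact hP) ?_⟩
  rcases Nat.eq_zero_or_pos m with h | h
  · rw [h, mul_zero] at hm; omega
  · exact h

theorem DEx' (hω : Sy ω) (Q : QF F p f q) : ∃ g : V ≃ₗ[F] V, (∀ v w, ω (g v) (g w) = ω v w) ∧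
    POrd g (p * (q + 1)) := by
  obtain ⟨x, y, -, -, h, -⟩ := hω.basis
  obtain ⟨g, h1, h2, -⟩ := DEx hω Q (x := x) (by rintro rfl; simp at h) (c := 1) one_ne_zero
  exact ⟨g, h1, h2⟩

theorem EEx (hω : Sy ω) (Q : QF F p f q) : ∃ g : V ≃ₗ[F] V, (∀ v w, ω (g v) (g w) = ω v w) ∧
    POrd g (p * ((q + 1) / 2)) ∧ ∀ h : V ≃ₗ[F] V, (∀ v w, ω (h v) (h w) = ω v w) → POrd h (p * (q + 1)) →
    ¬ ∀ v, (h ^ (2 * (q + 1))) v = (g ^ (2 * (q + 1))) v := by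
  have hch := Q.hch
  have htwo := Q.two
  obtain ⟨e1, f1, e2, f2, h1, h2, h3, h4, h5, h6⟩ := hω.basis
  obtain ⟨τ, irr, hτ⟩ := Xi (V := V) Q
  have ht4 : τ ^ 2 ≠ 4 := by
    intro h; apply irr (τ / 2); field_simp; linear_combination -h
  obtain ⟨s, si, s1, s2, s3, s4⟩ := mkIso hω h1 h2 h3 h4 h5 h6 (a := e2) (b := f2 + τ • f1)
    (a' := τ • e2 - e1) (b' := - f1)
    (by simp [h2, hω.skew e2 f1, h5])
    (by simp [hω.skew e2 f1, h1, h5])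
    (by simp [hω.alt, hω.skew e2 e1, h3])
    (by simp [hω.skew e2 f1, h5])
    (by simp [hω.skew f2 e1, h4, hω.skew f2 e2, h2, hω.skew f1 e1, h1, h5])
    (by simp [hω.alt, hω.skew f2 f1, h6])
  obtain ⟨u, ui, u1, u2, u3, u4⟩ := mkIso hω h1 h2 h3 h4 h5 h6 (a := e1) (b := f1 + ((2 : F) • e1 - τ • e2))
    (a' := e2) (b' := f2 + ((2 : F) • e2 - τ • e1))
    (by simp [hω.alt, h1, h3])
    (by simp [hω.alt, h2, hω.skew e2 e1, h3])
    h3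
    (by simp [hω.alt, h4, h3])
    (by simp [hω.alt, h5, h3])
    (by simp [hω.alt, h5, h6, h4, h3, h2, hω.skew f1 e1, h1, hω.skew e2 e1])
  have rel : ∀ v, s (s v) = τ • s v - v := by
    intro v
    rw [hω.expand h1 h2 h3 h4 h5 h6 v]
    simp only [map_add, map_sub, map_smul, map_neg, s1, s2, s3, s4]
    module
  have comm : ∀ v, s (u v) = u (s v) := by
    intro v
    rw [hω.expand h1 h2 h3 h4 h5 h6 v]
    simp only [map_add, map_sub, map_smul, map_neg, s1, s2, s3, s4, u1, u2, u3, u4]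
    module
  have hsu : Commute s u := LinearEquiv.ext comm
  have ue1 : ∀ k : ℕ, (u ^ k) e1 = e1 := fun k => by
    have := pow_eig (s := u) (c := 1) (v := e1) (by simpa using u1) k
    simpa using this
  have ue2 : ∀ k : ℕ, (u ^ k) e2 = e2 := fun k => by
    have := pow_eig (s := u) (c := 1) (v := e2) (by simpa using u3) k
    simpa using this
  have uf1 : ∀ k : ℕ, (u ^ k) f1 = f1 + (k : F) • ((2 : F) • e1 - τ • e2) := by
    intro k
    induction k with
    | zero => simp
    | succ k ih =>
      rw [pow_succ', LinearEquiv.mul_apply, ih]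
      simp only [map_add, map_sub, map_smul, u1, u2, u3]
      push_cast; module
  have uf2 : ∀ k : ℕ, (u ^ k) f2 = f2 + (k : F) • ((2 : F) • e2 - τ • e1) := by
    intro k
    induction k with
    | zero => simp
    | succ k ih =>
      rw [pow_succ', LinearEquiv.mul_apply, ih]
      simp only [map_add, map_sub, map_smul, u1, u4, u3]
      push_cast; module
  have e10 : e1 ≠ 0 := by rintro rfl; simp at h1
  have sone : ∀ k, q + 1 ∣ k → ∀ v, (s ^ k) v = v := by
    intro k hk v
    by_cases hv : v = 0
    · simp [hv]
    · exact (hτ s v hv (rel v) k).2 hk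
  have gk : ∀ k : ℕ, ∀ v, ((s * u) ^ k) v = (s ^ k) ((u ^ k) v) := fun k v => by
    rw [hsu.mul_pow, LinearEquiv.mul_apply]
  refine ⟨s * u, fun v w => by rw [LinearEquiv.mul_apply, LinearEquiv.mul_apply, si, ui], fun k => ⟨?_, ?_⟩, ?_⟩
  · intro hk
    have hk2 : ∀ v, ((s * u) ^ (k * 2)) v = v := by
      intro v
      rw [pow_mul, pow_two, LinearEquiv.mul_apply]
      rcases hk with hk | hk
      · rw [hk, hk]
      · rw [hk, hk, neg_neg]
    have d1 : q + 1 ∣ k * 2 := by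
      rw [← hτ s e1 e10 (rel e1)]
      have := hk2 e1
      rwa [gk, ue1] at this
    have d2 : (q + 1) / 2 ∣ k := by
      have := Q.e2
      rw [this, mul_comm] at d1
      exact Nat.dvd_of_mul_dvd_mul_right (by norm_num) d1
    have d3 := hk2 f1
    rw [gk, sone _ d1, uf1] at d3
    have d4 := congrArg (fun v => ω v f1) d3
    simp [hω.alt, h1, hω.skew e2 f1, h5, htwo] at d4
    rw [CharP.cast_eq_zero_iff F p] at d4
    apply Nat.Coprime.mul_dvd_of_dvd_of_dvd _ d4 d2
    rw [Q.hp.coprime_iff_not_dvd]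
    intro h
    have : p ∣ q + 1 := by rw [Q.e2]; exact h.mul_left 2
    rw [← CharP.cast_eq_zero_iff F p] at this
    push_cast at this; rw [Q.q0] at this; simp at this
  · intro hk
    have hu : ∀ v, (u ^ k) v = v := by
      have e1 : (k : F) = 0 := (CharP.cast_eq_zero_iff F p k).2 (dvd_of_mul_right_dvd hk)
      intro v
      rw [hω.expand h1 h2 h3 h4 h5 h6 v]
      simp [ue1, ue2, uf1, uf2, e1]
    have hs : Pm (s ^ k) := by
      obtain ⟨t, rfl⟩ := dvd_of_mul_left_dvd hk
      rw [pow_mul]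
      apply Pm.powk
      rcases LemR Q ht4 with ⟨⟨c, hc⟩, -⟩ | ⟨-, ε, hε, hd⟩
      · exact absurd hc (irr c)
      · rcases hε with rfl | rfl
        · left; intro v; rw [rel_pow (rel v) hd, one_smul]
        · right; intro v; rw [rel_pow (rel v) hd, neg_one_smul]
    rcases hs with hs | hs
    · left; intro v; rw [gk, hu, hs]
    · right; intro v; rw [gk, hu, hs]
  · intro h hi hD hall
    obtain ⟨c, x, -, -, -, -, -, -, -, -, -, hT⟩ := Dcls hω Q hi hD
    have hg : ∀ v, (u ^ (2 * (q + 1))) v = Tv ω c x v := by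
      intro v
      rw [← hT, hall, gk, sone _ (dvd_mul_left _ _)]
    have a1 := hg f1
    have a2 := hg f2
    rw [uf1, Tv] at a1
    rw [uf2, Tv] at a2
    have hc2 : ((2 * (q + 1) : ℕ) : F) = 2 := by push_cast; rw [Q.q0]; ring
    rw [hc2] at a1 a2
    have b1 := add_left_cancel a1
    have b2 := add_left_cancel a2
    generalize c * ω f1 x = α at b1
    generalize c * ω f2 x = β at b2
    have c1 : β • ((2 : F) • ((2 : F) • e1 - τ • e2)) = α • ((2 : F) • ((2 : F) • e2 - τ • e1)) := by
      rw [b1, b2, smul_comm]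
    have c2 := congrArg (fun v => ω v f1) c1
    have c3 := congrArg (fun v => ω v f2) c1
    simp [hω.alt, h1, h2, h4, hω.skew e2 f1, h5, htwo] at c2 c3
    have hb : β = 0 := by
      have h' : 2 * (β * (τ ^ 2 - 4)) = 0 := by linear_combination -τ * c3 - 2 * c2
      have := (mul_eq_zero.1 h').resolve_left htwo
      exact (mul_eq_zero.1 this).resolve_right (sub_ne_zero.2 ht4)
    rw [hb, zero_smul] at b2
    have := congrArg (fun v => ω v f2) b2
    simp [h2, h4, htwo] at this

end PSp

open Module
section PSp
open scoped Pointwise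
set_option linter.unusedSectionVars false

variable {F V : Type*} [Field F] [AddCommGroup V] [Module F V] [Finite F] [Finite V]
variable {ω : V →ₗ[F] V →ₗ[F] F} {p f q : ℕ}
variable {S : Type*} [Group S] {ρ : S →* (V ≃ₗ[F] V)}

structure Rp (ω : V →ₗ[F] V →ₗ[F] F) (ρ : S →* (V ≃ₗ[F] V)) : Prop where
  inj : Function.Injective ρ
  iso : ∀ A v w, ω (ρ A v) (ρ A w) = ω v w
  sur : ∀ g : V ≃ₗ[F] V, (∀ v w, ω (g v) (g w) = ω v w) → ∃ A, ρ A = g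

theorem Rp.cen (hω : Sy ω) (R : Rp ω ρ) (A : S) : A ∈ Subgroup.center S ↔ Pm (ρ A) := by
  rw [Subgroup.mem_center_iff]
  constructor
  · intro h
    have hsc : ∀ x : V, ∃ c : F, ρ A x = c • x := by
      intro x
      by_cases hx : x = 0
      · exact ⟨0, by simp [hx]⟩
      obtain ⟨y, hy⟩ := hω.nd1 hx
      let φ : V →ₗ[F] V := LinearMap.id + (ω.flip x).smulRight x
      have hφ : ∀ v, φ v = Tv ω 1 x v := fun v => by simp [φ, Tv]
      obtain ⟨t, ht⟩ := isoEquiv hω φ (fun v w => by rw [hφ, hφ, Tv_iso hω])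
      obtain ⟨B, hB⟩ := R.sur t (fun v w => by rw [ht, ht, hφ, hφ, Tv_iso hω])
      have e := congrArg (fun C => ρ C y) (h B)
      simp only [map_mul, LinearEquiv.mul_apply, hB, ht, hφ, Tv, one_mul, map_add, map_smul] at e
      have e2 := add_left_cancel e
      rw [hω.skew y x, hy] at e2
      refine ⟨- ω (ρ A y) x, ?_⟩
      rw [neg_smul, e2]; simp
    obtain ⟨x, y, -, -, hxy, -⟩ := hω.basis
    have hx0 : x ≠ 0 := by rintro rfl; simp at hxy
    have hall : ∃ a : F, ∀ v, ρ A v = a • v := by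
      obtain ⟨a, ha⟩ := LinearMap.exists_eq_smul_id_of_forall_notLinearIndependent
        (f := (ρ A : V →ₗ[F] V)) (fun v => by
          obtain ⟨c, hc⟩ := hsc v
          intro hli
          have := LinearIndependent.pair_iff.1 hli c (-1) (by simp [hc])
          simp at this)
      exact ⟨a, fun v => by have := congrArg (fun m => m v) ha; simpa using this⟩
    obtain ⟨a, ha⟩ := hall
    have h1 := R.iso A x y
    rw [ha, ha] at h1
    simp [hxy] at h1
    rcases mul_self_eq_one_iff.1 h1 with rfl | rfl
    · left; intro v; rw [ha, one_smul]
    · right; intro v; rw [ha, neg_one_smul]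
  · rintro (h | h) B <;> apply R.inj <;> ext v <;> simp [h]

theorem Rp.ord (hω : Sy ω) (R : Rp ω ρ) (A : S) (n : ℕ) :
    orderOf (A : S ⧸ Subgroup.center S) = n ↔ POrd (ρ A) n := by
  have key : ∀ k : ℕ, Pm (ρ A ^ k) ↔ orderOf (A : S ⧸ Subgroup.center S) ∣ k := by
    intro k
    rw [← map_pow, ← R.cen hω, orderOf_dvd_iff_pow_eq_one, ← QuotientGroup.mk_pow, QuotientGroup.eq_one_iff]
  constructor
  · rintro rfl; exact key
  · intro h
    apply Nat.dvd_antisymm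
    · exact (key n).1 ((h n).2 dvd_rfl)
    · exact (h _).1 ((key _).2 dvd_rfl)

def tE {G : Type*} [Group G] (p q : ℕ) (g : G) : Prop :=
  orderOf g = p * ((q + 1) / 2) ∧ ∀ h : G, orderOf h = p * (q + 1) → h ^ (q + 1) ≠ g ^ (q + 1)

theorem Rp.two (hω : Sy ω) (R : Rp ω ρ) (Q : QF F p f q) (X : Subgroup (S ⧸ Subgroup.center S)) (hX : X ≠ ⊤) :
    (∀ a ∈ X, ∀ b ∈ X, orderOf a = (q ^ 2 + 1) / 2 → orderOf b ≠ p * (q + 1)) ∧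
    (∀ a ∈ X, ∀ b ∈ X, orderOf a = (q ^ 2 + 1) / 2 → ¬ tE p q b) ∧
    (∀ a ∈ X, ∀ b ∈ X, orderOf a = p * (q + 1) → ¬ tE p q b) := by
  set Y : Subgroup (V ≃ₗ[F] V) := (X.comap (QuotientGroup.mk' (Subgroup.center S))).map ρ with hY
  have hI : IsoS ω Y := by
    rintro g ⟨A, -, rfl⟩ v w; exact R.iso A v w
  have hneg : Has Y (fun v => -v) := by
    obtain ⟨A, hA⟩ := R.sur (LinearEquiv.neg F) (fun v w => by simp)
    refine ⟨ρ A, ⟨A, ?_, rfl⟩, fun v => by rw [hA]; rfl⟩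
    have : (A : S ⧸ Subgroup.center S) = 1 := by
      rw [QuotientGroup.eq_one_iff, R.cen hω]
      right; intro v; rw [hA]; rfl
    simp [Subgroup.mem_comap, this]
  have hfin : ¬ AllS ω Y := by
    intro h
    apply hX
    rw [Subgroup.eq_top_iff']
    intro x
    obtain ⟨A, rfl⟩ := QuotientGroup.mk_surjective x
    obtain ⟨B, hB, hAB⟩ := h (ρ A) (R.iso A)
    have := R.inj hAB
    subst this
    exact hB
  have hm : ∀ A : S, (A : S ⧸ Subgroup.center S) ∈ X → ρ A ∈ Y := fun A hA => ⟨A, hA, rfl⟩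
  have hE : ∀ A : S, tE p q (A : S ⧸ Subgroup.center S) →
      ∃ τ U, ED ω q (ρ A ^ p) (ρ A ^ (q + 1)) τ U := by
    rintro A ⟨h1, h2⟩
    refine Ecls hω Q (R.iso A) ((R.ord hω A _).1 h1) (fun h hi hh hcon => ?_)
    obtain ⟨B, rfl⟩ := R.sur h hi
    apply h2 B ((R.ord hω B _).2 hh)
    rw [← QuotientGroup.mk_pow, ← QuotientGroup.mk_pow]
    congr 1
    apply R.inj
    rw [map_pow, map_pow]
    exact LinearEquiv.ext hcon
  refine ⟨?_, ?_, ?_⟩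
  all_goals
    intro a ha b hb h1 h2
    obtain ⟨A, rfl⟩ := QuotientGroup.mk_surjective a
    obtain ⟨B, rfl⟩ := QuotientGroup.mk_surjective b
    apply hfin
  · exact AD hω hI Q hneg (hm A ha) (hm B hb) ((R.ord hω A _).1 h1) ((R.ord hω B _).1 h2)
  · obtain ⟨τ, U, E⟩ := hE B h2
    exact AE hω hI Q (hm A ha) ((R.ord hω A _).1 h1) (Y.pow_mem (hm B hb) _) (Y.pow_mem (hm B hb) _) E
  · obtain ⟨τ, U, E⟩ := hE B h2
    exact DE hω hI Q hneg (Y.pow_mem (hm B hb) _) (Y.pow_mem (hm B hb) _) E (hm A ha) ((R.ord hω A _).1 h1)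

theorem Rp.main (hω : Sy ω) (R : Rp ω ρ) (Q : QF F p f q) (X Y : Subgroup (S ⧸ Subgroup.center S)) (hX : X ≠ ⊤)
    (hY : Y ≠ ⊤) : ∃ g : S ⧸ Subgroup.center S, ∀ φ : (S ⧸ Subgroup.center S) ≃* (S ⧸ Subgroup.center S),
      φ g ∉ X ∧ φ g ∉ Y := by
  obtain ⟨x1, x2, x3⟩ := R.two hω Q X hX
  obtain ⟨y1, y2, y3⟩ := R.two hω Q Y hY
  have tEφ : ∀ (φ : (S ⧸ Subgroup.center S) ≃* (S ⧸ Subgroup.center S)) g, tE p q g → tE p q (φ g) := by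
    rintro φ g ⟨h1, h2⟩
    refine ⟨by rw [MulEquiv.orderOf_eq, h1], fun h hh hcon => ?_⟩
    apply h2 (φ.symm h) (by rw [MulEquiv.orderOf_eq, hh])
    apply φ.injective
    rw [map_pow, map_pow, ← hcon, MulEquiv.apply_symm_apply]
  obtain ⟨a, ha⟩ : ∃ a : S ⧸ Subgroup.center S, orderOf a = (q ^ 2 + 1) / 2 := by
    obtain ⟨g, hg, ho⟩ := AEx hω Q
    obtain ⟨A, rfl⟩ := R.sur g hg
    exact ⟨A, (R.ord hω A _).2 ho⟩
  obtain ⟨d, hd⟩ : ∃ a : S ⧸ Subgroup.center S, orderOf a = p * (q + 1) := by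
    obtain ⟨g, hg, ho⟩ := DEx' hω Q
    obtain ⟨A, rfl⟩ := R.sur g hg
    exact ⟨A, (R.ord hω A _).2 ho⟩
  obtain ⟨e, he⟩ : ∃ a : S ⧸ Subgroup.center S, tE p q a := by
    obtain ⟨g, hg, ho, hn⟩ := EEx hω Q
    obtain ⟨A, rfl⟩ := R.sur g hg
    refine ⟨A, (R.ord hω A _).2 ho, fun h hh hcon => ?_⟩
    obtain ⟨B, rfl⟩ := QuotientGroup.mk_surjective h
    apply hn (ρ B) (R.iso B) ((R.ord hω B _).1 hh)
    rw [← QuotientGroup.mk_pow, ← QuotientGroup.mk_pow, QuotientGroup.eq, R.cen hω] at hcon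
    have e1 : ∀ v, ρ (A ^ (q + 1)) v = ρ (B ^ (q + 1)) (ρ ((B ^ (q + 1))⁻¹ * A ^ (q + 1)) v) := by
      intro v; rw [← LinearEquiv.mul_apply, ← map_mul, mul_inv_cancel_left]
    intro v
    rw [mul_comm 2, pow_mul, pow_mul, pow_two, pow_two, LinearEquiv.mul_apply,
      LinearEquiv.mul_apply, ← map_pow ρ B, ← map_pow ρ A, e1, e1]
    rcases hcon with h | h <;> simp only [h, map_neg, neg_neg]
  by_contra hcon
  push Not at hcon
  have key : ∀ g, ∃ φ : (S ⧸ Subgroup.center S) ≃* (S ⧸ Subgroup.center S), φ g ∈ X ∨ φ g ∈ Y := by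
    intro g
    obtain ⟨φ, h⟩ := hcon g
    exact ⟨φ, or_iff_not_imp_left.2 h⟩
  obtain ⟨φ1, ka⟩ := key a
  obtain ⟨φ2, kd⟩ := key d
  obtain ⟨φ3, ke⟩ := key e
  have ha' : orderOf (φ1 a) = (q ^ 2 + 1) / 2 := by rw [MulEquiv.orderOf_eq, ha]
  have hd' : orderOf (φ2 d) = p * (q + 1) := by rw [MulEquiv.orderOf_eq, hd]
  have he' := tEφ φ3 e he
  rcases ka with ka | ka <;> rcases kd with kd | kd <;> rcases ke with ke | ke
  · exact x1 _ ka _ kd ha' hd'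
  · exact x1 _ ka _ kd ha' hd'
  · exact x2 _ ka _ ke ha' he'
  · exact y3 _ kd _ ke hd' he'
  · exact x3 _ kd _ ke hd' he'
  · exact y2 _ ka _ ke ha' he'
  · exact y1 _ ka _ kd ha' hd'
  · exact y1 _ ka _ kd ha' hd'

end PSp


/-- The projective symplectic group `PSp_{2m}(F)`: the quotient of the symplectic group
`Sp_{2m}(F)` by its center. -/
abbrev ProjSp (m : ℕ) (F : Type*) [Field F] : Type _ :=
  ↥(Matrix.symplecticGroup (Fin m) F) ⧸
    Subgroup.center ↥(Matrix.symplecticGroup (Fin m) F)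

noncomputable def rhoSp (F : Type*) [Field F] :
    Matrix.symplecticGroup (Fin 2) F →* ((Fin 2 ⊕ Fin 2 → F) ≃ₗ[F] (Fin 2 ⊕ Fin 2 → F)) :=
  (LinearMap.GeneralLinearGroup.generalLinearEquiv F (Fin 2 ⊕ Fin 2 → F)).toMonoidHom.comp
    (MonoidHom.toHomUnits
      (((Matrix.toLinAlgEquiv' : _ ≃ₐ[F] ((Fin 2 ⊕ Fin 2 → F) →ₗ[F] _)) : _ →* _).comp
        (Submonoid.subtype (Matrix.symplecticGroup (Fin 2) F))))

theorem rhoSp_apply (F : Type*) [Field F] (A : Matrix.symplecticGroup (Fin 2) F) (v : Fin 2 ⊕ Fin 2 → F) :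
    rhoSp F A v = (A : Matrix _ _ F).mulVec v := rfl

theorem rhoSp_ok (F : Type*) [Field F] [Finite F] :
    Sy (Matrix.toLinearMap₂' F (Matrix.J (Fin 2) F)) ∧ Rp (Matrix.toLinearMap₂' F (Matrix.J (Fin 2) F)) (rhoSp F) := by
  have hJ : ∀ (A : Matrix (Fin 2 ⊕ Fin 2) (Fin 2 ⊕ Fin 2) F), A ∈ Matrix.symplecticGroup (Fin 2) F ↔ ∀ v w,
      Matrix.toLinearMap₂' F (Matrix.J (Fin 2) F) (A.mulVec v) (A.mulVec w) =
      Matrix.toLinearMap₂' F (Matrix.J (Fin 2) F) v w := by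
    intro A
    have e : ∀ v w, Matrix.toLinearMap₂' F (Matrix.J (Fin 2) F) (A.mulVec v) (A.mulVec w)
        = Matrix.toLinearMap₂' F (A.transpose * Matrix.J (Fin 2) F * A) v w := by
      intro v w
      rw [Matrix.toLinearMap₂'_apply', Matrix.toLinearMap₂'_apply', ← Matrix.mulVec_mulVec, ← Matrix.mulVec_mulVec,
        Matrix.dotProduct_mulVec v, Matrix.vecMul_transpose]
    rw [SymplecticGroup.mem_iff']
    constructor
    · intro h v w; rw [e, h]
    · intro h
      apply (Matrix.toLinearMap₂' (R := F) (N₂ := F) (S₁ := F) (S₂ := F) (n := Fin 2 ⊕ Fin 2) (m := Fin 2 ⊕ Fin 2)).injective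
      apply LinearMap.ext; intro v; apply LinearMap.ext; intro w
      rw [← e, h]
  refine ⟨⟨fun v => ?_, fun v hv => ?_, ?_⟩, ⟨fun A B h => ?_, fun A v w => ?_, fun g hg => ?_⟩⟩
  · simp [Matrix.toLinearMap₂'_apply', Matrix.J, Matrix.fromBlocks_mulVec, dotProduct, Fin.sum_univ_two,
      Fintype.sum_sum_type]
    ring
  · have h1 := fun j => hv (Pi.single j 1)
    simp [Matrix.toLinearMap₂'_apply', Matrix.J, dotProduct,
      Fintype.sum_sum_type, Matrix.one_apply] at h1
    funext j
    rcases j with j | j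
    · fin_cases j
      · exact h1.2.1
      · exact h1.2.2
    · fin_cases j
      · exact h1.1.1
      · exact h1.1.2
  · simp
  · apply Subtype.ext
    apply Matrix.ext_of_mulVec_single
    intro j
    rw [← rhoSp_apply, h, rhoSp_apply]
  · rw [rhoSp_apply, rhoSp_apply]
    exact (hJ A).1 A.2 v w
  · have hm : ∀ v, (LinearMap.toMatrix' (g : (Fin 2 ⊕ Fin 2 → F) →ₗ[F] _)).mulVec v = g v := fun v => by
      rw [LinearMap.toMatrix'_mulVec]; rfl
    refine ⟨⟨LinearMap.toMatrix' (g : (Fin 2 ⊕ Fin 2 → F) →ₗ[F] _), (hJ _).2 (fun v w => by rw [hm, hm, hg])⟩, ?_⟩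
    apply LinearEquiv.ext
    intro v
    rw [rhoSp_apply]; exact hm v

theorem gammaW_PSp4_ge_three (q : ℕ) (hq : IsPrimePow q) (hodd : Odd q) (hq3 : 3 < q)
    (F : Type*) [Field F] [Fintype F] (hF : Fintype.card F = q)
    (H K : Subgroup (ProjSp 2 F)) (hH : H ≠ ⊤) (hK : K ≠ ⊤) :
    ∃ g : ProjSp 2 F, ∀ φ : ProjSp 2 F ≃* ProjSp 2 F, φ g ∉ H ∧ φ g ∉ K := by
  obtain ⟨p, hp⟩ := CharP.exists F
  obtain ⟨n, hpp, hc⟩ := FiniteField.card F p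
  have Q : QF F p n q := ⟨hpp, by rw [← hF, hc], by rcases hodd with ⟨k, hk⟩; omega, hodd,
    by rw [Nat.card_eq_fintype_card, hF], hp⟩
  obtain ⟨h1, h2⟩ := rhoSp_ok F
  exact h2.main h1 Q H K hH hK
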